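/- For every positive integer n, the following identity of formal power series in x_0,x_1,x_2,… with polynomial coefficients in q holds: Σ_{w∈FC(B_n)} q^{bl(w^{-1})}·F^B_{Des_B(w)}(x_0,x_1,…) = Σ_{k=1}^{n} (Σ_{j=0}^{n} b_{n,k,j} q^j)·h_k(x_1,x_2,…)·h_{n−k}(x_0,x_1,…) + Σ_{k=0}^{⌊n/2⌋} (Σ_{j=0}^{n} a_{n,k,j} q^j)·s_{(n−k,k)}(x_0,x_1,…). In particular, for every 1≤j≤n the set {w∈FC(B_n) : bl(w^{-1})=j} is Chow type-B Schur-positive. -/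

import Mathlib

open scoped Classical

noncomputable section

namespace Paper

/-- Membership in the hyperoctahedral group `B_n`, realized inside `Equiv.Perm ℤ`:
`w(-i) = -w(i)` and `w` fixes every integer of absolute value larger than `n`. -/
def InB (n : ℕ) (w : Equiv.Perm ℤ) : Prop :=
  (∀ i : ℤ, w (-i) = - w i) ∧ ∀ i : ℤ, (n : ℤ) < |i| → w i = i

/-- Window entry `w_i` with the convention `w_0 = 0`. -/
def went (w : Equiv.Perm ℤ) (i : ℕ) : ℤ := if i = 0 then 0 else w (i : ℤ)

/-- Stembridge's pattern criterion: `w ∈ B_n` is fully commutative iff there are no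
indices `i<j` with `0 > w_i > w_j`, no `i<j<k` with `|w_i| > w_j > w_k`, and no
`i<j<k` with `-w_j > |w_i| > w_k`. -/
def IsFC (n : ℕ) (w : Equiv.Perm ℤ) : Prop :=
  InB n w ∧
  (¬ ∃ i j : ℕ, 1 ≤ i ∧ i < j ∧ j ≤ n ∧ w (j : ℤ) < w (i : ℤ) ∧ w (i : ℤ) < 0) ∧
  (¬ ∃ i j k : ℕ, 1 ≤ i ∧ i < j ∧ j < k ∧ k ≤ n ∧
      w (j : ℤ) < |w (i : ℤ)| ∧ w (k : ℤ) < w (j : ℤ)) ∧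
  (¬ ∃ i j k : ℕ, 1 ≤ i ∧ i < j ∧ j < k ∧ k ≤ n ∧
      |w (i : ℤ)| < - w (j : ℤ) ∧ w (k : ℤ) < |w (i : ℤ)|)

/-- Membership in `S_n ⊆ B_n`: all window entries positive. -/
def InS (n : ℕ) (w : Equiv.Perm ℤ) : Prop :=
  InB n w ∧ ∀ i : ℕ, 1 ≤ i → i ≤ n → 0 < w (i : ℤ)

/-- 321-avoidance of the window. -/
def Avoids321 (n : ℕ) (w : Equiv.Perm ℤ) : Prop :=
  ¬ ∃ i j k : ℕ, 1 ≤ i ∧ i < j ∧ j < k ∧ k ≤ n ∧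
    w (k : ℤ) < w (j : ℤ) ∧ w (j : ℤ) < w (i : ℤ)

/-- Type-B descent set `Des_B(w) = {0 ≤ i ≤ n-1 : w_i > w_{i+1}}`, convention `w_0 = 0`. -/
def DesB (n : ℕ) (w : Equiv.Perm ℤ) : Finset ℕ :=
  (Finset.range n).filter fun i => went w (i+1) < went w i

/-- Type-A descent set `Des(w) = {1 ≤ i ≤ n-1 : w_i > w_{i+1}}`. -/
def DesA (n : ℕ) (w : Equiv.Perm ℤ) : Finset ℕ :=
  (Finset.Ico 1 n).filter fun i => went w (i+1) < went w i

/-- Last descent: `ldes(w) = max (Des_B(w) ∪ {0})`. -/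
def ldes (n : ℕ) (w : Equiv.Perm ℤ) : ℕ := (DesB n w).sup id

/-- `Neg(w) = {1 ≤ i ≤ n : w_i < 0}`. -/
def NegSet (n : ℕ) (w : Equiv.Perm ℤ) : Finset ℕ :=
  (Finset.Icc 1 n).filter fun i => w (i : ℤ) < 0

/-- Block number `bl(w) = 1 + #{1 ≤ i ≤ n-1 : max(w_1,…,w_i) < min(w_{i+1},…,w_n)}`. -/
def bl (n : ℕ) (w : Equiv.Perm ℤ) : ℕ :=
  1 + ((Finset.Ioo 0 n).filter fun i : ℕ =>
    ∀ j ∈ Finset.Icc 1 i, ∀ k ∈ Finset.Icc (i + 1) n, w ((j : ℕ) : ℤ) < w ((k : ℕ) : ℤ)).card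

/-- Chow's type-B fundamental quasi-symmetric function `F^B_J` in variables `x_0,x_1,…`:
the sum of `x_{i_1} ⋯ x_{i_n}` over `0 ≤ i_1 ≤ ⋯ ≤ i_n` with `i_j < i_{j+1}` for `j ∈ J`,
with the convention `i_0 = 0`. A sequence is encoded by `f : ℕ → ℕ` with `f a = i_a`
for `1 ≤ a ≤ n`, normalized by `f 0 = 0` and `f a = 0` for `a > n`. -/
def FB (R : Type) [CommRing R] (n : ℕ) (J : Finset ℕ) : MvPowerSeries ℕ R :=
  fun m => (Nat.card {f : ℕ → ℕ //
    f 0 = 0 ∧ (∀ a, n < a → f a = 0) ∧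
    (∀ a b, a ≤ b → b ≤ n → f a ≤ f b) ∧
    (∀ j ∈ J, f j < f (j + 1)) ∧
    ∀ v : ℕ, m v = ((Finset.Icc 1 n).filter fun a => f a = v).card} : R)

/-- Gessel's fundamental quasi-symmetric function `F_J` in variables `x_1,x_2,…`. -/
def FA (R : Type) [CommRing R] (n : ℕ) (J : Finset ℕ) : MvPowerSeries ℕ R :=
  fun m => (Nat.card {f : ℕ → ℕ //
    f 0 = 0 ∧ (∀ a, n < a → f a = 0) ∧
    (∀ a, 1 ≤ a → a ≤ n → 1 ≤ f a) ∧
    (∀ a b, 1 ≤ a → a ≤ b → b ≤ n → f a ≤ f b) ∧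
    (∀ j ∈ J, f j < f (j + 1)) ∧
    ∀ v : ℕ, m v = ((Finset.Icc 1 n).filter fun a => f a = v).card} : R)

/-- Complete homogeneous symmetric function `h_m` in the variables `x_s, x_{s+1}, …`. -/
def hSeries (R : Type) [CommRing R] (s m : ℕ) : MvPowerSeries ℕ R :=
  fun μ => if (μ.sum fun _ v => v) = m ∧ ∀ a < s, μ a = 0 then 1 else 0

/-- Number of semistandard Young tableaux of shape `lam` (row lengths `lam 0 ≥ lam 1 ≥ …`),
with all entries `≥ s`, rows weakly increasing, columns strictly increasing,
and content `μ` (the value `v` occurs `μ v` times). Tableaux are normalized to be `0`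
outside the cells of the diagram. -/
def schurCoeff (s : ℕ) (lam : ℕ → ℕ) (μ : ℕ → ℕ) : ℕ :=
  Nat.card {T : ℕ → ℕ → ℕ //
    (∀ i j, j + 1 < lam i → T i j ≤ T i (j + 1)) ∧
    (∀ i j, j < lam (i + 1) → T i j < T (i + 1) j) ∧
    (∀ i j, j < lam i → s ≤ T i j) ∧
    (∀ i j, ¬ j < lam i → T i j = 0) ∧
    ∀ v : ℕ, μ v = Nat.card {p : ℕ × ℕ // p.2 < lam p.1 ∧ T p.1 p.2 = v}}

/-- The Schur function `s_lam` in the variables `x_s, x_{s+1}, …`. -/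
def schurS (R : Type) [CommRing R] (s : ℕ) (lam : ℕ → ℕ) : MvPowerSeries ℕ R :=
  fun m => (schurCoeff s lam (fun v => m v) : R)

/-- The two-row shape `(a, b)` as a row-length function. -/
def twoRow (a b : ℕ) : ℕ → ℕ := fun i => if i = 0 then a else if i = 1 then b else 0

/-- Row-length function of a partition of `k`. -/
def partFun {k : ℕ} (p : Nat.Partition k) : ℕ → ℕ :=
  fun i => ((p.parts.sort (· ≤ ·)).reverse).getD i 0

/-- Conjugate of a row-length function. -/
def conjFun (lam : ℕ → ℕ) : ℕ → ℕ := fun j => Nat.card {i : ℕ // j < lam i}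

/-- Descent set of the standard Young tableau of skew shape `(n,k)/(k)` (resp. of the
bi-tableau of bi-shape `((k),(n-k))`) encoded by the set `S ⊆ {1,…,n}` of entries of the
length-`k` bottom row: `{1 ≤ i ≤ n-1 : i ∉ S, i+1 ∈ S}`. -/
def DesSet (n : ℕ) (S : Finset ℕ) : Finset ℕ :=
  (Finset.Ico 1 n).filter fun i => i ∉ S ∧ i + 1 ∈ S

/-- Last descent of the tableau encoded by `S`. -/
def ldesSet (n : ℕ) (S : Finset ℕ) : ℕ := (DesSet n S).sup id

/-- Type-B descent set of the bi-tableau encoded by `S`: add `0` when `1 ∈ S`. -/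
def DesBSet (n : ℕ) (S : Finset ℕ) : Finset ℕ :=
  if 1 ∈ S then insert 0 (DesSet n S) else DesSet n S

/-- `b_{n,k,j}`: the number of standard Young tableaux of skew shape `(n,k)/(k)`
(encoded by `k`-subsets `S ⊆ {1,…,n}`) with `ldes = n - j`. -/
def bCoeff (n k j : ℕ) : ℕ :=
  ((Finset.Icc 1 n).powerset.filter fun S => S.card = k ∧ ldesSet n S = n - j).card

/-- `a_{n,k,j}`: the number of standard Young tableaux of shape `(n-k,k)` (encoded by
`k`-subsets `S ⊆ {1,…,n}` of second-row entries satisfying the ballot condition)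
with `ldes = n - j`. -/
def aCoeff (n k j : ℕ) : ℕ :=
  ((Finset.Icc 1 n).powerset.filter fun S => S.card = k ∧
    (∀ i ∈ Finset.Icc 1 n, 2 * (S.filter (· ≤ i)).card ≤ i) ∧ ldesSet n S = n - j).card

/-- `e_{n,m,J}`: number of `m`-subsets `S ⊆ {1,…,n}` with `Des_B(S) = J`. -/
def eCoeff (n m : ℕ) (J : Finset ℕ) : ℕ :=
  ((Finset.Icc 1 n).powerset.filter fun S => S.card = m ∧ DesBSet n S = J).card

/-- `d_{n,m,j}`: number of `m`-subsets `S ⊆ {1,…,n}` with `ldes(S) = n - j`. -/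
def dCoeff (n m j : ℕ) : ℕ :=
  ((Finset.Icc 1 n).powerset.filter fun S => S.card = m ∧ ldesSet n S = n - j).card

/-- The palindromic representation `w^0 = [-w_n, …, -w_1, w_1, …, w_n]`,
as a function of the position `p ∈ {1,…,2n}`. -/
def wzero (n : ℕ) (w : Equiv.Perm ℤ) : ℕ → ℤ :=
  fun p => if p ≤ n then - w ((n : ℤ) + 1 - (p : ℤ)) else w ((p : ℤ) - (n : ℤ))

/-- Greene invariant: the maximal total size of a union of `j` increasing subsequences
of `w^0` (a set of positions is such a union iff it admits a coloring by `j` colors with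
each color class increasing). By Greene's theorem this equals `λ_1 + ⋯ + λ_j` for the
RSK shape `λ(w^0)`. -/
def greene (n : ℕ) (w : Equiv.Perm ℤ) (j : ℕ) : ℕ :=
  ((Finset.Icc 1 (2 * n)).powerset.filter fun P =>
    ∃ c : ℕ → Fin j, ∀ p ∈ P, ∀ q ∈ P, p < q → c p = c q →
      wzero n w p < wzero n w q).sup Finset.card

/-- First valley `v(π)`. -/
def firstValley (n : ℕ) (π : Equiv.Perm ℤ) : ℕ :=
  if h : ((DesA n π⁻¹).erase 1).Nonempty then ((DesA n π⁻¹).erase 1).min' h else n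

/-- Order key for the order `-1 <r -2 <r ⋯ <r -n <r 1 <r ⋯ <r n`. -/
def rkey (n : ℕ) (a : ℤ) : ℤ := if a < 0 then -a else a + n

/-- The r-descent set `rDes(w) = {1 ≤ i ≤ n-1 : w_i >r w_{i+1}}`. -/
def rDes (n : ℕ) (w : Equiv.Perm ℤ) : Finset ℕ :=
  (Finset.Ico 1 n).filter fun i : ℕ =>
    rkey n (w (((i : ℕ) + 1 : ℕ) : ℤ)) < rkey n (w ((i : ℕ) : ℤ))

/-- Poirier's type-B quasi-symmetric function `F^P_w(X,Y)`, a power series in the two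
alphabets `x_1,x_2,…` (indexed by `Sum.inl`) and `y_1,y_2,…` (indexed by `Sum.inr`). -/
def FP (n : ℕ) (w : Equiv.Perm ℤ) : MvPowerSeries (ℕ ⊕ ℕ) ℤ :=
  fun m => (Nat.card {f : ℕ → ℕ //
    f 0 = 0 ∧ (∀ a, n < a → f a = 0) ∧
    (∀ a, 1 ≤ a → a ≤ n → 1 ≤ f a) ∧
    (∀ a b, 1 ≤ a → a ≤ b → b ≤ n → f a ≤ f b) ∧
    (∀ j ∈ rDes n w, f j < f (j + 1)) ∧
    (∀ v : ℕ, m (Sum.inl v) =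
      ((Finset.Icc 1 n).filter fun a => f a = v ∧ 0 < w ((a : ℕ) : ℤ)).card) ∧
    ∀ v : ℕ, m (Sum.inr v) =
      ((Finset.Icc 1 n).filter fun a => f a = v ∧ w ((a : ℕ) : ℤ) < 0).card} : ℤ)

/-- The Schur function `s_lam(X)` in the first alphabet `x_1,x_2,…`. -/
def schurX (lam : ℕ → ℕ) : MvPowerSeries (ℕ ⊕ ℕ) ℤ :=
  fun m => if ∀ v, m (Sum.inr v) = 0 then
    (schurCoeff 1 lam fun v => m (Sum.inl v) : ℤ) else 0

/-- The Schur function `s_lam(Y)` in the second alphabet `y_1,y_2,…`. -/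
def schurY (lam : ℕ → ℕ) : MvPowerSeries (ℕ ⊕ ℕ) ℤ :=
  fun m => if ∀ v, m (Sum.inl v) = 0 then
    (schurCoeff 1 lam fun v => m (Sum.inr v) : ℤ) else 0

/-- Chow type-B Schur-positivity: a nonnegative combination of the products
`s_{λ⁻}(x_1,x_2,…) ⋅ s_{λ⁺}(x_0,x_1,…)` over pairs of partitions of total size `n`. -/
def ChowPos (n : ℕ) (F : MvPowerSeries ℕ ℤ) : Prop :=
  ∃ c : (Σ k : Fin (n + 1), Nat.Partition (k : ℕ) × Nat.Partition (n - (k : ℕ))) → ℕ,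
    F = ∑ p : (Σ k : Fin (n + 1), Nat.Partition (k : ℕ) × Nat.Partition (n - (k : ℕ))),
      (c p : ℤ) • (schurS ℤ 1 (partFun p.2.1) * schurS ℤ 0 (partFun p.2.2))

open Polynomial in
/-- The `ℤ`-linear operator on `ℤ[X]` with `X ^ j ↦ X + X ^ 2 + ⋯ + X ^ j`. -/
def sumOp : ℤ[X] →ₗ[ℤ] ℤ[X] :=
  (Polynomial.basisMonomials ℤ).constr ℤ fun j => ∑ i ∈ Finset.range j, Polynomial.X ^ (i + 1)

section
open Polynomial

lemma sumOp_X_pow (j : ℕ) : sumOp (X ^ j) = ∑ i ∈ Finset.range j, (X ^ (i + 1) : ℤ[X]) := by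
  have := (Polynomial.basisMonomials ℤ).constr_basis ℤ
    (fun j => ∑ i ∈ Finset.range j, (X ^ (i + 1) : ℤ[X])) j
  simp only [Polynomial.coe_basisMonomials, Polynomial.monomial_one_right_eq_X_pow] at this
  exact this

lemma sumOp_one : sumOp 1 = 0 := by simpa using sumOp_X_pow 0

lemma sumOp_X : sumOp X = X := by simpa using sumOp_X_pow 1

lemma sumOp_X_mul (f : ℤ[X]) : sumOp (X * f) = X * f + sumOp f := by
  induction f using Polynomial.induction_on' with
  | add p q hp hq => rw [mul_add, map_add, hp, hq, map_add]; ring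
  | monomial j a =>
    have h : (monomial j a : ℤ[X]) = a • X ^ j := by
      rw [zsmul_eq_mul, ← C_mul_X_pow_eq_monomial]; simp
    rw [h, mul_smul_comm, map_smul, map_smul, ← pow_succ', sumOp_X_pow, sumOp_X_pow,
      Finset.sum_range_succ, smul_add, add_comm]

/-- The block operator `∑_{a ≤ m} X ^ (m - a) * sumOp ^ a`. -/
def blockOp : ℕ → ℤ[X] → ℤ[X]
  | 0, f => f
  | m + 1, f => X ^ (m + 1) * f + blockOp m (sumOp f)

lemma blockOp_add (m : ℕ) (f g : ℤ[X]) : blockOp m (f + g) = blockOp m f + blockOp m g := by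
  induction m generalizing f g with
  | zero => rfl
  | succ m ih => simp only [blockOp, map_add, ih]; ring

lemma blockOp_zero (m : ℕ) : blockOp m 0 = 0 := by
  have := blockOp_add m 0 0
  simpa using this

lemma blockOp_sub (m : ℕ) (f g : ℤ[X]) : blockOp m (f - g) = blockOp m f - blockOp m g := by
  rw [eq_sub_iff_add_eq, ← blockOp_add, sub_add_cancel]

lemma blockOp_sum {ι : Type*} (m : ℕ) (s : Finset ι) (f : ι → ℤ[X]) :
    blockOp m (∑ i ∈ s, f i) = ∑ i ∈ s, blockOp m (f i) := by
  induction s using Finset.induction_on with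
  | empty => simp [blockOp_zero]
  | insert a s ha ih => rw [Finset.sum_insert ha, Finset.sum_insert ha, blockOp_add, ih]

lemma blockOp_eq_sum (m : ℕ) (f : ℤ[X]) :
    blockOp m f = ∑ a ∈ Finset.range (m + 1), X ^ (m - a) * sumOp^[a] f := by
  induction m generalizing f with
  | zero => simp [blockOp]
  | succ m ih =>
    rw [Finset.sum_range_succ', blockOp, ih, add_comm]
    simp

lemma blockOp_succ' (m : ℕ) (f : ℤ[X]) :
    blockOp (m + 1) f = X * blockOp m f + sumOp^[m + 1] f := by
  rw [blockOp_eq_sum, blockOp_eq_sum, Finset.sum_range_succ, Finset.mul_sum]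
  congr 1
  · refine Finset.sum_congr rfl fun a ha => ?_
    rw [Finset.mem_range] at ha
    rw [← mul_assoc, ← pow_succ', show m + 1 - a = m - a + 1 by omega]
  · simp

lemma blockOp_iterate (m i : ℕ) (f : ℤ[X]) :
    blockOp m (sumOp^[i + 1] f) = blockOp (m + i + 1) f - X ^ (m + 1) * blockOp i f := by
  induction i generalizing f with
  | zero => simp [blockOp]
  | succ i ih =>
    have h1 : blockOp (m + (i + 1) + 1) f =
        X ^ (m + (i + 1) + 1) * f + blockOp (m + i + 1) (sumOp f) := rfl
    have h2 : blockOp (i + 1) f = X ^ (i + 1) * f + blockOp i (sumOp f) := rfl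
    rw [Function.iterate_succ_apply, ih, h1, h2]
    ring

/-- Generating polynomial for two-row tableaux by last descent. -/
def pasc (i k : ℕ) : ℤ[X] := blockOp i (X ^ k)

lemma pasc_zero_left (k : ℕ) : pasc 0 k = X ^ k := rfl

lemma pasc_zero_right (i : ℕ) : pasc i 0 = X ^ i := by
  cases i with
  | zero => rfl
  | succ i => simp [pasc, blockOp, sumOp_one, blockOp_zero]

lemma pasc_succ_succ (i k : ℕ) :
    pasc (i + 1) (k + 1) = pasc (i + 1) k + pasc i (k + 1) + X ^ (i + k + 2) - X ^ (i + k + 1) := by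
  simp only [pasc, blockOp]
  rw [pow_succ' X k, sumOp_X_mul, blockOp_add]
  ring

lemma pasc_symm (i k : ℕ) : pasc i k = pasc k i := by
  induction i generalizing k with
  | zero => rw [pasc_zero_left, pasc_zero_right]
  | succ i ihi =>
    induction k with
    | zero => rw [pasc_zero_left, pasc_zero_right]
    | succ k ihk =>
      rw [pasc_succ_succ, pasc_succ_succ, ihi, ihk, add_comm i k]
      ring

lemma sumOp_pasc (i k : ℕ) :
    sumOp (pasc i k) = pasc i (k + 1) + sumOp^[i + 1] (X ^ k) - X ^ (i + k + 1) := by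
  induction i with
  | zero => simp [pasc_zero_left]
  | succ i ih =>
    have h : pasc (i + 1) k = X * pasc i k + sumOp^[i + 1] (X ^ k) := blockOp_succ' _ _
    rw [pasc_succ_succ, h, map_add, sumOp_X_mul, ih, ← Function.iterate_succ_apply' sumOp]
    ring

lemma blockOp_pasc (m i k : ℕ) :
    blockOp m (pasc i k) + ∑ j ∈ Finset.range m, pasc (i + k + m - j) j =
      ∑ a ∈ Finset.range (m + 1), pasc (i + m - a) (k + a) := by
  induction m generalizing i k with
  | zero => simp [blockOp]
  | succ m ih =>
    have h := ih i (k + 1)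
    have h2 : blockOp m (X ^ (i + k + 1)) = pasc (i + k + 1) m := pasc_symm _ _
    rw [blockOp, sumOp_pasc, blockOp_sub, blockOp_add, blockOp_iterate, h2,
      Finset.sum_range_succ, Finset.sum_range_succ']
    have e1 : ∀ j, i + k + (m + 1) - j = i + (k + 1) + m - j := fun j => by omega
    have e2 : ∀ a, pasc (i + (m + 1) - (a + 1)) (k + (a + 1)) = pasc (i + m - a) (k + 1 + a) :=
      fun a => by congr 1 <;> omega
    simp only [e1, e2]
    rw [← h, show i + (k + 1) + m - m = i + k + 1 by omega]
    have h4 : blockOp (m + i + 1) (X ^ k) = pasc (i + (m + 1) - 0) (k + 0) := by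
      rw [pasc]; congr 1; omega
    have h5 : blockOp i (X ^ k) = pasc i k := rfl
    rw [h4, h5]
    ring

/-- The difference `pasc (n - k) k - pasc (n - k + 1) (k - 1)`. -/
def pascDiff (n k : ℕ) : ℤ[X] := pasc (n - k) k - if k = 0 then 0 else pasc (n + 1 - k) (k - 1)

lemma sum_pascDiff (N i r : ℕ) :
    ∑ a ∈ Finset.range (r + 1), pascDiff N (i + a) =
      pasc (N - (i + r)) (i + r) - if i = 0 then 0 else pasc (N + 1 - i) (i - 1) := by
  induction r with
  | zero => simp [pascDiff]
  | succ r ih =>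
    rw [Finset.sum_range_succ, ih, pascDiff]
    rw [if_neg (by omega : i + (r + 1) ≠ 0), show N + 1 - (i + (r + 1)) = N - (i + r) by omega,
      show i + (r + 1) - 1 = i + r by omega]
    ring

lemma blockOp_pascDiff_eq (n m i : ℕ) (hi : i ≤ n) :
    blockOp m (pascDiff n i) =
      pasc (n - i) (i + m) - if i = 0 then 0 else pasc (n + m + 1 - i) (i - 1) := by
  have h1 := blockOp_pasc m (n - i) i
  rw [Finset.sum_range_succ] at h1
  rw [pascDiff, blockOp_sub, eq_sub_of_add_eq h1]
  rw [show n - i + i = n by omega, show n - i + m - m = n - i by omega]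
  by_cases h0 : i = 0
  · subst h0
    simp [blockOp_zero]
  · have h2 := blockOp_pasc m (n + 1 - i) (i - 1)
    rw [Finset.sum_range_succ'] at h2
    rw [if_neg h0, if_neg h0, eq_sub_of_add_eq h2, show n + 1 - i + (i - 1) = n by omega]
    have e : ∀ a, pasc (n + 1 - i + m - (a + 1)) (i - 1 + (a + 1)) =
        pasc (n - i + m - a) (i + a) := fun a => by congr 1 <;> omega
    simp only [e]
    rw [show n + 1 - i + m - 0 = n + m + 1 - i by omega, add_zero]
    ring

lemma blockOp_pascDiff (n m i : ℕ) (hi : 2 * i ≤ n) :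
    blockOp m (pascDiff n i) =
      ∑ a ∈ (Finset.range (m + 1)).filter (fun a => 2 * i + a ≤ n), pascDiff (n + m) (i + a) := by
  have hf : (Finset.range (m + 1)).filter (fun a => 2 * i + a ≤ n) =
      Finset.range (min m (n - 2 * i) + 1) := by
    ext a; simp only [Finset.mem_filter, Finset.mem_range]; omega
  rw [hf, sum_pascDiff, blockOp_pascDiff_eq n m i (by omega)]
  congr 1
  rcases le_total m (n - 2 * i) with h | h
  · rw [min_eq_left h]; congr 1; omega
  · rw [min_eq_right h, pasc_symm]
    congr 1 <;> omega

/-- `affOp n a f` applies `g ↦ sumOp g + X ^ (length + 1)` successively at the lengths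
`n, …, n + a - 1`. -/
def affOp (n : ℕ) : ℕ → ℤ[X] → ℤ[X]
  | 0, f => f
  | a + 1, f => sumOp (affOp n a f) + X ^ (n + a + 1)

lemma affOp_eq (n a : ℕ) (f : ℤ[X]) : affOp n a f = sumOp^[a] f + affOp n a 0 := by
  induction a with
  | zero => simp [affOp]
  | succ a ih =>
    rw [affOp, ih, map_add, ← Function.iterate_succ_apply' sumOp, affOp, add_assoc]

lemma affOp_zero_eq_sum (n a : ℕ) :
    affOp n a 0 = ∑ d ∈ Finset.range a, sumOp^[a - 1 - d] (X ^ (n + d + 1)) := by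
  induction a with
  | zero => simp [affOp]
  | succ a ih =>
    rw [affOp, ih, Finset.sum_range_succ, map_sum]
    congr 1
    · refine Finset.sum_congr rfl fun d hd => ?_
      rw [Finset.mem_range] at hd
      rw [← Function.iterate_succ_apply' sumOp, show (a - 1 - d).succ = a + 1 - 1 - d by omega]
    · simp

lemma sum_affOp_zero (n m : ℕ) :
    ∑ a ∈ Finset.range (m + 1), X ^ (m - a) * affOp n a 0 =
      ∑ d ∈ Finset.range m, blockOp (m - 1 - d) (X ^ (n + d + 1)) := by
  induction m with
  | zero => simp [affOp]
  | succ m ih =>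
    have e : ∑ a ∈ Finset.range (m + 1), X ^ (m + 1 - a) * affOp n a 0 =
        X * ∑ a ∈ Finset.range (m + 1), X ^ (m - a) * affOp n a 0 := by
      rw [Finset.mul_sum]
      refine Finset.sum_congr rfl fun a ha => ?_
      rw [Finset.mem_range] at ha
      rw [← mul_assoc, ← pow_succ', show m + 1 - a = m - a + 1 by omega]
    rw [Finset.sum_range_succ, e, ih, affOp_zero_eq_sum n (m + 1), Finset.sum_range_succ _ m,
      Finset.sum_range_succ _ m, Finset.mul_sum]
    have e2 : ∀ d ∈ Finset.range m, blockOp (m + 1 - 1 - d) (X ^ (n + d + 1)) =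
        X * blockOp (m - 1 - d) (X ^ (n + d + 1)) + sumOp^[m + 1 - 1 - d] (X ^ (n + d + 1)) := by
      intro d hd
      rw [Finset.mem_range] at hd
      rw [show m + 1 - 1 - d = (m - 1 - d) + 1 by omega, blockOp_succ']
    rw [Finset.sum_congr rfl e2, Finset.sum_add_distrib]
    simp [blockOp]
    ring

lemma sum_affOp (n m : ℕ) (f : ℤ[X]) :
    ∑ a ∈ Finset.range (m + 1), X ^ (m - a) * affOp n a f =
      blockOp m f + ∑ j ∈ Finset.range m, pasc (n + m - j) j := by
  have : ∑ j ∈ Finset.range m, pasc (n + m - j) j =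
      ∑ d ∈ Finset.range m, blockOp (m - 1 - d) (X ^ (n + d + 1)) := by
    rw [← Finset.sum_range_reflect]
    refine Finset.sum_congr rfl fun d hd => ?_
    rw [Finset.mem_range] at hd
    rw [pasc_symm, pasc]
    congr 2
    omega
  rw [this, ← sum_affOp_zero, blockOp_eq_sum, ← Finset.sum_add_distrib]
  refine Finset.sum_congr rfl fun a _ => ?_
  rw [affOp_eq, mul_add]

end

/-- Vectors `ν` with `ν i ≤ c i` for `i < N` and `ν i = 0` for `i ≥ N`. -/
def vecs (c : ℕ → ℕ) : ℕ → Finset (ℕ → ℕ)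
  | 0 => {0}
  | N + 1 => (vecs c N ×ˢ Finset.range (c N + 1)).image fun p => Function.update p.1 N p.2

lemma mem_vecs {c : ℕ → ℕ} {N : ℕ} {ν : ℕ → ℕ} :
    ν ∈ vecs c N ↔ (∀ i < N, ν i ≤ c i) ∧ ∀ i, N ≤ i → ν i = 0 := by
  induction N generalizing ν with
  | zero =>
    simp only [vecs, Finset.mem_singleton]
    constructor
    · rintro rfl; simp
    · rintro ⟨-, h⟩; funext i; exact h i (Nat.zero_le i)
  | succ N ih =>
    simp only [vecs, Finset.mem_image, Finset.mem_product, Finset.mem_range, Prod.exists]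
    constructor
    · rintro ⟨μ, a, ⟨hμ, ha⟩, rfl⟩
      rw [ih] at hμ
      refine ⟨fun i hi => ?_, fun i hi => ?_⟩
      · by_cases h : i = N
        · subst h; simp; omega
        · rw [Function.update_of_ne h]; exact hμ.1 i (by omega)
      · rw [Function.update_of_ne (by omega)]; exact hμ.2 i (by omega)
    · rintro ⟨h1, h2⟩
      refine ⟨Function.update ν N 0, ν N, ⟨ih.2 ⟨fun i hi => ?_, fun i hi => ?_⟩, ?_⟩, ?_⟩
      · rw [Function.update_of_ne (by omega)]; exact h1 i (by omega)
      · by_cases h : i = N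
        · subst h; simp
        · rw [Function.update_of_ne h]; exact h2 i (by omega)
      · have := h1 N (by omega); omega
      · simp

lemma sum_vecs_succ {M : Type*} [AddCommMonoid M] (c : ℕ → ℕ) (N : ℕ) (φ : (ℕ → ℕ) → M) :
    ∑ ν ∈ vecs c (N + 1), φ ν =
      ∑ ν ∈ vecs c N, ∑ a ∈ Finset.range (c N + 1), φ (Function.update ν N a) := by
  rw [vecs, Finset.sum_image, Finset.sum_product]
  rintro ⟨ν, a⟩ hν ⟨μ, b⟩ hμ h
  simp only [Finset.coe_product, Set.mem_prod, Finset.mem_coe, mem_vecs] at hν hμ h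
  have hab : a = b := by simpa using congrFun h N
  subst hab
  have : ν = μ := by
    funext i
    by_cases hi : i = N
    · subst hi; rw [hν.1.2 i le_rfl, hμ.1.2 i le_rfl]
    · have := congrFun h i
      rwa [Function.update_of_ne hi, Function.update_of_ne hi] at this
  rw [this]

lemma sum_range_update_of_le (ν : ℕ → ℕ) {N j a : ℕ} (h : j ≤ N) :
    ∑ i ∈ Finset.range j, Function.update ν N a i = ∑ i ∈ Finset.range j, ν i :=
  Finset.sum_congr rfl fun i hi => by
    rw [Finset.mem_range] at hi; exact Function.update_of_ne (by omega) _ _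

lemma sum_range_update_succ (ν : ℕ → ℕ) (N a : ℕ) :
    ∑ i ∈ Finset.range (N + 1), Function.update ν N a i = ∑ i ∈ Finset.range N, ν i + a := by
  rw [Finset.sum_range_succ, sum_range_update_of_le ν le_rfl, Function.update_self]

/-- Union over `j < N` of the first `ν j` elements of the `j`-th block of lengths `m`. -/
def blockSet (m ν : ℕ → ℕ) : ℕ → Finset ℕ
  | 0 => ∅
  | N + 1 => blockSet m ν N ∪
      Finset.Ioc (∑ i ∈ Finset.range N, m i) (∑ i ∈ Finset.range N, m i + ν N)

lemma mem_blockSet {m ν : ℕ → ℕ} {N i : ℕ} :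
    i ∈ blockSet m ν N ↔ ∃ j < N, ∑ l ∈ Finset.range j, m l < i ∧
      i ≤ ∑ l ∈ Finset.range j, m l + ν j := by
  induction N with
  | zero => simp [blockSet]
  | succ N ih =>
    rw [blockSet, Finset.mem_union, ih, Finset.mem_Ioc]
    constructor
    · rintro (⟨j, hj, h⟩ | h)
      · exact ⟨j, by omega, h⟩
      · exact ⟨N, by omega, h⟩
    · rintro ⟨j, hj, h⟩
      rcases Nat.lt_succ_iff_lt_or_eq.1 hj with hj | rfl
      · exact Or.inl ⟨j, hj, h⟩
      · exact Or.inr h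

lemma blockSet_congr {m ν μ : ℕ → ℕ} {N : ℕ} (h : ∀ i < N, ν i = μ i) :
    blockSet m ν N = blockSet m μ N := by
  ext i
  simp only [mem_blockSet]
  constructor
  · rintro ⟨j, hj, h1⟩; exact ⟨j, hj, by rwa [← h j hj]⟩
  · rintro ⟨j, hj, h1⟩; exact ⟨j, hj, by rwa [h j hj]⟩

lemma sum_range_mono (m : ℕ → ℕ) {i j : ℕ} (h : i ≤ j) :
    ∑ l ∈ Finset.range i, m l ≤ ∑ l ∈ Finset.range j, m l :=
  Finset.sum_le_sum_of_subset (Finset.range_mono h)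

lemma blockSet_subset {m ν : ℕ → ℕ} {N : ℕ} (h : ∀ i < N, ν i ≤ m i) :
    blockSet m ν N ⊆ Finset.Icc 1 (∑ i ∈ Finset.range N, m i) := by
  intro i hi
  obtain ⟨j, hj, h1, h2⟩ := mem_blockSet.1 hi
  rw [Finset.mem_Icc]
  refine ⟨by omega, ?_⟩
  have h3 := sum_range_mono m (show j + 1 ≤ N from hj)
  rw [Finset.sum_range_succ] at h3
  have := h j hj
  omega

lemma blockSet_update (m ν : ℕ → ℕ) (N a : ℕ) :
    blockSet m (Function.update ν N a) (N + 1) = blockSet m ν N ∪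
      Finset.Ioc (∑ i ∈ Finset.range N, m i) (∑ i ∈ Finset.range N, m i + a) := by
  rw [blockSet, Function.update_self]
  congr 1
  exact blockSet_congr fun i hi => Function.update_of_ne (by omega) _ _

section
open Polynomial

/-- The generating polynomial by block number of the inverse of the 321-avoiding
permutations of `[1, n]` with set of strict anti-excedance positions `S`. -/
def fpoly (S : Finset ℕ) : ℕ → ℤ[X]
  | 0 => 1
  | n + 1 => if n + 1 ∈ S then sumOp (fpoly S n) else X * fpoly S n

/-- `fpoly S n` together with all `fpoly (S ∩ (s, n]) n` for `s ∈ S`. -/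
def hpoly (S : Finset ℕ) : ℕ → ℤ[X]
  | 0 => 1
  | n + 1 => if n + 1 ∈ S then sumOp (hpoly S n) + X ^ (n + 1) else X * hpoly S n

lemma fpoly_congr {S S' : Finset ℕ} {n : ℕ} (h : ∀ i, 1 ≤ i → i ≤ n → (i ∈ S ↔ i ∈ S')) :
    fpoly S n = fpoly S' n := by
  induction n with
  | zero => rfl
  | succ n ih =>
    rw [fpoly, fpoly, ih fun i h1 h2 => h i h1 (by omega)]
    simp only [h (n + 1) (by omega) le_rfl]

lemma hpoly_congr {S S' : Finset ℕ} {n : ℕ} (h : ∀ i, 1 ≤ i → i ≤ n → (i ∈ S ↔ i ∈ S')) :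
    hpoly S n = hpoly S' n := by
  induction n with
  | zero => rfl
  | succ n ih =>
    rw [hpoly, hpoly, ih fun i h1 h2 => h i h1 (by omega)]
    simp only [h (n + 1) (by omega) le_rfl]

lemma fpoly_add_of_mem {S : Finset ℕ} (n a : ℕ) (h : ∀ i, n < i → i ≤ n + a → i ∈ S) :
    fpoly S (n + a) = sumOp^[a] (fpoly S n) := by
  induction a with
  | zero => rfl
  | succ a ih =>
    rw [← add_assoc, fpoly, if_pos (h _ (by omega) (by omega)),
      ih fun i h1 h2 => h i h1 (by omega), Function.iterate_succ_apply']

lemma fpoly_add_of_notMem {S : Finset ℕ} (n a : ℕ) (h : ∀ i, n < i → i ≤ n + a → i ∉ S) :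
    fpoly S (n + a) = X ^ a * fpoly S n := by
  induction a with
  | zero => simp
  | succ a ih =>
    rw [← add_assoc, fpoly, if_neg (h _ (by omega) (by omega)),
      ih fun i h1 h2 => h i h1 (by omega), pow_succ', mul_assoc]

lemma hpoly_add_of_mem {S : Finset ℕ} (n a : ℕ) (h : ∀ i, n < i → i ≤ n + a → i ∈ S) :
    hpoly S (n + a) = affOp n a (hpoly S n) := by
  induction a with
  | zero => rfl
  | succ a ih =>
    rw [← add_assoc, hpoly, if_pos (h _ (by omega) (by omega)),
      ih fun i h1 h2 => h i h1 (by omega), affOp]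

lemma hpoly_add_of_notMem {S : Finset ℕ} (n a : ℕ) (h : ∀ i, n < i → i ≤ n + a → i ∉ S) :
    hpoly S (n + a) = X ^ a * hpoly S n := by
  induction a with
  | zero => simp
  | succ a ih =>
    rw [← add_assoc, hpoly, if_neg (h _ (by omega) (by omega)),
      ih fun i h1 h2 => h i h1 (by omega), pow_succ', mul_assoc]

lemma fpoly_empty (n : ℕ) : fpoly ∅ n = X ^ n := by
  have := fpoly_add_of_notMem (S := ∅) 0 n (by simp)
  simpa [fpoly] using this

lemma hpoly_empty (n : ℕ) : hpoly ∅ n = X ^ n := by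
  have := hpoly_add_of_notMem (S := ∅) 0 n (by simp)
  simpa [hpoly] using this

lemma fpoly_union_Ioc {S : Finset ℕ} {n a m : ℕ} (hS : S ⊆ Finset.Icc 1 n) (ha : a ≤ m) :
    fpoly (S ∪ Finset.Ioc n (n + a)) (n + m) = X ^ (m - a) * sumOp^[a] (fpoly S n) := by
  have hm : ∀ i ∈ S, i ≤ n := fun i hi => (Finset.mem_Icc.1 (hS hi)).2
  obtain ⟨r, rfl⟩ := Nat.exists_eq_add_of_le ha
  rw [← add_assoc, fpoly_add_of_notMem, fpoly_add_of_mem, Nat.add_sub_cancel_left]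
  · congr 2
    exact fpoly_congr fun i h1 h2 => by simp; omega
  · intro i h1 h2; simp; omega
  · intro i h1 h2 h3
    simp only [Finset.mem_union, Finset.mem_Ioc] at h3
    rcases h3 with h3 | h3
    · have := hm i h3; omega
    · omega

lemma hpoly_union_Ioc {S : Finset ℕ} {n a m : ℕ} (hS : S ⊆ Finset.Icc 1 n) (ha : a ≤ m) :
    hpoly (S ∪ Finset.Ioc n (n + a)) (n + m) = X ^ (m - a) * affOp n a (hpoly S n) := by
  have hm : ∀ i ∈ S, i ≤ n := fun i hi => (Finset.mem_Icc.1 (hS hi)).2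
  obtain ⟨r, rfl⟩ := Nat.exists_eq_add_of_le ha
  rw [← add_assoc, hpoly_add_of_notMem, hpoly_add_of_mem, Nat.add_sub_cancel_left]
  · congr 2
    exact hpoly_congr fun i h1 h2 => by simp; omega
  · intro i h1 h2; simp; omega
  · intro i h1 h2 h3
    simp only [Finset.mem_union, Finset.mem_Ioc] at h3
    rcases h3 with h3 | h3
    · have := hm i h3; omega
    · omega

lemma hpoly_eq (S : Finset ℕ) (n : ℕ) :
    hpoly S n = fpoly S n +
      ∑ s ∈ (Finset.Icc 1 n).filter (· ∈ S), fpoly (S.filter (s < ·)) n := by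
  induction n with
  | zero => simp [hpoly, fpoly]
  | succ n ih =>
    have hI : Finset.Icc 1 (n + 1) = insert (n + 1) (Finset.Icc 1 n) := by
      ext i; simp; omega
    have hn : n + 1 ∉ (Finset.Icc 1 n).filter (· ∈ S) := by simp
    have h0 : fpoly (S.filter (n + 1 < ·)) (n + 1) = X ^ (n + 1) := by
      rw [← fpoly_empty]
      exact fpoly_congr fun i h1 h2 => by simp; omega
    rw [hI, Finset.filter_insert]
    by_cases h : n + 1 ∈ S
    · rw [if_pos h, Finset.sum_insert hn, h0, hpoly, if_pos h, ih, fpoly, if_pos h, map_add,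
        map_sum]
      have : ∀ s ∈ (Finset.Icc 1 n).filter (· ∈ S),
          fpoly (S.filter (s < ·)) (n + 1) = sumOp (fpoly (S.filter (s < ·)) n) := by
        intro s hs
        simp only [Finset.mem_filter, Finset.mem_Icc] at hs
        rw [fpoly, if_pos (by simp [h]; omega)]
      rw [Finset.sum_congr rfl this]
      ring
    · rw [if_neg h, hpoly, if_neg h, ih, fpoly, if_neg h, mul_add, Finset.mul_sum]
      congr 1
      refine Finset.sum_congr rfl fun s hs => ?_
      rw [fpoly, if_neg (by simp [h])]

/-- The vector form of the ballot condition. -/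
def IsBallot (m ν : ℕ → ℕ) (N : ℕ) : Prop :=
  ∀ j < N, ∑ i ∈ Finset.range j, ν i + ∑ i ∈ Finset.range (j + 1), ν i ≤ ∑ i ∈ Finset.range j, m i

lemma isBallot_update {m ν : ℕ → ℕ} {N a : ℕ} :
    IsBallot m (Function.update ν N a) (N + 1) ↔
      IsBallot m ν N ∧ 2 * ∑ i ∈ Finset.range N, ν i + a ≤ ∑ i ∈ Finset.range N, m i := by
  have key : ∀ j < N, ((∑ i ∈ Finset.range j, Function.update ν N a i +
      ∑ i ∈ Finset.range (j + 1), Function.update ν N a i ≤ ∑ i ∈ Finset.range j, m i) ↔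
      ∑ i ∈ Finset.range j, ν i + ∑ i ∈ Finset.range (j + 1), ν i ≤
        ∑ i ∈ Finset.range j, m i) := fun j hj => by
    rw [sum_range_update_of_le ν hj.le, sum_range_update_of_le ν hj]
  have keyN : (∑ i ∈ Finset.range N, Function.update ν N a i +
      ∑ i ∈ Finset.range (N + 1), Function.update ν N a i ≤ ∑ i ∈ Finset.range N, m i) ↔
      2 * ∑ i ∈ Finset.range N, ν i + a ≤ ∑ i ∈ Finset.range N, m i := by
    rw [sum_range_update_of_le ν le_rfl, sum_range_update_succ]
    constructor <;> intro h <;> omega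
  constructor
  · intro h
    exact ⟨fun j hj => (key j hj).1 (h j (by omega)), keyN.1 (h N (by omega))⟩
  · rintro ⟨h1, h2⟩ j hj
    rcases Nat.lt_succ_iff_lt_or_eq.1 hj with hj | rfl
    · exact (key j hj).2 (h1 j hj)
    · exact keyN.2 h2

lemma IsBallot.two_mul_le {m ν : ℕ → ℕ} {N : ℕ} (h : IsBallot m ν N) (hν : ∀ i < N, ν i ≤ m i) :
    2 * ∑ i ∈ Finset.range N, ν i ≤ ∑ i ∈ Finset.range N, m i := by
  cases N with
  | zero => simp
  | succ N =>
    have := h N (by omega)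
    have h2 := hν N (by omega)
    rw [Finset.sum_range_succ] at this
    rw [Finset.sum_range_succ, Finset.sum_range_succ]
    omega

/-- The block lengths `m` with the zeroth one replaced by `0`. -/
def capZero (m : ℕ → ℕ) : ℕ → ℕ := Function.update m 0 0

lemma le_of_mem_vecs_capZero {m ν : ℕ → ℕ} {N : ℕ} (h : ν ∈ vecs (capZero m) N) (i : ℕ) :
    ν i ≤ m i := by
  rw [mem_vecs] at h
  rcases lt_or_ge i N with hi | hi
  · refine (h.1 i hi).trans ?_
    by_cases h0 : i = 0
    · subst h0; simp [capZero]
    · rw [capZero, Function.update_of_ne h0]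
  · rw [h.2 i hi]; exact Nat.zero_le _

lemma vecs_capZero_one (m : ℕ → ℕ) : vecs (capZero m) 1 = {0} := by
  simp [vecs, capZero]

lemma blockSet_zero (m : ℕ → ℕ) (N : ℕ) : blockSet m 0 N = ∅ := by
  ext i; simp only [mem_blockSet, Pi.zero_apply, Finset.notMem_empty, iff_false]
  rintro ⟨j, -, h⟩; omega

theorem sum_fpoly_blockSet (m : ℕ → ℕ) (N : ℕ) :
    ∑ ν ∈ vecs (capZero m) (N + 1),
        fpoly (blockSet m ν (N + 1)) (∑ i ∈ Finset.range (N + 1), m i) =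
      ∑ ν ∈ (vecs (capZero m) (N + 1)).filter (fun ν => IsBallot m ν (N + 1)),
        pascDiff (∑ i ∈ Finset.range (N + 1), m i) (∑ i ∈ Finset.range (N + 1), ν i) := by
  induction N with
  | zero =>
    rw [zero_add, vecs_capZero_one, Finset.filter_true_of_mem (by
      intro ν hν j hj
      rw [Finset.mem_singleton] at hν
      subst hν; simp)]
    simp [blockSet_zero, fpoly_empty, pascDiff, pasc_zero_right]
  | succ N ih =>
    have hc : capZero m (N + 1) = m (N + 1) := Function.update_of_ne (by omega) _ _
    rw [Finset.sum_filter, sum_vecs_succ _ (N + 1), sum_vecs_succ _ (N + 1), hc]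
    have e1 : ∀ ν ∈ vecs (capZero m) (N + 1), ∑ a ∈ Finset.range (m (N + 1) + 1),
        fpoly (blockSet m (Function.update ν (N + 1) a) (N + 1 + 1))
          (∑ i ∈ Finset.range (N + 1 + 1), m i) =
        blockOp (m (N + 1)) (fpoly (blockSet m ν (N + 1)) (∑ i ∈ Finset.range (N + 1), m i)) := by
      intro ν hν
      rw [blockOp_eq_sum]
      refine Finset.sum_congr rfl fun a ha => ?_
      rw [Finset.mem_range] at ha
      rw [blockSet_update, Finset.sum_range_succ _ (N + 1), fpoly_union_Ioc
        (blockSet_subset fun i _ => le_of_mem_vecs_capZero hν i) (by omega)]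
    rw [Finset.sum_congr rfl e1, ← blockOp_sum, ih, blockOp_sum, Finset.sum_filter]
    refine Finset.sum_congr rfl fun ν hν => ?_
    split_ifs with hb
    · rw [blockOp_pascDiff _ _ _ (hb.two_mul_le fun i _ => le_of_mem_vecs_capZero hν i),
        Finset.sum_filter]
      refine Finset.sum_congr rfl fun a _ => ?_
      simp only [isBallot_update, hb, true_and, sum_range_update_succ]
      rw [Finset.sum_range_succ m (N + 1)]
    · simp [isBallot_update, hb]

theorem sum_hpoly_blockSet (m : ℕ → ℕ) (N : ℕ) :
    ∑ ν ∈ vecs (capZero m) (N + 1),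
        hpoly (blockSet m ν (N + 1)) (∑ i ∈ Finset.range (N + 1), m i) =
      ∑ ν ∈ vecs (capZero m) (N + 1),
        pasc (∑ i ∈ Finset.range (N + 1), m i - ∑ i ∈ Finset.range (N + 1), ν i)
          (∑ i ∈ Finset.range (N + 1), ν i) := by
  induction N with
  | zero =>
    rw [zero_add, vecs_capZero_one]
    simp [blockSet_zero, hpoly_empty, pasc_zero_right]
  | succ N ih =>
    have hc : capZero m (N + 1) = m (N + 1) := Function.update_of_ne (by omega) _ _
    rw [sum_vecs_succ _ (N + 1), sum_vecs_succ _ (N + 1), hc]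
    have e1 : ∀ ν ∈ vecs (capZero m) (N + 1), ∑ a ∈ Finset.range (m (N + 1) + 1),
        hpoly (blockSet m (Function.update ν (N + 1) a) (N + 1 + 1))
          (∑ i ∈ Finset.range (N + 1 + 1), m i) =
        blockOp (m (N + 1)) (hpoly (blockSet m ν (N + 1)) (∑ i ∈ Finset.range (N + 1), m i)) +
          ∑ j ∈ Finset.range (m (N + 1)),
            pasc (∑ i ∈ Finset.range (N + 1), m i + m (N + 1) - j) j := by
      intro ν hν
      rw [← sum_affOp]
      refine Finset.sum_congr rfl fun a ha => ?_
      rw [Finset.mem_range] at ha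
      rw [blockSet_update, Finset.sum_range_succ _ (N + 1), hpoly_union_Ioc
        (blockSet_subset fun i _ => le_of_mem_vecs_capZero hν i) (by omega)]
    rw [Finset.sum_congr rfl e1, Finset.sum_add_distrib, ← blockOp_sum, ih, blockOp_sum,
      ← Finset.sum_add_distrib]
    refine Finset.sum_congr rfl fun ν hν => ?_
    have hle : ∑ i ∈ Finset.range (N + 1), ν i ≤ ∑ i ∈ Finset.range (N + 1), m i :=
      Finset.sum_le_sum fun i _ => le_of_mem_vecs_capZero hν i
    have h := blockOp_pasc (m (N + 1))
      (∑ i ∈ Finset.range (N + 1), m i - ∑ i ∈ Finset.range (N + 1), ν i)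
      (∑ i ∈ Finset.range (N + 1), ν i)
    rw [Nat.sub_add_cancel hle] at h
    rw [h]
    refine Finset.sum_congr rfl fun a _ => ?_
    rw [sum_range_update_succ, Finset.sum_range_succ m (N + 1)]
    congr 1
    omega

end

/-- Descents in the open interval `(i, n)` of the word encoded by `S`. -/
def desFrom (i n : ℕ) (S : Finset ℕ) : Finset ℕ :=
  (Finset.Ioo i n).filter fun p => p ∉ S ∧ p + 1 ∈ S

/-- The last descent in `(i, n)`, or `i` if there is none. -/
def ldesFrom (i n : ℕ) (S : Finset ℕ) : ℕ := max ((desFrom i n S).sup id) i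

lemma ldesFrom_of_empty {i n : ℕ} {S : Finset ℕ} (h : desFrom i n S = ∅) : ldesFrom i n S = i := by
  simp [ldesFrom, h]

lemma ldesFrom_eq_sup {i n : ℕ} {S : Finset ℕ} (h : desFrom i n S ≠ ∅) :
    ldesFrom i n S = (desFrom i n S).sup id := by
  obtain ⟨p, hp⟩ := Finset.nonempty_iff_ne_empty.2 h
  refine max_eq_left (le_trans ?_ (Finset.le_sup (f := id) hp))
  have := (Finset.mem_Ioo.1 (Finset.mem_filter.1 hp).1).1
  exact this.le

lemma desFrom_insert (i n : ℕ) (T : Finset ℕ) :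
    desFrom i n (insert (i + 1) T) = desFrom (i + 1) n T := by
  ext p
  simp only [desFrom, Finset.mem_filter, Finset.mem_Ioo, Finset.mem_insert, not_or]
  constructor
  · rintro ⟨h1, h2, h3⟩
    exact ⟨by omega, h2.2, h3.resolve_left (by omega)⟩
  · rintro ⟨h1, h2, h3⟩
    exact ⟨by omega, ⟨by omega, h2⟩, Or.inr h3⟩

lemma exists_desFrom {i n : ℕ} {T : Finset ℕ} (hT : T ⊆ Finset.Ioc i n) (h0 : T.Nonempty)
    (h : i + 1 ∉ T) : ∃ p ∈ desFrom i n T, i + 1 ≤ p := by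
  have hm := T.min'_mem h0
  have h1 := Finset.mem_Ioc.1 (hT hm)
  have h2 : T.min' h0 ≠ i + 1 := fun he => h (he ▸ hm)
  refine ⟨T.min' h0 - 1, ?_, by omega⟩
  simp only [desFrom, Finset.mem_filter, Finset.mem_Ioo]
  refine ⟨by omega, fun hc => ?_, ?_⟩
  · have := T.min'_le _ hc; omega
  · rwa [Nat.sub_add_cancel (by omega)]

lemma ldesFrom_of_nonempty {i n : ℕ} {T : Finset ℕ} (hT : T ⊆ Finset.Ioc (i + 1) n)
    (h0 : T.Nonempty) : ldesFrom i n T = ldesFrom (i + 1) n T := by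
  have hi : i + 1 ∉ T := fun h => by have := Finset.mem_Ioc.1 (hT h); omega
  by_cases h : i + 1 + 1 ∈ T
  · have h1 := Finset.mem_Ioc.1 (hT h)
    have : desFrom i n T = insert (i + 1) (desFrom (i + 1) n T) := by
      ext p
      simp only [desFrom, Finset.mem_filter, Finset.mem_Ioo, Finset.mem_insert]
      constructor
      · rintro ⟨h2, h3⟩
        by_cases hp : p = i + 1
        · exact Or.inl hp
        · exact Or.inr ⟨by omega, h3⟩
      · rintro (rfl | ⟨h2, h3⟩)
        · exact ⟨by omega, hi, h⟩
        · exact ⟨by omega, h3⟩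
    rw [ldesFrom, ldesFrom, this, Finset.sup_insert]
    simp only [id]
    omega
  · have : desFrom i n T = desFrom (i + 1) n T := by
      ext p
      simp only [desFrom, Finset.mem_filter, Finset.mem_Ioo]
      constructor
      · rintro ⟨h2, h3⟩
        refine ⟨⟨?_, h2.2⟩, h3⟩
        by_contra hp
        obtain rfl : p = i + 1 := by omega
        exact h h3.2
      · rintro ⟨h2, h3⟩
        exact ⟨by omega, h3⟩
    obtain ⟨p, hp, -⟩ := exists_desFrom hT h0 h
    have h1 := Finset.ne_empty_of_mem hp
    rw [ldesFrom_eq_sup h1, ← this, ← ldesFrom_eq_sup (this ▸ h1)]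

lemma desFrom_eq_empty_iff {i n : ℕ} {T : Finset ℕ} (hT : T ⊆ Finset.Ioc i n) :
    desFrom i n T = ∅ ↔ T = Finset.Ioc i (i + T.card) := by
  constructor
  · intro h
    rcases T.eq_empty_or_nonempty with h0 | h0
    · simp [h0]
    have hdown : ∀ d p, p + d ∈ T → i < p → p ∈ T := by
      intro d
      induction d with
      | zero => intro p hp _; exact hp
      | succ d ih =>
        intro p hp hip
        refine ih p ?_ hip
        by_contra hc
        have h1 := Finset.mem_Ioc.1 (hT hp)
        have : p + d ∈ desFrom i n T := by
          simp only [desFrom, Finset.mem_filter, Finset.mem_Ioo]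
          exact ⟨by omega, hc, by rwa [add_assoc]⟩
        rw [h] at this
        exact absurd this (Finset.notMem_empty _)
    have hTM : T = Finset.Ioc i (T.max' h0) := by
      ext p
      rw [Finset.mem_Ioc]
      constructor
      · exact fun hp => ⟨(Finset.mem_Ioc.1 (hT hp)).1, T.le_max' _ hp⟩
      · rintro ⟨h1, h2⟩
        refine hdown (T.max' h0 - p) p ?_ h1
        rw [Nat.add_sub_cancel' h2]; exact T.max'_mem h0
    have hM := Finset.mem_Ioc.1 (hT (T.max'_mem h0))
    have hc : T.card = T.max' h0 - i := by
      conv_lhs => rw [hTM]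
      simp
    rw [hc, Nat.add_sub_cancel' hM.1.le]
    exact hTM
  · intro h
    rw [h]
    ext p
    simp only [desFrom, Finset.mem_filter, Finset.mem_Ioo, Finset.mem_Ioc, Finset.notMem_empty,
      iff_false]
    omega

/-- The ballot condition on `(i, n]` with starting height `h`. -/
def BallotFrom (i n h : ℕ) (S : Finset ℕ) : Prop :=
  ∀ j ∈ Finset.Ioc i n, 2 * (S.filter (· ≤ j)).card ≤ (j - i) + h

lemma ballotFrom_succ_height {i n h : ℕ} {T : Finset ℕ}
    (hT : T ⊆ Finset.Ioc (i + 1) n) : BallotFrom i n h T ↔ BallotFrom (i + 1) n (h + 1) T := by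
  constructor
  · intro H j hj
    rw [Finset.mem_Ioc] at hj
    have := H j (Finset.mem_Ioc.2 ⟨by omega, hj.2⟩)
    omega
  · intro H j hj
    rw [Finset.mem_Ioc] at hj
    by_cases h1 : j = i + 1
    · subst h1
      have : T.filter (· ≤ i + 1) = ∅ := Finset.filter_eq_empty_iff.2 fun x hx hc => by
        have := Finset.mem_Ioc.1 (hT hx); omega
      rw [this]; simp
    · have := H j (Finset.mem_Ioc.2 ⟨by omega, hj.2⟩)
      omega

lemma ballotFrom_insert {i n h : ℕ} {T : Finset ℕ} (hi : i < n)
    (hT : T ⊆ Finset.Ioc (i + 1) n) :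
    BallotFrom i n h (insert (i + 1) T) ↔ 1 ≤ h ∧ BallotFrom (i + 1) n (h - 1) T := by
  have hi' : i + 1 ∉ T := fun h => by have := Finset.mem_Ioc.1 (hT h); omega
  have hcard : ∀ j, i < j → ((insert (i + 1) T).filter (· ≤ j)).card =
      (T.filter (· ≤ j)).card + 1 := fun j hj => by
    rw [Finset.filter_insert, if_pos (by omega), Finset.card_insert_of_notMem (by simp [hi'])]
  constructor
  · intro H
    have h1 := H (i + 1) (Finset.mem_Ioc.2 ⟨by omega, hi⟩)
    rw [hcard _ (by omega)] at h1
    refine ⟨by omega, fun j hj => ?_⟩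
    rw [Finset.mem_Ioc] at hj
    have h2 := H j (Finset.mem_Ioc.2 ⟨by omega, hj.2⟩)
    rw [hcard _ (by omega)] at h2
    omega
  · rintro ⟨h1, H⟩ j hj
    rw [Finset.mem_Ioc] at hj
    rw [hcard _ hj.1]
    by_cases hj1 : j = i + 1
    · subst hj1
      have : T.filter (· ≤ i + 1) = ∅ := Finset.filter_eq_empty_iff.2 fun x hx hc => by
        have := Finset.mem_Ioc.1 (hT hx); omega
      rw [this]; simp; omega
    · have := H j (Finset.mem_Ioc.2 ⟨by omega, hj.2⟩)
      omega

lemma ballotFrom_Ioc {i n h k : ℕ} (hk : i + k ≤ n) :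
    BallotFrom i n h (Finset.Ioc i (i + k)) ↔ k ≤ h := by
  have hf : ∀ j, (Finset.Ioc i (i + k)).filter (· ≤ j) = Finset.Ioc i (min j (i + k)) := by
    intro j; ext x; simp; omega
  constructor
  · intro H
    by_cases h0 : k = 0
    · omega
    have := H (i + k) (Finset.mem_Ioc.2 ⟨by omega, hk⟩)
    rw [hf] at this
    simp at this
    omega
  · intro H j hj
    rw [Finset.mem_Ioc] at hj
    rw [hf, Nat.card_Ioc]
    omega

section
open Polynomial

/-- Generating polynomial, by last descent, of the words on `(i, n]` with `k` down letters
staying ballot when started at height `h`. -/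
def ballotPoly (n i k h : ℕ) : ℤ[X] :=
  ∑ S ∈ (Finset.Ioc i n).powerset,
    if S.card = k ∧ BallotFrom i n h S then X ^ (n - ldesFrom i n S) else 0

lemma ballotPoly_eq_zero {n i k h : ℕ} (hk : n - i < k) : ballotPoly n i k h = 0 := by
  refine Finset.sum_eq_zero fun S hS => if_neg fun hc => ?_
  have := Finset.card_le_card (Finset.mem_powerset.1 hS)
  rw [Nat.card_Ioc] at this
  omega

lemma ballotPoly_zero (n i h : ℕ) : ballotPoly n i 0 h = X ^ (n - i) := by
  rw [ballotPoly, Finset.sum_eq_single_of_mem ∅ (by simp)]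
  · rw [if_pos ⟨rfl, fun j _ => by simp⟩, ldesFrom_of_empty]
    simp [desFrom]
  · intro S _ hS
    rw [if_neg]
    rintro ⟨hc, -⟩
    exact hS (Finset.card_eq_zero.1 hc)

lemma ballotPoly_succ {n i k h : ℕ} (hi : i < n) :
    ballotPoly n i (k + 1) h = ballotPoly n (i + 1) (k + 1) (h + 1) +
      if 1 ≤ h then ballotPoly n (i + 1) k (h - 1) +
        (if k + 1 ≤ n - i ∧ k + 1 ≤ h then X ^ (n - i) - X ^ (n - i - 1) else 0) else 0 := by
  have hI : Finset.Ioc i n = insert (i + 1) (Finset.Ioc (i + 1) n) := by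
    ext x; simp; omega
  rw [ballotPoly, hI, Finset.sum_powerset_insert (by simp)]
  congr 1
  · refine Finset.sum_congr rfl fun T hT => ?_
    rw [Finset.mem_powerset] at hT
    rw [ballotFrom_succ_height hT]
    split_ifs with hc
    · rw [ldesFrom_of_nonempty hT (Finset.card_pos.1 (by omega))]
    · rfl
  · have e1 : ∀ T ∈ (Finset.Ioc (i + 1) n).powerset,
        (if (insert (i + 1) T).card = k + 1 ∧ BallotFrom i n h (insert (i + 1) T) then
          (X : ℤ[X]) ^ (n - ldesFrom i n (insert (i + 1) T)) else 0) =
        if 1 ≤ h then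
          (if T.card = k ∧ BallotFrom (i + 1) n (h - 1) T then X ^ (n - ldesFrom (i + 1) n T)
            else 0) +
          (if T = Finset.Ioc (i + 1) (i + 1 + k) then
            (if k + 1 ≤ n - i ∧ k + 1 ≤ h then X ^ (n - i) - X ^ (n - i - 1) else 0) else 0)
          else 0 := by
      intro T hT
      rw [Finset.mem_powerset] at hT
      have hi' : i + 1 ∉ T := fun h => by have := Finset.mem_Ioc.1 (hT h); omega
      rw [ballotFrom_insert hi hT, Finset.card_insert_of_notMem hi']
      simp only [Nat.add_right_cancel_iff]
      by_cases h1 : 1 ≤ h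
      · rw [if_pos h1]
        simp only [h1, true_and]
        have hTc := Finset.card_le_card hT
        rw [Nat.card_Ioc] at hTc
        by_cases hd : desFrom (i + 1) n T = ∅
        · rw [ldesFrom_of_empty hd, ldesFrom_of_empty ((desFrom_insert _ _ _).trans hd)]
          have hd2 := (desFrom_eq_empty_iff hT).1 hd
          by_cases hk : T.card = k
          · rw [hk] at hd2
            have hb : BallotFrom (i + 1) n (h - 1) T ↔ k + 1 ≤ h := by
              rw [hd2, ballotFrom_Ioc (by omega)]; omega
            rw [if_pos hd2]
            simp only [hk, hb, true_and, show k + 1 ≤ n - i by omega]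
            split_ifs
            · rw [show n - i - 1 = n - (i + 1) by omega]; ring
            · simp
          · rw [if_neg (by tauto), if_neg (by tauto), if_neg, add_zero]
            intro he
            apply hk
            rw [he]; simp
        · rw [if_neg (c := T = _), add_zero, ldesFrom_eq_sup hd, ldesFrom_eq_sup, desFrom_insert]
          · rwa [desFrom_insert]
          · intro he
            apply hd
            rw [desFrom_eq_empty_iff hT]
            conv_lhs => rw [he]
            congr 2
            rw [he]; simp
      · rw [if_neg h1, if_neg (by tauto)]
    rw [Finset.sum_congr rfl e1]
    by_cases h1 : 1 ≤ h
    · simp only [if_pos h1]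
      rw [Finset.sum_add_distrib]
      congr 1
      rw [Finset.sum_ite_eq']
      split_ifs with h2 h3 h3
      · rfl
      · rfl
      · exfalso
        apply h2
        rw [Finset.mem_powerset]
        intro x
        simp only [Finset.mem_Ioc]
        omega
      · rfl
    · simp only [if_neg h1, Finset.sum_const_zero]

lemma ballotPoly_eq (n ℓ i k h : ℕ) (hi : i + ℓ = n) (hkl : k ≤ ℓ) (hk : 2 * k ≤ ℓ + h + 1) :
    ballotPoly n i k h =
      pasc (ℓ - k) k - if k ≤ h then 0 else pasc (ℓ - k + 1 + h) (k - 1 - h) := by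
  induction ℓ generalizing i k h with
  | zero =>
    obtain rfl : k = 0 := by omega
    rw [ballotPoly_zero]
    simp [pasc_zero_left, ← hi]
  | succ ℓ ih =>
    cases k with
    | zero => rw [ballotPoly_zero]; simp [pasc_zero_right, ← hi]
    | succ k =>
      rw [ballotPoly_succ (by omega)]
      have hn : n - i = ℓ + 1 := by omega
      rw [hn]
      by_cases hkl2 : k = ℓ
      · subst hkl2
        rw [ballotPoly_eq_zero (by omega), zero_add]
        by_cases h1 : 1 ≤ h
        · rw [if_pos h1, ih (i + 1) k (h - 1) (by omega) le_rfl (by omega)]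
          by_cases h2 : k + 1 ≤ h
          · rw [if_pos (by omega : k ≤ h - 1), if_pos ⟨le_rfl, h2⟩, if_pos h2]
            simp [pasc_zero_left]
          · obtain rfl : k = h := by omega
            rw [if_neg (by omega), if_neg (by omega), if_neg (by omega)]
            rw [show k - k = 0 by omega, show k - 1 - (k - 1) = 0 by omega,
              show k + 1 - (k + 1) = 0 by omega, show k + 1 - 1 - k = 0 by omega,
              show 0 + 1 + (k - 1) = k by omega, show 0 + 1 + k = k + 1 by omega]
            simp [pasc_zero_left, pasc_zero_right]
        · obtain rfl : h = 0 := by omega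
          obtain rfl : k = 0 := by omega
          simp [pasc_zero_left, pasc_zero_right]
      · have h3 := pasc_succ_succ (ℓ - k - 1) k
        rw [show ℓ - k - 1 + 1 = ℓ - k by omega, show ℓ - k - 1 + k + 2 = ℓ + 1 by omega,
          show ℓ - k - 1 + k + 1 = ℓ by omega] at h3
        rw [ih (i + 1) (k + 1) (h + 1) (by omega) (by omega) (by omega),
          show ℓ + 1 - (k + 1) = ℓ - k by omega, show ℓ - (k + 1) = ℓ - k - 1 by omega, h3]
        by_cases h1 : 1 ≤ h
        · rw [if_pos h1, ih (i + 1) k (h - 1) (by omega) (by omega) (by omega)]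
          by_cases h2 : k + 1 ≤ h
          · rw [if_pos (by omega), if_pos (by omega), if_pos (by omega), if_pos (by omega)]
            simp
            ring
          · rw [if_neg (by omega : ¬ k ≤ h - 1), if_neg (by omega : ¬ (_ ∧ _)),
              if_neg (by omega : ¬ k + 1 ≤ h)]
            by_cases h4 : k = h
            · subst h4
              rw [if_pos le_rfl, show k + 1 - 1 - k = 0 by omega,
                show k - 1 - (k - 1) = 0 by omega, show ℓ - k + 1 + (k - 1) = ℓ by omega,
                show ℓ - k + 1 + k = ℓ + 1 by omega, pasc_zero_right, pasc_zero_right]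
              ring
            · have h5 := pasc_succ_succ (ℓ - k + h) (k - h - 1)
              rw [show k - h - 1 + 1 = k - h by omega,
                show ℓ - k + h + (k - h - 1) + 2 = ℓ + 1 by omega,
                show ℓ - k + h + (k - h - 1) + 1 = ℓ by omega] at h5
              rw [if_neg (by omega), show k + 1 - 1 - h = k - h by omega,
                show ℓ - k + 1 + h = ℓ - k + h + 1 by omega, h5,
                show ℓ - k - 1 + 1 + (h + 1) = ℓ - k + h + 1 by omega,
                show k + 1 - 1 - (h + 1) = k - h - 1 by omega,
                show ℓ - k + 1 + (h - 1) = ℓ - k + h by omega,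
                show k - 1 - (h - 1) = k - h by omega]
              ring
        · obtain rfl : h = 0 := by omega
          rw [if_neg h1, if_neg (by omega : ¬ k + 1 ≤ 0)]
          by_cases h4 : k = 0
          · subst h4
            simp [pasc_zero_right]
            ring
          · have h5 := pasc_succ_succ (ℓ - k) (k - 1)
            rw [show k - 1 + 1 = k by omega, show ℓ - k + (k - 1) + 2 = ℓ + 1 by omega,
              show ℓ - k + (k - 1) + 1 = ℓ by omega] at h5
            rw [if_neg (by omega), add_zero, add_zero, show k + 1 - 1 - 0 = k by omega, h5,
              show ℓ - k - 1 + 1 + (0 + 1) = ℓ - k + 1 by omega,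
              show k + 1 - 1 - (0 + 1) = k - 1 by omega]
            ring

lemma ldesFrom_zero (n : ℕ) (S : Finset ℕ) : ldesFrom 0 n S = ldesSet n S := by
  have : desFrom 0 n S = DesSet n S := by
    ext p; simp only [desFrom, DesSet, Finset.mem_filter, Finset.mem_Ioo, Finset.mem_Ico]
    rfl
  rw [ldesFrom, this, ldesSet]
  simp

lemma sum_card_mul_X_pow (n k : ℕ) (P : Finset ℕ → Prop) :
    ∑ j ∈ Finset.range (n + 1), ((((Finset.Icc 1 n).powerset.filter fun S =>
        S.card = k ∧ P S ∧ ldesSet n S = n - j).card : ℕ) : ℤ[X]) * X ^ j =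
      ∑ S ∈ (Finset.Ioc 0 n).powerset,
        if S.card = k ∧ P S then X ^ (n - ldesFrom 0 n S) else 0 := by
  have h1 : ∀ j, ((((Finset.Icc 1 n).powerset.filter fun S =>
        S.card = k ∧ P S ∧ ldesSet n S = n - j).card : ℕ) : ℤ[X]) * X ^ j =
      ∑ S ∈ (Finset.Ioc 0 n).powerset,
        if S.card = k ∧ P S ∧ ldesSet n S = n - j then X ^ j else 0 := by
    intro j
    rw [← Finset.sum_filter, Finset.sum_const, nsmul_eq_mul]
    rfl
  simp only [h1]
  rw [Finset.sum_comm]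
  refine Finset.sum_congr rfl fun S hS => ?_
  have hl : ldesSet n S ≤ n := by
    refine Finset.sup_le fun p hp => ?_
    have := Finset.mem_Ico.1 (Finset.mem_filter.1 hp).1
    exact this.2.le
  rw [ldesFrom_zero]
  by_cases hc : S.card = k ∧ P S
  · rw [if_pos hc, Finset.sum_eq_single_of_mem (n - ldesSet n S)
      (Finset.mem_range.2 (by omega))]
    · rw [if_pos ⟨hc.1, hc.2, by omega⟩]
    · intro j hj hne
      rw [Finset.mem_range] at hj
      rw [if_neg]
      rintro ⟨-, -, h⟩
      omega
  · rw [if_neg hc]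
    exact Finset.sum_eq_zero fun j _ => if_neg (by tauto)

theorem sum_bCoeff (n k : ℕ) (hk : k ≤ n) :
    ∑ j ∈ Finset.range (n + 1), (bCoeff n k j : ℤ[X]) * X ^ j = pasc (n - k) k := by
  have h := sum_card_mul_X_pow n k fun _ => True
  have h2 := ballotPoly_eq n n 0 k n (by omega) hk (by omega)
  rw [if_pos hk, sub_zero] at h2
  rw [← h2, ballotPoly]
  simp only [true_and, and_true] at h
  simp only [bCoeff]
  rw [h]
  refine Finset.sum_congr rfl fun S hS => ?_
  have hb : BallotFrom 0 n n S := by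
    intro j hj
    rw [Finset.mem_Ioc] at hj
    have h3 : S.filter (· ≤ j) ⊆ Finset.Ioc 0 j := by
      intro x hx
      rw [Finset.mem_filter] at hx
      have := Finset.mem_Ioc.1 (Finset.mem_powerset.1 hS hx.1)
      exact Finset.mem_Ioc.2 ⟨this.1, hx.2⟩
    have := Finset.card_le_card h3
    rw [Nat.card_Ioc] at this
    omega
  simp only [hb, and_true]

theorem sum_aCoeff (n k : ℕ) (hk : 2 * k ≤ n) :
    ∑ j ∈ Finset.range (n + 1), (aCoeff n k j : ℤ[X]) * X ^ j = pascDiff n k := by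
  have h := sum_card_mul_X_pow n k fun S => ∀ i ∈ Finset.Icc 1 n, 2 * (S.filter (· ≤ i)).card ≤ i
  have h2 := ballotPoly_eq n n 0 k 0 (by omega) (by omega) (by omega)
  refine Eq.trans (by simp only [aCoeff]; congr!) (h.trans ?_)
  rw [pascDiff]
  have e : (if k ≤ 0 then 0 else pasc (n - k + 1 + 0) (k - 1 - 0)) =
      if k = 0 then 0 else pasc (n + 1 - k) (k - 1) := by
    simp only [Nat.le_zero]
    split_ifs
    · rfl
    · congr 1; omega
  rw [← e, ← h2, ballotPoly]
  refine Finset.sum_congr rfl fun S _ => ?_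
  have hb : BallotFrom 0 n 0 S ↔ ∀ i ∈ Finset.Icc 1 n, 2 * (S.filter (· ≤ i)).card ≤ i := by
    simp only [BallotFrom, Nat.sub_zero, add_zero]
    rfl
  by_cases hS : S.card = k ∧ BallotFrom 0 n 0 S
  · rw [if_pos hS, if_pos ⟨hS.1, hb.1 hS.2⟩]
  · rw [if_neg hS, if_neg fun h => hS ⟨h.1, hb.2 h.2⟩]

end

/-- The weakly increasing word on positions `1, …, n` with content `c`, and `0` elsewhere. -/
def sortedWord (c : ℕ → ℕ) (n a : ℕ) : ℕ :=
  if 1 ≤ a ∧ a ≤ n then sInf {v | a ≤ ∑ i ∈ Finset.range (v + 1), c i} else 0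

lemma sum_range_eq_of_le {c : ℕ → ℕ} {N M : ℕ} (hc : ∀ v, N ≤ v → c v = 0) (h : N ≤ M) :
    ∑ i ∈ Finset.range M, c i = ∑ i ∈ Finset.range N, c i := by
  symm
  refine Finset.sum_subset (Finset.range_mono h) fun x _ hx => hc x ?_
  simpa using hx

lemma sum_range_le_of_eq {c : ℕ → ℕ} {N : ℕ} (hc : ∀ v, N ≤ v → c v = 0) (M : ℕ) :
    ∑ i ∈ Finset.range M, c i ≤ ∑ i ∈ Finset.range N, c i := by
  rcases le_total M N with h | h
  · exact sum_range_mono c h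
  · exact (sum_range_eq_of_le hc h).le

lemma sortedWord_le_iff {c : ℕ → ℕ} {N n a : ℕ} (hc : ∀ v, N ≤ v → c v = 0)
    (hn : ∑ i ∈ Finset.range N, c i = n) (h1 : 1 ≤ a) (h2 : a ≤ n) (v : ℕ) :
    sortedWord c n a ≤ v ↔ a ≤ ∑ i ∈ Finset.range (v + 1), c i := by
  rw [sortedWord, if_pos ⟨h1, h2⟩]
  have hne : {v | a ≤ ∑ i ∈ Finset.range (v + 1), c i}.Nonempty :=
    ⟨N, by rw [Set.mem_ofPred_eq, sum_range_eq_of_le hc (Nat.le_succ N), hn]; exact h2⟩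
  constructor
  · intro h
    have h3 := Nat.sInf_mem hne
    exact le_trans h3 (sum_range_mono c (by omega))
  · intro h
    exact Nat.sInf_le h

lemma le_iff_of_content {g c : ℕ → ℕ} {n : ℕ}
    (hg : ∀ a b, 1 ≤ a → a ≤ b → b ≤ n → g a ≤ g b)
    (hc : ∀ v, c v = ((Finset.Icc 1 n).filter fun a => g a = v).card) {a : ℕ}
    (h1 : 1 ≤ a) (h2 : a ≤ n) (v : ℕ) :
    g a ≤ v ↔ a ≤ ∑ i ∈ Finset.range (v + 1), c i := by
  have hsum : ∑ i ∈ Finset.range (v + 1), c i =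
      ((Finset.Icc 1 n).filter fun a => g a ≤ v).card := by
    rw [Finset.card_eq_sum_card_fiberwise (t := Finset.range (v + 1)) (f := g)]
    · refine Finset.sum_congr rfl fun i hi => ?_
      rw [Finset.mem_range] at hi
      rw [hc, Finset.filter_filter]
      congr 1
      ext x
      simp only [Finset.mem_filter]
      constructor
      · rintro ⟨h, rfl⟩; exact ⟨h, by omega, rfl⟩
      · rintro ⟨h, -, h'⟩; exact ⟨h, h'⟩
    · intro x hx
      simp only [Finset.coe_filter, Set.mem_ofPred_eq, Finset.coe_range, Set.mem_Iio] at hx ⊢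
      omega
  rw [hsum]
  constructor
  · intro h
    have : Finset.Icc 1 a ⊆ (Finset.Icc 1 n).filter fun a => g a ≤ v := by
      intro x hx
      rw [Finset.mem_Icc] at hx
      rw [Finset.mem_filter, Finset.mem_Icc]
      exact ⟨by omega, (hg x a hx.1 hx.2 h2).trans h⟩
    have := Finset.card_le_card this
    simpa using this
  · intro h
    by_contra hlt
    have : ((Finset.Icc 1 n).filter fun a => g a ≤ v) ⊆ Finset.Ico 1 a := by
      intro x hx
      rw [Finset.mem_filter, Finset.mem_Icc] at hx
      rw [Finset.mem_Ico]
      refine ⟨hx.1.1, ?_⟩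
      by_contra hxa
      exact hlt ((hg a x h1 (by omega) hx.1.2).trans hx.2)
    have := Finset.card_le_card this
    rw [Nat.card_Ico] at this
    omega

lemma sum_eq_of_content {g c : ℕ → ℕ} {n N : ℕ}
    (hc : ∀ v, c v = ((Finset.Icc 1 n).filter fun a => g a = v).card)
    (hN : ∀ v, N ≤ v → c v = 0) : ∑ i ∈ Finset.range N, c i = n := by
  have h : (Finset.Icc 1 n).card = n := by simp
  rw [← h, Finset.card_eq_sum_card_fiberwise (t := Finset.range N) (f := g)]
  · exact Finset.sum_congr rfl fun i _ => hc i
  · intro x hx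
    simp only [Finset.coe_range, Set.mem_Iio]
    by_contra hlt
    have h0 := hN (g x) (by omega)
    rw [hc, Finset.card_eq_zero, Finset.filter_eq_empty_iff] at h0
    exact h0 hx rfl

lemma eq_sortedWord_of_content {g c : ℕ → ℕ} {n N : ℕ}
    (hg : ∀ a b, 1 ≤ a → a ≤ b → b ≤ n → g a ≤ g b)
    (hc : ∀ v, c v = ((Finset.Icc 1 n).filter fun a => g a = v).card)
    (hN : ∀ v, N ≤ v → c v = 0) {a : ℕ} (h1 : 1 ≤ a) (h2 : a ≤ n) :
    g a = sortedWord c n a := by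
  have hn := sum_eq_of_content hc hN
  refine le_antisymm ?_ ?_
  · rw [le_iff_of_content hg hc h1 h2, ← sortedWord_le_iff hN hn h1 h2]
  · rw [sortedWord_le_iff hN hn h1 h2, ← le_iff_of_content hg hc h1 h2]

lemma sortedWord_mono {c : ℕ → ℕ} {N n a b : ℕ} (hc : ∀ v, N ≤ v → c v = 0)
    (hn : ∑ i ∈ Finset.range N, c i = n) (h1 : 1 ≤ a) (h2 : a ≤ b) (h3 : b ≤ n) :
    sortedWord c n a ≤ sortedWord c n b := by
  rw [sortedWord_le_iff hc hn h1 (h2.trans h3)]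
  exact h2.trans ((sortedWord_le_iff hc hn (h1.trans h2) h3 _).1 le_rfl)

lemma content_sortedWord {c : ℕ → ℕ} {N n : ℕ} (hc : ∀ v, N ≤ v → c v = 0)
    (hn : ∑ i ∈ Finset.range N, c i = n) (v : ℕ) :
    c v = ((Finset.Icc 1 n).filter fun a => sortedWord c n a = v).card := by
  have hle : ∑ i ∈ Finset.range (v + 1), c i ≤ n := hn ▸ sum_range_le_of_eq hc _
  have : ((Finset.Icc 1 n).filter fun a => sortedWord c n a = v) =
      Finset.Ioc (∑ i ∈ Finset.range v, c i) (∑ i ∈ Finset.range (v + 1), c i) := by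
    ext a
    rw [Finset.mem_filter, Finset.mem_Icc, Finset.mem_Ioc]
    constructor
    · rintro ⟨⟨h1, h2⟩, h3⟩
      refine ⟨?_, (sortedWord_le_iff hc hn h1 h2 v).1 h3.le⟩
      cases v with
      | zero => simp; omega
      | succ v =>
        have := (sortedWord_le_iff hc hn h1 h2 v).not.1 (by omega)
        omega
    · rintro ⟨h1, h2⟩
      have h3 : 1 ≤ a := by omega
      have h4 : a ≤ n := by omega
      refine ⟨⟨h3, h4⟩, le_antisymm ((sortedWord_le_iff hc hn h3 h4 v).2 h2) ?_⟩
      cases v with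
      | zero => exact Nat.zero_le _
      | succ v =>
        have := (sortedWord_le_iff hc hn h3 h4 v).not.2 (by omega)
        omega
  rw [this, Nat.card_Ioc, Finset.sum_range_succ]
  omega

lemma sortedWord_lt_succ_iff {c : ℕ → ℕ} {N n j : ℕ} (hc : ∀ v, N ≤ v → c v = 0)
    (hn : ∑ i ∈ Finset.range N, c i = n) (hj : j < n) :
    sortedWord c n j < sortedWord c n (j + 1) ↔ ∃ v, j = ∑ i ∈ Finset.range (v + 1), c i := by
  have key := sortedWord_le_iff hc hn (a := j + 1) (by omega) hj
  rcases Nat.eq_zero_or_pos j with rfl | h0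
  · have hz : sortedWord c n 0 = 0 := by simp [sortedWord]
    rw [hz]
    constructor
    · intro h
      have := (key 0).not.1 (by omega)
      exact ⟨0, by omega⟩
    · rintro ⟨v, hv⟩
      have := sum_range_mono c (show 1 ≤ v + 1 by omega)
      have := (key 0).not.2 (by rw [zero_add 1]; omega)
      omega
  · have key2 := sortedWord_le_iff hc hn (a := j) h0 hj.le
    constructor
    · intro h
      refine ⟨sortedWord c n j, ?_⟩
      have h1 := (key2 _).1 le_rfl
      have h2 := (key (sortedWord c n j)).not.1 (by omega)
      omega
    · rintro ⟨v, hv⟩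
      have h1 := (key2 v).2 hv.le
      have h2 := (key v).not.2 (by omega)
      omega

lemma finsupp_sum_eq {m : ℕ →₀ ℕ} {N : ℕ} (hN : ∀ v, N ≤ v → m v = 0) :
    (m.sum fun _ v => v) = ∑ i ∈ Finset.range N, m i :=
  Finsupp.sum_of_support_subset m (fun i hi => by
    rw [Finset.mem_range]
    by_contra h
    exact (Finsupp.mem_support_iff.1 hi) (hN i (by omega))) _ (fun _ _ => rfl)

lemma finsupp_bound (m : ℕ →₀ ℕ) : ∃ N, ∀ v, N + 1 ≤ v → m v = 0 := by
  refine ⟨m.support.sup id, fun v hv => ?_⟩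
  by_contra h
  have : id v ≤ m.support.sup id := Finset.le_sup (Finsupp.mem_support_iff.2 h)
  simp only [id] at this
  omega

/-- The positions at which a weakly increasing word of content `m` may increase. -/
def IsCut (m : ℕ → ℕ) (j : ℕ) : Prop := ∃ v, j = ∑ i ∈ Finset.range (v + 1), m i

theorem coeff_FB (R : Type) [CommRing R] {n N : ℕ} {J : Finset ℕ} (hJ : ∀ j ∈ J, j < n)
    {m : ℕ →₀ ℕ} (hN : ∀ v, N ≤ v → m v = 0) :
    FB R n J m = if ∑ i ∈ Finset.range N, m i = n ∧ ∀ j ∈ J, IsCut m j then 1 else 0 := by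
  rw [FB]
  split_ifs with h
  · obtain ⟨hn, hK⟩ := h
    rw [Nat.subtype_card {sortedWord m n}]
    · simp
    · intro f
      rw [Finset.mem_singleton]
      constructor
      · rintro rfl
        refine ⟨by simp [sortedWord], fun a ha => if_neg (by omega), fun a b hab hb => ?_,
          fun j hj => (sortedWord_lt_succ_iff hN hn (hJ j hj)).2 (hK j hj),
          content_sortedWord hN hn⟩
        rcases Nat.eq_zero_or_pos a with rfl | h0
        · simp [sortedWord]
        · exact sortedWord_mono hN hn h0 hab hb
      · rintro ⟨h0, h1, h2, -, h4⟩
        funext a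
        by_cases ha : 1 ≤ a ∧ a ≤ n
        · exact eq_sortedWord_of_content (fun a b _ hab hb => h2 a b hab hb) h4 hN ha.1 ha.2
        · rw [sortedWord, if_neg ha]
          rcases Nat.eq_zero_or_pos a with rfl | h
          · exact h0
          · exact h1 a (by omega)
  · rw [Nat.subtype_card ∅]
    · simp
    · intro f
      simp only [Finset.notMem_empty, false_iff]
      rintro ⟨h0, h1, h2, h3, h4⟩
      refine h ⟨sum_eq_of_content h4 hN, fun j hj => ?_⟩
      have hn := sum_eq_of_content h4 hN
      have hf : f = sortedWord m n := by
        funext a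
        by_cases ha : 1 ≤ a ∧ a ≤ n
        · exact eq_sortedWord_of_content (fun a b _ hab hb => h2 a b hab hb) h4 hN ha.1 ha.2
        · rw [sortedWord, if_neg ha]
          rcases Nat.eq_zero_or_pos a with rfl | h
          · exact h0
          · exact h1 a (by omega)
      have := h3 j hj
      rw [hf] at this
      exact (sortedWord_lt_succ_iff hN hn (hJ j hj)).1 this

lemma mem_DesBSet {n p : ℕ} {S : Finset ℕ} (hS : S ⊆ Finset.Icc 1 n) :
    p ∈ DesBSet n S ↔ p ∉ S ∧ p + 1 ∈ S := by
  have h0 : 0 ∉ S := fun h => by have := Finset.mem_Icc.1 (hS h); omega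
  have hle : p + 1 ∈ S → p < n := fun h => by have := Finset.mem_Icc.1 (hS h); omega
  rw [DesBSet]
  split_ifs with h
  · simp only [DesSet, Finset.mem_insert, Finset.mem_filter, Finset.mem_Ico]
    constructor
    · rintro (rfl | ⟨-, h1⟩)
      · exact ⟨h0, h⟩
      · exact h1
    · rintro ⟨h1, h2⟩
      have := hle h2
      rcases Nat.eq_zero_or_pos p with hp | hp
      · exact Or.inl hp
      · exact Or.inr ⟨by omega, h1, h2⟩
  · simp only [DesSet, Finset.mem_filter, Finset.mem_Ico]
    constructor
    · rintro ⟨-, h1⟩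
      exact h1
    · rintro ⟨h1, h2⟩
      have := hle h2
      rcases Nat.eq_zero_or_pos p with rfl | hp
      · exact absurd h2 h
      · exact ⟨by omega, h1, h2⟩

/-- The sets whose type-B descents are cuts of `m`. -/
def allowedSets (m : ℕ → ℕ) (n : ℕ) : Finset (Finset ℕ) :=
  (Finset.Icc 1 n).powerset.filter fun S => ∀ p ∈ DesBSet n S, IsCut m p

lemma mem_allowedSets {m : ℕ → ℕ} {n : ℕ} {S : Finset ℕ} :
    S ∈ allowedSets m n ↔ S ⊆ Finset.Icc 1 n ∧ ∀ p, p ∉ S → p + 1 ∈ S → IsCut m p := by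
  rw [allowedSets, Finset.mem_filter, Finset.mem_powerset]
  refine and_congr_right fun hS => ?_
  simp only [mem_DesBSet hS, and_imp]

lemma block_unique {m : ℕ → ℕ} {i j p : ℕ}
    (h1 : ∑ l ∈ Finset.range i, m l < p) (h2 : p ≤ ∑ l ∈ Finset.range (i + 1), m l)
    (h3 : ∑ l ∈ Finset.range j, m l < p) (h4 : p ≤ ∑ l ∈ Finset.range (j + 1), m l) : i = j := by
  rcases lt_trichotomy i j with h | h | h
  · have := sum_range_mono m (show i + 1 ≤ j from h); omega
  · exact h
  · have := sum_range_mono m (show j + 1 ≤ i from h); omega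

lemma exists_block {m : ℕ → ℕ} {N p : ℕ} (h1 : 1 ≤ p) (h2 : p ≤ ∑ l ∈ Finset.range N, m l) :
    ∃ j < N, ∑ l ∈ Finset.range j, m l < p ∧ p ≤ ∑ l ∈ Finset.range (j + 1), m l := by
  induction N with
  | zero => simp at h2; omega
  | succ N ih =>
    by_cases h : p ≤ ∑ l ∈ Finset.range N, m l
    · obtain ⟨j, hj, h3⟩ := ih h
      exact ⟨j, by omega, h3⟩
    · exact ⟨N, by omega, by omega, h2⟩

lemma inter_block_eq {m : ℕ → ℕ} {n : ℕ} {S : Finset ℕ} (hS : S ∈ allowedSets m n) (j : ℕ) :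
    S ∩ Finset.Ioc (∑ l ∈ Finset.range j, m l) (∑ l ∈ Finset.range (j + 1), m l) =
      Finset.Ioc (∑ l ∈ Finset.range j, m l) (∑ l ∈ Finset.range j, m l +
        (S ∩ Finset.Ioc (∑ l ∈ Finset.range j, m l) (∑ l ∈ Finset.range (j + 1), m l)).card) := by
  rw [mem_allowedSets] at hS
  rw [← desFrom_eq_empty_iff Finset.inter_subset_right]
  rw [desFrom, Finset.filter_eq_empty_iff]
  intro p hp hc
  rw [Finset.mem_Ioo] at hp
  simp only [Finset.mem_inter, Finset.mem_Ioc, not_and] at hc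
  obtain ⟨hc1, hc2, hc3⟩ := hc
  obtain ⟨v, hv⟩ := hS.2 p (fun h => hc1 h hp.1 hp.2.le) hc2
  rcases le_or_gt (v + 1) j with h | h
  · have := sum_range_mono m h; omega
  · have := sum_range_mono m (show j + 1 ≤ v + 1 by omega); omega

theorem sum_allowedSets {M : Type*} [AddCommMonoid M] (m : ℕ → ℕ) (N : ℕ) (φ : Finset ℕ → M) :
    ∑ S ∈ allowedSets m (∑ i ∈ Finset.range (N + 1), m i), φ S =
      ∑ ν ∈ vecs (capZero m) (N + 1), φ (blockSet m ν (N + 1)) := by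
  have hblock : ∀ ν ∈ vecs (capZero m) (N + 1), ∀ j < N + 1, blockSet m ν (N + 1) ∩
      Finset.Ioc (∑ l ∈ Finset.range j, m l) (∑ l ∈ Finset.range (j + 1), m l) =
      Finset.Ioc (∑ l ∈ Finset.range j, m l) (∑ l ∈ Finset.range j, m l + ν j) := by
    intro ν hν j hj
    ext p
    rw [Finset.mem_inter, mem_blockSet, Finset.mem_Ioc, Finset.mem_Ioc]
    constructor
    · rintro ⟨⟨i, -, h1, h2⟩, h3, h4⟩
      have hi := le_of_mem_vecs_capZero hν i
      obtain rfl : i = j := block_unique h1 (by rw [Finset.sum_range_succ]; omega) h3 h4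
      exact ⟨h1, h2⟩
    · rintro ⟨h1, h2⟩
      have hj' := le_of_mem_vecs_capZero hν j
      exact ⟨⟨j, hj, h1, h2⟩, h1, by rw [Finset.sum_range_succ]; omega⟩
  symm
  refine Finset.sum_bij (fun ν _ => blockSet m ν (N + 1)) ?_ ?_ ?_ fun _ _ => rfl
  · intro ν hν
    rw [mem_allowedSets]
    refine ⟨blockSet_subset fun i _ => le_of_mem_vecs_capZero hν i, fun p h1 h2 => ?_⟩
    obtain ⟨j, hj, h3, h4⟩ := mem_blockSet.1 h2
    have hp : p = ∑ l ∈ Finset.range j, m l := by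
      by_contra hne
      exact h1 (mem_blockSet.2 ⟨j, hj, by omega, by omega⟩)
    cases j with
    | zero =>
      have := (mem_vecs.1 hν).1 0 (by omega)
      simp only [capZero, Function.update_self] at this
      omega
    | succ j => exact ⟨j, hp⟩
  · intro ν hν μ hμ h
    funext j
    by_cases hj : j < N + 1
    · have h1 := hblock ν hν j hj
      have h2 : blockSet m ν (N + 1) = blockSet m μ (N + 1) := h
      rw [h2, hblock μ hμ j hj] at h1
      have := congrArg Finset.card h1
      rw [Nat.card_Ioc, Nat.card_Ioc] at this
      omega
    · rw [(mem_vecs.1 hν).2 j (by omega), (mem_vecs.1 hμ).2 j (by omega)]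
  · intro S hS
    let ν : ℕ → ℕ := fun j => if j < N + 1 then
      (S ∩ Finset.Ioc (∑ l ∈ Finset.range j, m l) (∑ l ∈ Finset.range (j + 1), m l)).card else 0
    have hν : ∀ j < N + 1, ν j = (S ∩ Finset.Ioc (∑ l ∈ Finset.range j, m l)
        (∑ l ∈ Finset.range (j + 1), m l)).card := fun j hj => if_pos hj
    refine ⟨ν, ?_, ?_⟩
    · rw [mem_vecs]
      refine ⟨fun j hj => ?_, fun j hj => if_neg (by omega)⟩
      rw [hν j hj]
      by_cases h0 : j = 0
      · subst h0
        refine (Finset.card_eq_zero.2 ?_).trans_le (Nat.zero_le _)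
        rw [Finset.eq_empty_iff_forall_notMem]
        intro p hp
        have hp' := hp
        rw [inter_block_eq hS 0, Finset.mem_Ioc] at hp'
        have h1 : 1 ∈ S ∩ Finset.Ioc (∑ l ∈ Finset.range 0, m l)
            (∑ l ∈ Finset.range (0 + 1), m l) := by
          rw [inter_block_eq hS 0, Finset.mem_Ioc]
          simp only [Finset.range_zero, Finset.sum_empty] at hp' ⊢
          omega
        rw [Finset.mem_inter, Finset.mem_Ioc] at h1
        have hS2 := mem_allowedSets.1 hS
        obtain ⟨v, hv⟩ := hS2.2 0
          (fun h => by have := Finset.mem_Icc.1 (hS2.1 h); omega) h1.1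
        have := sum_range_mono m (show 0 + 1 ≤ v + 1 by omega)
        omega
      · rw [capZero, Function.update_of_ne h0]
        have := Finset.card_le_card (Finset.inter_subset_right (s₁ := S) (s₂ :=
          Finset.Ioc (∑ l ∈ Finset.range j, m l) (∑ l ∈ Finset.range (j + 1), m l)))
        have h5 := Finset.sum_range_succ m j
        rw [Nat.card_Ioc] at this
        omega
    · ext p
      rw [mem_blockSet]
      constructor
      · rintro ⟨j, hj, h1, h2⟩
        have : p ∈ S ∩ Finset.Ioc (∑ l ∈ Finset.range j, m l)
            (∑ l ∈ Finset.range (j + 1), m l) := by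
          rw [inter_block_eq hS j, Finset.mem_Ioc, ← hν j hj]
          exact ⟨h1, h2⟩
        exact (Finset.mem_inter.1 this).1
      · intro hp
        have h1 := Finset.mem_Icc.1 ((mem_allowedSets.1 hS).1 hp)
        obtain ⟨j, hj, h2, h3⟩ := exists_block h1.1 h1.2
        refine ⟨j, hj, ?_⟩
        have : p ∈ S ∩ Finset.Ioc (∑ l ∈ Finset.range j, m l)
            (∑ l ∈ Finset.range (j + 1), m l) :=
          Finset.mem_inter.2 ⟨hp, Finset.mem_Ioc.2 ⟨h2, h3⟩⟩
        rw [inter_block_eq hS j, Finset.mem_Ioc, ← hν j hj] at this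
        exact this

theorem coeff_hSeries_mul (R : Type) [CommRing R] (k l : ℕ) {m : ℕ →₀ ℕ} {N : ℕ}
    (hN : ∀ v, N + 1 ≤ v → m v = 0) :
    MvPowerSeries.coeff m (hSeries R 1 k * hSeries R 0 l) =
      if ∑ i ∈ Finset.range (N + 1), m i = k + l then
        (((vecs (capZero m) (N + 1)).filter
          fun ν => ∑ i ∈ Finset.range (N + 1), ν i = k).card : R) else 0 := by
  have hcoe : ∀ (p : ℕ →₀ ℕ) (s t : ℕ), MvPowerSeries.coeff p (hSeries R s t) =
      if (p.sum fun _ v => v) = t ∧ ∀ a < s, p a = 0 then 1 else 0 := fun _ _ _ => rfl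
  have hle : ∀ p ∈ Finset.HasAntidiagonal.antidiagonal m, ∀ i, p.1 i + p.2 i = m i := fun p hp i => by
    rw [← Finset.HasAntidiagonal.mem_antidiagonal.1 hp]; rfl
  have hsum : ∀ p ∈ Finset.HasAntidiagonal.antidiagonal m,
      (p.1.sum fun _ v => v) = ∑ i ∈ Finset.range (N + 1), p.1 i ∧
      (p.2.sum fun _ v => v) = ∑ i ∈ Finset.range (N + 1), p.2 i := fun p hp =>
    ⟨finsupp_sum_eq fun v hv => by have := hle p hp v; have := hN v hv; omega,
      finsupp_sum_eq fun v hv => by have := hle p hp v; have := hN v hv; omega⟩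
  rw [MvPowerSeries.coeff_mul]
  simp only [hcoe, mul_ite, mul_one, mul_zero, ← ite_and]
  rw [Finset.sum_boole]
  split_ifs with h
  · congr 1
    refine Finset.card_bij (fun p _ => ⇑p.1) ?_ ?_ ?_
    · intro p hp
      rw [Finset.mem_filter] at hp
      obtain ⟨hp, ⟨h1, -⟩, h2, h3⟩ := hp
      rw [Finset.mem_filter, mem_vecs]
      refine ⟨⟨fun i hi => ?_, fun i hi => ?_⟩, (hsum p hp).1 ▸ h2⟩
      · have := hle p hp i
        rcases Nat.eq_zero_or_pos i with rfl | h0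
        · rw [h3 0 (by omega)]; exact Nat.zero_le _
        · rw [capZero, Function.update_of_ne (by omega)]; omega
      · have := hle p hp i
        have := hN i hi
        omega
    · rintro p hp q hq hpq
      have h1 : p.1 = q.1 := DFunLike.coe_injective hpq
      have hp := Finset.HasAntidiagonal.mem_antidiagonal.1 (Finset.mem_filter.1 hp).1
      have hq := Finset.HasAntidiagonal.mem_antidiagonal.1 (Finset.mem_filter.1 hq).1
      refine Prod.ext h1 ?_
      rw [← hq, h1] at hp
      exact add_left_cancel hp
    · intro ν hν
      obtain ⟨hν, hk⟩ := Finset.mem_filter.1 hν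
      have hνm := le_of_mem_vecs_capZero hν
      rw [mem_vecs] at hν
      let f : ℕ →₀ ℕ := Finsupp.onFinset (Finset.range (N + 1)) ν fun a ha => by
        rw [Finset.mem_range]; by_contra h'; exact ha (hν.2 a (by omega))
      have hf : ⇑f = ν := rfl
      have hmem : (f, m - f) ∈ Finset.HasAntidiagonal.antidiagonal m := by
        rw [Finset.HasAntidiagonal.mem_antidiagonal]
        ext i
        have := hνm i
        simp only [Finsupp.coe_add, Pi.add_apply, Finsupp.coe_tsub, Pi.sub_apply, hf]
        omega
      have h1 := hsum _ hmem
      have h2 : ∑ i ∈ Finset.range (N + 1), f i +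
          ∑ i ∈ Finset.range (N + 1), (m - f) i = k + l := by
        rw [← h, ← Finset.sum_add_distrib]
        exact Finset.sum_congr rfl fun i _ => hle _ hmem i
      refine ⟨(f, m - f), ?_, rfl⟩
      rw [Finset.mem_filter]
      refine ⟨hmem, ⟨?_, by simp⟩, ?_, ?_⟩
      · rw [h1.2]
        simp only [hf] at h2
        simp only at h2 ⊢
        omega
      · rw [h1.1]; exact hk
      · intro a ha
        obtain rfl : a = 0 := by omega
        have := hν.1 0 (by omega)
        simp only [capZero, Function.update_self] at this
        simp only [hf]
        omega
  · rw [Finset.filter_eq_empty_iff.2]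
    · simp
    · rintro p hp ⟨⟨h1, -⟩, h2, -⟩
      refine h ?_
      rw [(hsum p hp).1] at h2
      rw [(hsum p hp).2] at h1
      rw [← h1, ← h2, ← Finset.sum_add_distrib]
      exact Finset.sum_congr rfl fun i _ => (hle p hp i).symm

lemma card_twoRow_cells (a b v : ℕ) (T : ℕ → ℕ → ℕ) :
    Nat.card {p : ℕ × ℕ // p.2 < twoRow a b p.1 ∧ T p.1 p.2 = v} =
      ((Finset.Icc 1 a).filter fun x => T 0 (x - 1) = v).card +
      ((Finset.Icc 1 b).filter fun x => T 1 (x - 1) = v).card := by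
  rw [Nat.subtype_card (((Finset.Icc 1 a).filter fun x => T 0 (x - 1) = v).image
      (fun x => ((0 : ℕ), x - 1)) ∪ ((Finset.Icc 1 b).filter fun x => T 1 (x - 1) = v).image
      (fun x => ((1 : ℕ), x - 1)))]
  · rw [Finset.card_union_of_disjoint, Finset.card_image_of_injOn, Finset.card_image_of_injOn]
    · intro x hx y hy h
      simp only [Finset.coe_filter, Finset.mem_Icc, Set.mem_ofPred_eq, Prod.mk.injEq] at hx hy h
      omega
    · intro x hx y hy h
      simp only [Finset.coe_filter, Finset.mem_Icc, Set.mem_ofPred_eq, Prod.mk.injEq] at hx hy h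
      omega
    · rw [Finset.disjoint_left]
      intro x hx hy
      obtain ⟨y, -, rfl⟩ := Finset.mem_image.1 hx
      obtain ⟨z, -, hz⟩ := Finset.mem_image.1 hy
      simp at hz
  · rintro ⟨i, j⟩
    simp only [Finset.mem_union, Finset.mem_image, Finset.mem_filter, Finset.mem_Icc,
      Prod.mk.injEq]
    constructor
    · rintro (⟨x, ⟨hx, h⟩, rfl, rfl⟩ | ⟨x, ⟨hx, h⟩, rfl, rfl⟩)
      · exact ⟨by simp [twoRow]; omega, h⟩
      · exact ⟨by simp [twoRow]; omega, h⟩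
    · rintro ⟨h1, h2⟩
      rcases i with _ | _ | i
      · left; exact ⟨j + 1, ⟨by simp [twoRow] at h1; omega, h2⟩, rfl, rfl⟩
      · right; exact ⟨j + 1, ⟨by simp [twoRow] at h1; omega, h2⟩, rfl, rfl⟩
      · simp [twoRow] at h1

/-- The two-row filling with weakly increasing rows of contents `c` and `ν`. -/
def twoRowFilling (c ν : ℕ → ℕ) (a b : ℕ) : ℕ → ℕ → ℕ := fun i j =>
  if i = 0 then sortedWord c a (j + 1) else if i = 1 then sortedWord ν b (j + 1) else 0

lemma sortedWord_column_iff {c ν : ℕ → ℕ} {N a b : ℕ} (hab : b ≤ a)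
    (hc : ∀ v, N + 1 ≤ v → c v = 0) (hν : ∀ v, N + 1 ≤ v → ν v = 0)
    (ha : ∑ i ∈ Finset.range (N + 1), c i = a) (hb : ∑ i ∈ Finset.range (N + 1), ν i = b) :
    (∀ j < b, sortedWord c a (j + 1) < sortedWord ν b (j + 1)) ↔
      ∀ v < N + 1, ∑ i ∈ Finset.range (v + 1), ν i ≤ ∑ i ∈ Finset.range v, c i := by
  constructor
  · intro h v _
    by_contra hlt
    set x := ∑ i ∈ Finset.range (v + 1), ν i with hx
    have hxb : x ≤ b := hb ▸ sum_range_le_of_eq hν _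
    have h1 := h (x - 1) (by omega)
    rw [Nat.sub_add_cancel (by omega)] at h1
    have h2 := (sortedWord_le_iff hν hb (a := x) (by omega) hxb v).2 le_rfl
    cases v with
    | zero => omega
    | succ v =>
      have h3 := (sortedWord_le_iff hc ha (a := x) (by omega) (by omega) v).1 (by omega)
      omega
  · intro h j hj
    by_contra hlt
    set w := sortedWord ν b (j + 1) with hw
    have h1 := (sortedWord_le_iff hν hb (a := j + 1) (by omega) (by omega) w).1 le_rfl
    have h2 : j + 1 ≤ ∑ i ∈ Finset.range w, c i := by
      rcases lt_or_ge w (N + 1) with h' | h'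
      · exact h1.trans (h w h')
      · rw [sum_range_eq_of_le hc h']; omega
    cases hw' : w with
    | zero => rw [hw'] at h2; simp at h2
    | succ u =>
      rw [hw'] at h2 hlt
      have := (sortedWord_le_iff hc ha (a := j + 1) (by omega) (by omega) u).2 h2
      omega

lemma exists_content_of_rows {a b N : ℕ} {m : ℕ → ℕ} (hN : ∀ v, N + 1 ≤ v → m v = 0)
    {T : ℕ → ℕ → ℕ} (hrow : ∀ i j, j + 1 < twoRow a b i → T i j ≤ T i (j + 1))
    (hcont : ∀ v, m v = ((Finset.Icc 1 a).filter fun x => T 0 (x - 1) = v).card +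
      ((Finset.Icc 1 b).filter fun x => T 1 (x - 1) = v).card) :
    ∃ c ν : ℕ → ℕ, (∀ v, m v = c v + ν v) ∧
      ∑ i ∈ Finset.range (N + 1), c i = a ∧ ∑ i ∈ Finset.range (N + 1), ν i = b ∧
      (∀ j < a, T 0 j = sortedWord c a (j + 1)) ∧ ∀ j < b, T 1 j = sortedWord ν b (j + 1) := by
  have hmono : ∀ i, ∀ x y, 1 ≤ x → x ≤ y → y ≤ twoRow a b i → T i (x - 1) ≤ T i (y - 1) := by
    intro i x y hx hxy
    induction y, hxy using Nat.le_induction with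
    | base => intro _; exact le_rfl
    | succ y hy ih =>
      intro h
      have := hrow i (y - 1) (by omega)
      rw [Nat.sub_add_cancel (by omega)] at this
      exact (ih (by omega)).trans this
  have h0 : twoRow a b 0 = a := by simp [twoRow]
  have h1 : twoRow a b 1 = b := by simp [twoRow]
  have m0 := hmono 0
  have m1 := hmono 1
  rw [h0] at m0
  rw [h1] at m1
  refine ⟨fun v => ((Finset.Icc 1 a).filter fun x => T 0 (x - 1) = v).card,
    fun v => ((Finset.Icc 1 b).filter fun x => T 1 (x - 1) = v).card, hcont, ?_, ?_, ?_, ?_⟩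
  · exact sum_eq_of_content (g := fun x => T 0 (x - 1)) (fun _ => rfl)
      fun v hv => by have := hcont v; rw [hN v hv] at this; omega
  · exact sum_eq_of_content (g := fun x => T 1 (x - 1)) (fun _ => rfl)
      fun v hv => by have := hcont v; rw [hN v hv] at this; omega
  · intro j hj
    exact eq_sortedWord_of_content (g := fun x => T 0 (x - 1)) (N := N + 1) m0 (fun _ => rfl)
      (fun v hv => by have := hcont v; rw [hN v hv] at this; omega) (a := j + 1) (by omega) hj
  · intro j hj
    exact eq_sortedWord_of_content (g := fun x => T 1 (x - 1)) (N := N + 1) m1 (fun _ => rfl)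
      (fun v hv => by have := hcont v; rw [hN v hv] at this; omega) (a := j + 1) (by omega) hj

theorem schurCoeff_twoRow {s a b : ℕ} (hab : b ≤ a) {m : ℕ → ℕ} {N : ℕ}
    (hN : ∀ v, N + 1 ≤ v → m v = 0) :
    schurCoeff s (twoRow a b) m =
      if (∀ i < s, m i = 0) ∧ ∑ i ∈ Finset.range (N + 1), m i = a + b then
        ((vecs m (N + 1)).filter fun ν =>
          ∑ i ∈ Finset.range (N + 1), ν i = b ∧ IsBallot m ν (N + 1)).card else 0 := by
  have h0 : twoRow a b 0 = a := by simp [twoRow]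
  have h1 : twoRow a b 1 = b := by simp [twoRow]
  have h2 : ∀ i, twoRow a b (i + 2) = 0 := by simp [twoRow]
  have hz : ∀ c n a, ¬ a ≤ n → sortedWord c n a = 0 := fun c n a h => by
    rw [sortedWord, if_neg (fun h' => h h'.2)]
  rw [schurCoeff]
  simp only [card_twoRow_cells]
  split_ifs with h
  · obtain ⟨hs, hab'⟩ := h
    have key : ∀ ν ∈ (vecs m (N + 1)).filter (fun ν =>
        ∑ i ∈ Finset.range (N + 1), ν i = b ∧ IsBallot m ν (N + 1)),
        (∀ v, N + 1 ≤ v → m v - ν v = 0) ∧ (∀ v, N + 1 ≤ v → ν v = 0) ∧ (∀ v, ν v ≤ m v) ∧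
        (∀ v, ∑ i ∈ Finset.range v, (m i - ν i) + ∑ i ∈ Finset.range v, ν i =
          ∑ i ∈ Finset.range v, m i) ∧ ∑ i ∈ Finset.range (N + 1), (m i - ν i) = a ∧
        ∑ i ∈ Finset.range (N + 1), ν i = b ∧ IsBallot m ν (N + 1) := by
      intro ν hν
      obtain ⟨hν, hb, hB⟩ := Finset.mem_filter.1 hν
      rw [mem_vecs] at hν
      have hle : ∀ v, ν v ≤ m v := fun v => by
        rcases lt_or_ge v (N + 1) with hv | hv
        · exact hν.1 v hv
        · rw [hν.2 v hv]; exact Nat.zero_le _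
      have hadd : ∀ v, ∑ i ∈ Finset.range v, (m i - ν i) + ∑ i ∈ Finset.range v, ν i =
          ∑ i ∈ Finset.range v, m i := fun v => by
        rw [← Finset.sum_add_distrib]
        exact Finset.sum_congr rfl fun i _ => Nat.sub_add_cancel (hle i)
      have := hadd (N + 1)
      exact ⟨fun v hv => by rw [hN v hv, Nat.zero_sub], hν.2, hle, hadd, by omega, hb, hB⟩
    rw [Nat.subtype_card (((vecs m (N + 1)).filter fun ν =>
        ∑ i ∈ Finset.range (N + 1), ν i = b ∧ IsBallot m ν (N + 1)).image
        fun ν => twoRowFilling (fun i => m i - ν i) ν a b)]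
    · refine Finset.card_image_of_injOn ?_
      intro ν hν μ hμ hνμ
      obtain ⟨-, hν1, -, -, -, hν2, -⟩ := key ν hν
      obtain ⟨-, hμ1, -, -, -, hμ2, -⟩ := key μ hμ
      funext v
      rw [content_sortedWord hν1 hν2, content_sortedWord hμ1 hμ2]
      congr 1
      refine Finset.filter_congr fun x hx => ?_
      have hx := Finset.mem_Icc.1 hx
      have := congrFun (congrFun hνμ 1) (x - 1)
      simp only [twoRowFilling, one_ne_zero, if_false, if_true] at this
      rw [Nat.sub_add_cancel hx.1] at this
      rw [this]
    · intro T
      rw [Finset.mem_image]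
      constructor
      · rintro ⟨ν, hν, rfl⟩
        obtain ⟨hc0, hν0, hle, hadd, ha, hb, hB⟩ := key ν hν
        have hcont : ∀ v, m v =
            ((Finset.Icc 1 a).filter fun x => twoRowFilling (fun i => m i - ν i) ν a b 0
              (x - 1) = v).card +
            ((Finset.Icc 1 b).filter fun x => twoRowFilling (fun i => m i - ν i) ν a b 1
              (x - 1) = v).card := by
          intro v
          have e1 := content_sortedWord hc0 ha v
          have e2 := content_sortedWord hν0 hb v
          have e3 := hle v
          rw [show m v = (m v - ν v) + ν v by omega]
          refine congrArg₂ (· + ·) (e1.trans (congrArg _ ?_)) (e2.trans (congrArg _ ?_))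
          · refine Finset.filter_congr fun x hx => ?_
            rw [twoRowFilling, if_pos rfl, Nat.sub_add_cancel (Finset.mem_Icc.1 hx).1]
          · refine Finset.filter_congr fun x hx => ?_
            rw [twoRowFilling, if_neg one_ne_zero, if_pos rfl,
              Nat.sub_add_cancel (Finset.mem_Icc.1 hx).1]
        refine ⟨?_, ?_, ?_, ?_, hcont⟩
        · intro i j hj
          rcases i with _ | _ | i
          · rw [h0] at hj; exact sortedWord_mono hc0 ha (by omega) (by omega) (by omega)
          · rw [zero_add, h1] at hj ; exact sortedWord_mono hν0 hb (by omega) (by omega) (by omega)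
          · rw [h2] at hj; omega
        · intro i j hj
          rcases i with _ | i
          · rw [zero_add, h1] at hj
            refine (sortedWord_column_iff hab hc0 hν0 ha hb).2 (fun v hv => ?_) j hj
            have := hB v hv
            have := hadd v
            omega
          · rw [show i + 1 + 1 = i + 2 from rfl, h2] at hj; omega
        · intro i j hj
          by_contra hlt
          have h3 := hs _ (not_le.1 hlt)
          rw [hcont, Nat.add_eq_zero_iff, Finset.card_eq_zero, Finset.card_eq_zero] at h3
          rcases i with _ | _ | i
          · rw [h0] at hj
            exact Finset.filter_eq_empty_iff.1 h3.1
              (Finset.mem_Icc.2 ⟨Nat.le_add_left 1 j, hj⟩) rfl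
          · rw [zero_add, h1] at hj
            exact Finset.filter_eq_empty_iff.1 h3.2
              (Finset.mem_Icc.2 ⟨Nat.le_add_left 1 j, hj⟩) rfl
          · rw [h2] at hj; omega
        · intro i j hj
          rcases i with _ | _ | i
          · rw [h0] at hj; exact hz _ _ _ (by omega)
          · rw [zero_add, h1] at hj; exact hz _ _ _ (by omega)
          · rfl
      · rintro ⟨hrow, hcol, -, hout, hcont⟩
        obtain ⟨c, ν, hm, ha, hb, hT0, hT1⟩ := exists_content_of_rows hN hrow hcont
        obtain rfl : c = fun i => m i - ν i := by funext i; have := hm i; omega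
        have hc0 : ∀ v, N + 1 ≤ v → m v - ν v = 0 := fun v hv => by rw [hN v hv, Nat.zero_sub]
        have hν0 : ∀ v, N + 1 ≤ v → ν v = 0 := fun v hv => by
          have := hm v; rw [hN v hv] at this; omega
        have hcol' := (sortedWord_column_iff hab hc0 hν0 ha hb).1 fun j hj => by
          rw [← hT0 j (by omega), ← hT1 j hj]
          exact hcol 0 j (by rw [zero_add, h1]; exact hj)
        refine ⟨ν, ?_, ?_⟩
        · rw [Finset.mem_filter, mem_vecs]
          refine ⟨⟨fun i _ => by have := hm i; omega, hν0⟩, hb, fun v hv => ?_⟩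
          have h3 := hcol' v hv
          have h4 : ∑ i ∈ Finset.range v, m i =
              ∑ i ∈ Finset.range v, (m i - ν i) + ∑ i ∈ Finset.range v, ν i := by
            rw [← Finset.sum_add_distrib]
            exact Finset.sum_congr rfl fun i _ => hm i
          omega
        · funext i j
          rcases i with _ | _ | i
          · by_cases hj : j < a
            · exact (hT0 j hj).symm
            · rw [hout 0 j (by rw [h0]; exact hj)]
              exact hz _ _ _ (by omega)
          · by_cases hj : j < b
            · exact (hT1 j hj).symm
            · rw [hout (0 + 1) j (by rw [zero_add, h1]; exact hj)]
              exact hz _ _ _ (by omega)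
          · rw [hout (i + 1 + 1) j (by rw [show i + 1 + 1 = i + 2 from rfl, h2]; omega)]
            rfl
  · rw [Nat.subtype_card ∅]
    · simp
    · intro T
      simp only [Finset.notMem_empty, false_iff]
      rintro ⟨hrow, hcol, hge, -, hcont⟩
      refine h ⟨fun v hv => ?_, ?_⟩
      · rw [hcont v, Nat.add_eq_zero_iff, Finset.card_eq_zero, Finset.card_eq_zero,
          Finset.filter_eq_empty_iff, Finset.filter_eq_empty_iff]
        refine ⟨fun x hx hxv => ?_, fun x hx hxv => ?_⟩
        · have := hge 0 (x - 1) (by rw [h0]; have := Finset.mem_Icc.1 hx; omega)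
          omega
        · have := hge 1 (x - 1) (by rw [h1]; have := Finset.mem_Icc.1 hx; omega)
          omega
      · obtain ⟨c, ν, hm, ha, hb, -⟩ := exists_content_of_rows hN hrow hcont
        rw [← ha, ← hb, ← Finset.sum_add_distrib]
        exact Finset.sum_congr rfl fun i _ => hm i

lemma schurS_twoRow_zero (R : Type) [CommRing R] (s k : ℕ) :
    schurS R s (twoRow k 0) = hSeries R s k := by
  funext m
  obtain ⟨N, hN⟩ := finsupp_bound m
  rw [schurS, schurCoeff_twoRow (Nat.zero_le k) hN, hSeries, finsupp_sum_eq hN, add_zero]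
  have : ((vecs m (N + 1)).filter fun ν =>
      ∑ i ∈ Finset.range (N + 1), ν i = 0 ∧ IsBallot m ν (N + 1)) = {0} := by
    ext ν
    rw [Finset.mem_filter, Finset.mem_singleton, mem_vecs]
    constructor
    · rintro ⟨⟨-, h1⟩, h2, -⟩
      funext i
      rcases lt_or_ge i (N + 1) with hi | hi
      · exact Finset.sum_eq_zero_iff.1 h2 i (Finset.mem_range.2 hi)
      · exact h1 i hi
    · rintro rfl
      exact ⟨⟨fun _ _ => Nat.zero_le _, fun _ _ => rfl⟩, by simp, fun j _ => by simp⟩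
  rw [this, Finset.card_singleton]
  simp only [and_comm]
  split_ifs <;> simp

lemma filter_isBallot_vecs (m : ℕ → ℕ) (N b : ℕ) :
    ((vecs m (N + 1)).filter fun ν =>
      ∑ i ∈ Finset.range (N + 1), ν i = b ∧ IsBallot m ν (N + 1)) =
    ((vecs (capZero m) (N + 1)).filter fun ν => IsBallot m ν (N + 1)).filter
      fun ν => ∑ i ∈ Finset.range (N + 1), ν i = b := by
  ext ν
  simp only [Finset.mem_filter, mem_vecs]
  constructor
  · rintro ⟨⟨h1, h2⟩, h3, h4⟩
    refine ⟨⟨⟨fun i hi => ?_, h2⟩, h4⟩, h3⟩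
    by_cases h0 : i = 0
    · subst h0
      have := h4 0 hi
      simp only [capZero, Function.update_self]
      simpa using this
    · rw [capZero, Function.update_of_ne h0]
      exact h1 i hi
  · rintro ⟨⟨⟨h1, h2⟩, h4⟩, h3⟩
    exact ⟨⟨fun i _ => le_of_mem_vecs_capZero (mem_vecs.2 ⟨h1, h2⟩) i, h2⟩, h3, h4⟩

theorem coeff_schurS_twoRow (R : Type) [CommRing R] {a b : ℕ} (hab : b ≤ a) {m : ℕ →₀ ℕ} {N : ℕ}
    (hN : ∀ v, N + 1 ≤ v → m v = 0) :
    MvPowerSeries.coeff m (schurS R 0 (twoRow a b)) =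
      if ∑ i ∈ Finset.range (N + 1), m i = a + b then
        ((((vecs (capZero m) (N + 1)).filter fun ν => IsBallot m ν (N + 1)).filter
          fun ν => ∑ i ∈ Finset.range (N + 1), ν i = b).card : R) else 0 := by
  change ((schurCoeff 0 (twoRow a b) fun v => m v : ℕ) : R) = _
  rw [schurCoeff_twoRow hab hN, filter_isBallot_vecs]
  simp only [not_lt_zero, false_imp_iff, implies_true, true_and]
  split_ifs <;> simp

section
open Polynomial

/-- The coefficient at `m` of the symmetric function side, as a sum over the sets whose type-B
descents are cuts of `m`. -/
theorem coeff_rhs {n N : ℕ} {m : ℕ →₀ ℕ} (hN : ∀ v, N + 1 ≤ v → m v = 0) :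
    MvPowerSeries.coeff m
      (∑ k ∈ Finset.Icc 1 n,
        (∑ j ∈ Finset.range (n + 1), (bCoeff n k j : Polynomial ℤ) * Polynomial.X ^ j) •
          (hSeries (Polynomial ℤ) 1 k * hSeries (Polynomial ℤ) 0 (n - k))
      + ∑ k ∈ Finset.range (n / 2 + 1),
        (∑ j ∈ Finset.range (n + 1), (aCoeff n k j : Polynomial ℤ) * Polynomial.X ^ j) •
          schurS (Polynomial ℤ) 0 (twoRow (n - k) k)) =
      if ∑ i ∈ Finset.range (N + 1), m i = n then
        ∑ S ∈ allowedSets m n, (hpoly S n + if S = ∅ then 0 else fpoly S n) else 0 := by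
  rw [map_add, map_sum, map_sum]
  have e1 : ∀ k ∈ Finset.Icc 1 n, MvPowerSeries.coeff m
      ((∑ j ∈ Finset.range (n + 1), (bCoeff n k j : Polynomial ℤ) * Polynomial.X ^ j) •
          (hSeries (Polynomial ℤ) 1 k * hSeries (Polynomial ℤ) 0 (n - k))) =
      if ∑ i ∈ Finset.range (N + 1), m i = n then
        ∑ ν ∈ (vecs (capZero m) (N + 1)).filter fun ν => ∑ i ∈ Finset.range (N + 1), ν i = k,
          pasc (n - ∑ i ∈ Finset.range (N + 1), ν i) (∑ i ∈ Finset.range (N + 1), ν i) else 0 := by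
    intro k hk
    have hk := Finset.mem_Icc.1 hk
    rw [MvPowerSeries.coeff_smul, coeff_hSeries_mul _ _ _ hN, sum_bCoeff n k hk.2,
      Nat.add_sub_cancel' hk.2]
    split_ifs with h
    · rw [Finset.sum_congr rfl (g := fun _ => pasc (n - k) k) fun ν hν => by
        rw [(Finset.mem_filter.1 hν).2], Finset.sum_const, nsmul_eq_mul, mul_comm]
    · rw [mul_zero]
  have e2 : ∀ k ∈ Finset.range (n / 2 + 1), MvPowerSeries.coeff m
      ((∑ j ∈ Finset.range (n + 1), (aCoeff n k j : Polynomial ℤ) * Polynomial.X ^ j) •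
          schurS (Polynomial ℤ) 0 (twoRow (n - k) k)) =
      if ∑ i ∈ Finset.range (N + 1), m i = n then
        ∑ ν ∈ ((vecs (capZero m) (N + 1)).filter fun ν => IsBallot m ν (N + 1)).filter
          fun ν => ∑ i ∈ Finset.range (N + 1), ν i = k,
          pascDiff n (∑ i ∈ Finset.range (N + 1), ν i) else 0 := by
    intro k hk
    have hk : 2 * k ≤ n := by have := Finset.mem_range.1 hk; omega
    rw [MvPowerSeries.coeff_smul, coeff_schurS_twoRow _ (by omega) hN, sum_aCoeff n k hk,
      Nat.sub_add_cancel (by omega)]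
    split_ifs with h
    · rw [Finset.sum_congr rfl (g := fun _ => pascDiff n k) fun ν hν => by
        rw [(Finset.mem_filter.1 hν).2], Finset.sum_const, nsmul_eq_mul, mul_comm]
    · rw [mul_zero]
  rw [Finset.sum_congr rfl e1, Finset.sum_congr rfl e2]
  split_ifs with h
  · rw [Finset.sum_add_distrib]
    subst h
    have hle : ∀ ν ∈ vecs (capZero m) (N + 1), ∑ i ∈ Finset.range (N + 1), ν i ≤
        ∑ i ∈ Finset.range (N + 1), m i := fun ν hν =>
      Finset.sum_le_sum fun i _ => le_of_mem_vecs_capZero hν i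
    have hempty : (∅ : Finset ℕ) ∈ allowedSets m (∑ i ∈ Finset.range (N + 1), m i) := by
      rw [mem_allowedSets]; simp
    have h0 : (0 : ℕ → ℕ) ∈ vecs (capZero m) (N + 1) := by
      rw [mem_vecs]; simp
    have a1 : ∑ S ∈ allowedSets m (∑ i ∈ Finset.range (N + 1), m i),
        (if S = ∅ then 0 else fpoly S (∑ i ∈ Finset.range (N + 1), m i)) +
        X ^ (∑ i ∈ Finset.range (N + 1), m i) =
        ∑ S ∈ allowedSets m (∑ i ∈ Finset.range (N + 1), m i),
          fpoly S (∑ i ∈ Finset.range (N + 1), m i) := by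
      rw [← Finset.add_sum_erase _ _ hempty, ← Finset.add_sum_erase _ (fun S => fpoly S _) hempty,
        if_pos rfl, zero_add, fpoly_empty, add_comm]
      congr 1
      exact Finset.sum_congr rfl fun S hS => if_neg (Finset.ne_of_mem_erase hS)
    have a2 : ∑ k ∈ Finset.Icc 1 (∑ i ∈ Finset.range (N + 1), m i),
        ∑ ν ∈ (vecs (capZero m) (N + 1)).filter fun ν => ∑ i ∈ Finset.range (N + 1), ν i = k,
          pasc (∑ i ∈ Finset.range (N + 1), m i - ∑ i ∈ Finset.range (N + 1), ν i)
            (∑ i ∈ Finset.range (N + 1), ν i) + X ^ (∑ i ∈ Finset.range (N + 1), m i) =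
        ∑ ν ∈ vecs (capZero m) (N + 1),
          pasc (∑ i ∈ Finset.range (N + 1), m i - ∑ i ∈ Finset.range (N + 1), ν i)
            (∑ i ∈ Finset.range (N + 1), ν i) := by
      rw [← Finset.add_sum_erase _ _ h0, add_comm]
      congr 1
      · simp [pasc_zero_right]
      · rw [← Finset.sum_fiberwise_of_maps_to (t := Finset.Icc 1 _)
          (g := fun ν : ℕ → ℕ => ∑ i ∈ Finset.range (N + 1), ν i)]
        · refine Finset.sum_congr rfl fun k hk => Finset.sum_congr ?_ fun _ _ => rfl
          ext ν
          simp only [Finset.mem_filter, Finset.mem_erase]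
          constructor
          · rintro ⟨h1, rfl⟩
            refine ⟨⟨?_, h1⟩, rfl⟩
            rintro rfl
            simp at hk
          · rintro ⟨⟨-, h1⟩, h2⟩
            exact ⟨h1, h2⟩
        · intro ν hν
          obtain ⟨h1, h2⟩ := Finset.mem_erase.1 hν
          rw [Finset.mem_Icc]
          refine ⟨Nat.one_le_iff_ne_zero.2 fun h3 => h1 ?_, hle ν h2⟩
          funext i
          rcases lt_or_ge i (N + 1) with hi | hi
          · exact Finset.sum_eq_zero_iff.1 h3 i (Finset.mem_range.2 hi)
          · exact (mem_vecs.1 h2).2 i hi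
    have a3 : ∑ k ∈ Finset.range ((∑ i ∈ Finset.range (N + 1), m i) / 2 + 1),
        ∑ ν ∈ ((vecs (capZero m) (N + 1)).filter fun ν => IsBallot m ν (N + 1)).filter
          fun ν => ∑ i ∈ Finset.range (N + 1), ν i = k,
          pascDiff (∑ i ∈ Finset.range (N + 1), m i) (∑ i ∈ Finset.range (N + 1), ν i) =
        ∑ ν ∈ (vecs (capZero m) (N + 1)).filter fun ν => IsBallot m ν (N + 1),
          pascDiff (∑ i ∈ Finset.range (N + 1), m i) (∑ i ∈ Finset.range (N + 1), ν i) := by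
      refine Finset.sum_fiberwise_of_maps_to (fun ν hν => ?_) _
      obtain ⟨h1, h2⟩ := Finset.mem_filter.1 hν
      have := h2.two_mul_le fun i _ => le_of_mem_vecs_capZero h1 i
      rw [Finset.mem_range]
      omega
    rw [a3, ← sum_fpoly_blockSet, ← sum_allowedSets m N fun S => fpoly S _, ← a1,
      sum_allowedSets m N fun S => hpoly S _, sum_hpoly_blockSet, ← a2]
    ring
  · simp

end

section
open Polynomial

/-- The height after `i` steps of the lattice path encoded by `S` and `V`. -/
def pathHeight (S V : Finset ℕ) : ℕ → ℤ
  | 0 => 0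
  | i + 1 => pathHeight S V i + (if i + 1 ∈ S then 0 else 1) - (if i + 1 ∈ V then 1 else 0)

/-- Steps in `S` may only be taken from positive height. -/
def IsCode (S V : Finset ℕ) (n : ℕ) : Prop := ∀ i < n, i + 1 ∈ S → 0 < pathHeight S V i

/-- Number of returns to height zero during the first `n` steps. -/
def touches (S V : Finset ℕ) (n : ℕ) : ℕ := ((Finset.Icc 1 n).filter fun i => pathHeight S V i = 0).card

lemma pathHeight_congr {S V V' : Finset ℕ} {n : ℕ} (h : ∀ i, i ≤ n → (i ∈ V ↔ i ∈ V')) :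
    pathHeight S V n = pathHeight S V' n := by
  induction n with
  | zero => rfl
  | succ n ih =>
    rw [pathHeight, pathHeight, ih fun i hi => h i (by omega)]
    simp only [h (n + 1) le_rfl]

lemma IsCode.nonneg {S V : Finset ℕ} {n : ℕ} (h : IsCode S V n) : 0 ≤ pathHeight S V n := by
  induction n with
  | zero => exact le_rfl
  | succ n ih =>
    have h1 := ih fun i hi => h i (by omega)
    have h2 := h n (by omega)
    rw [pathHeight]
    by_cases hS : n + 1 ∈ S
    · have := h2 hS
      rw [if_pos hS]; split_ifs <;> omega
    · rw [if_neg hS]; split_ifs <;> omega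

lemma isCode_succ {S V : Finset ℕ} {n : ℕ} :
    IsCode S V (n + 1) ↔ IsCode S V n ∧ (n + 1 ∈ S → 0 < pathHeight S V n) := by
  constructor
  · intro h; exact ⟨fun i hi => h i (by omega), h n (by omega)⟩
  · rintro ⟨h1, h2⟩ i hi
    rcases Nat.lt_succ_iff_lt_or_eq.1 hi with h | rfl
    · exact h1 i h
    · exact h2

lemma touches_succ (S V : Finset ℕ) (n : ℕ) :
    touches S V (n + 1) = touches S V n + if pathHeight S V (n + 1) = 0 then 1 else 0 := by
  rw [touches, touches, ← Finset.insert_Icc_right_eq_Icc_add_one (by omega), Finset.filter_insert]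
  split_ifs
  · rw [Finset.card_insert_of_notMem (by simp)]
  · rfl

/-- The weight of `V` as a path ending at height `h`. -/
def codeWeight (S : Finset ℕ) (n h : ℕ) (V : Finset ℕ) : ℤ[X] :=
  if IsCode S V n ∧ pathHeight S V n = h then X ^ touches S V n else 0

/-- Weighted enumeration of the paths of length `n` ending at height `h`. -/
def codeSum (S : Finset ℕ) (n h : ℕ) : ℤ[X] := ∑ V ∈ (Finset.Icc 1 n).powerset, codeWeight S n h V

/-- The factor recording a return to height zero. -/
def stepWeight (h : ℕ) : ℤ[X] := if h = 0 then X else 1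

/-- The transfer operator of a step outside `S`. -/
def upOp : Module.End ℤ (ℕ → ℤ[X]) where
  toFun Z h := stepWeight h * (Z h + if h = 0 then 0 else Z (h - 1))
  map_add' Z Z' := by funext h; simp only [Pi.add_apply]; split_ifs <;> ring
  map_smul' c Z := by
    funext h; simp only [Pi.smul_apply, RingHom.id_apply, zsmul_eq_mul]; split_ifs <;> ring

/-- The transfer operator of a step in `S`. -/
def downOp : Module.End ℤ (ℕ → ℤ[X]) where
  toFun Z h := stepWeight h * (Z (h + 1) + if h = 0 then 0 else Z h)
  map_add' Z Z' := by funext h; simp only [Pi.add_apply]; split_ifs <;> ring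
  map_smul' c Z := by
    funext h; simp only [Pi.smul_apply, RingHom.id_apply, zsmul_eq_mul]; split_ifs <;> ring

lemma downOp_mul_upOp : downOp * upOp = upOp + downOp := by
  ext1 Z
  funext h
  rcases h with _ | h
  · simp [downOp, upOp, stepWeight]; ring
  · simp [downOp, upOp, stepWeight]; ring

/-- The linear map sending `X ^ i` to the path enumeration after `i` up steps. -/
def pathMap : ℤ[X] →ₗ[ℤ] ℕ → ℤ[X] :=
  (LinearMap.applyₗ (Pi.single 0 1)).comp (aeval upOp).toLinearMap

lemma pathMap_X_mul (f : ℤ[X]) : pathMap (X * f) = upOp (pathMap f) := by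
  simp [pathMap]

lemma pathMap_one : pathMap 1 = Pi.single 0 1 := by simp [pathMap]

lemma pathMap_apply_zero (f : ℤ[X]) : pathMap f 0 = f := by
  induction f using Polynomial.induction_on' with
  | add p q hp hq => rw [map_add, Pi.add_apply, hp, hq]
  | monomial i a =>
    rw [← Polynomial.smul_X_eq_monomial, map_smul, Pi.smul_apply]
    congr 1
    induction i with
    | zero => rw [pow_zero, pathMap_one, Pi.single_eq_same]
    | succ i ih =>
      rw [pow_succ', pathMap_X_mul]
      simp [upOp, stepWeight, ih]

lemma pathMap_sumOp (f : ℤ[X]) : pathMap (sumOp f) = downOp (pathMap f) := by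
  induction f using Polynomial.induction_on' with
  | add p q hp hq => rw [map_add, map_add, map_add, map_add, hp, hq]
  | monomial i a =>
    rw [← Polynomial.smul_X_eq_monomial, map_smul, map_smul, map_smul, map_smul]
    congr 1
    induction i with
    | zero =>
      rw [pow_zero, sumOp_one, pathMap_one, map_zero]
      funext h
      rcases h with _ | h <;> simp [downOp]
    | succ i ih =>
      rw [pow_succ', sumOp_X_mul, map_add, ih, pathMap_X_mul, ← Module.End.mul_apply,
        downOp_mul_upOp, LinearMap.add_apply]

lemma codeWeight_succ {S V V' : Finset ℕ} {n h h' : ℕ} (ht : touches S V' n = touches S V n)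
    (hiff : IsCode S V' (n + 1) ∧ pathHeight S V' (n + 1) = h ↔
      IsCode S V n ∧ pathHeight S V n = h') :
    codeWeight S (n + 1) h V' = stepWeight h * codeWeight S n h' V := by
  rw [codeWeight, codeWeight]
  by_cases hc : IsCode S V' (n + 1) ∧ pathHeight S V' (n + 1) = h
  · rw [if_pos hc, if_pos (hiff.1 hc), touches_succ, ht, hc.2, stepWeight]
    by_cases h0 : h = 0
    · simp [h0, pow_succ']
    · simp [h0]
  · rw [if_neg hc, if_neg (hiff.not.1 hc), mul_zero]

lemma codeSum_succ (S : Finset ℕ) (n : ℕ) :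
    codeSum S (n + 1) = if n + 1 ∈ S then downOp (codeSum S n) else upOp (codeSum S n) := by
  have hV : ∀ V ∈ (Finset.Icc 1 n).powerset, n + 1 ∉ V ∧
      pathHeight S (insert (n + 1) V) n = pathHeight S V n ∧
      (IsCode S (insert (n + 1) V) n ↔ IsCode S V n) ∧
      touches S (insert (n + 1) V) n = touches S V n := by
    intro V hV
    have h0 : n + 1 ∉ V := fun h => by
      have := Finset.mem_Icc.1 (Finset.mem_powerset.1 hV h); omega
    have h1 : ∀ i ≤ n, pathHeight S (insert (n + 1) V) i = pathHeight S V i := fun i hi =>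
      pathHeight_congr fun j hj => by
        rw [Finset.mem_insert, or_iff_right (by omega)]
    refine ⟨h0, h1 n le_rfl, ?_, ?_⟩
    · exact forall₂_congr fun i hi => by rw [h1 i hi.le]
    · exact congrArg _ (Finset.filter_congr fun i hi => by rw [h1 i (Finset.mem_Icc.1 hi).2])
  funext h
  rw [codeSum, ← Finset.insert_Icc_right_eq_Icc_add_one (by omega),
    Finset.sum_powerset_insert (by simp)]
  split_ifs with hS
  · simp only [downOp, LinearMap.coe_mk, AddHom.coe_mk, mul_add, codeSum, Finset.mul_sum]
    rw [add_comm]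
    congr 1
    · refine Finset.sum_congr rfl fun V h1 => ?_
      obtain ⟨h1, h2, h3, h4⟩ := hV V h1
      refine codeWeight_succ h4 ?_
      rw [isCode_succ, pathHeight, h2, h3, if_pos hS, if_pos (Finset.mem_insert_self _ _)]
      push_cast
      constructor
      · rintro ⟨⟨h1, -⟩, h2⟩; exact ⟨h1, by omega⟩
      · rintro ⟨h1, h2⟩; exact ⟨⟨h1, fun _ => by omega⟩, by omega⟩
    · split_ifs with h0
      · rw [mul_zero]
        refine Finset.sum_eq_zero fun V h1 => if_neg ?_
        obtain ⟨h1, -⟩ := hV V h1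
        rw [isCode_succ, pathHeight, if_pos hS, if_neg h1]
        rintro ⟨⟨-, h2⟩, h3⟩
        have := h2 hS
        omega
      · rw [Finset.mul_sum]
        refine Finset.sum_congr rfl fun V h1 => ?_
        obtain ⟨h1, -⟩ := hV V h1
        refine codeWeight_succ rfl ?_
        rw [isCode_succ, pathHeight, if_pos hS, if_neg h1]
        constructor
        · rintro ⟨⟨h1, -⟩, h2⟩; exact ⟨h1, by omega⟩
        · rintro ⟨h1, h2⟩; exact ⟨⟨h1, fun _ => by omega⟩, by omega⟩
  · simp only [upOp, LinearMap.coe_mk, AddHom.coe_mk, mul_add, codeSum, Finset.mul_sum]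
    rw [add_comm]
    congr 1
    · refine Finset.sum_congr rfl fun V h1 => ?_
      obtain ⟨h1, h2, h3, h4⟩ := hV V h1
      refine codeWeight_succ h4 ?_
      rw [isCode_succ, pathHeight, h2, h3, if_neg hS, if_pos (Finset.mem_insert_self _ _)]
      constructor
      · rintro ⟨⟨h1, -⟩, h2⟩; exact ⟨h1, by omega⟩
      · rintro ⟨h1, h2⟩; exact ⟨⟨h1, fun h => absurd h hS⟩, by omega⟩
    · split_ifs with h0
      · rw [mul_zero]
        refine Finset.sum_eq_zero fun V h1 => if_neg ?_
        obtain ⟨h1, -⟩ := hV V h1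
        rw [isCode_succ, pathHeight, if_neg hS, if_neg h1]
        rintro ⟨⟨h2, -⟩, h3⟩
        have := h2.nonneg
        omega
      · rw [Finset.mul_sum]
        refine Finset.sum_congr rfl fun V h1 => ?_
        obtain ⟨h1, -⟩ := hV V h1
        refine codeWeight_succ rfl ?_
        rw [isCode_succ, pathHeight, if_neg hS, if_neg h1]
        constructor
        · rintro ⟨⟨h1, -⟩, h2⟩; exact ⟨h1, by omega⟩
        · rintro ⟨h1, h2⟩; exact ⟨⟨h1, fun h => absurd h hS⟩, by omega⟩

theorem codeSum_eq (S : Finset ℕ) (n : ℕ) : codeSum S n = pathMap (fpoly S n) := by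
  induction n with
  | zero =>
    rw [fpoly, pathMap_one]
    funext h
    simp only [codeSum, codeWeight, IsCode, touches, pathHeight]
    rcases h with _ | h
    · simp
    · simp; omega
  | succ n ih =>
    rw [codeSum_succ, fpoly, ih]
    split_ifs
    · rw [pathMap_sumOp]
    · rw [pathMap_X_mul]

theorem codeSum_zero_right (S : Finset ℕ) (n : ℕ) : codeSum S n 0 = fpoly S n := by
  rw [codeSum_eq, pathMap_apply_zero]

end

/-- One-line notation of a permutation of `{1, …, n}`, extended by `0`. -/
def IsWindow (n : ℕ) (g : ℕ → ℕ) : Prop :=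
  (∀ i ∈ Finset.Icc 1 n, g i ∈ Finset.Icc 1 n) ∧ Set.InjOn g (Finset.Icc 1 n) ∧
    ∀ i ∉ Finset.Icc 1 n, g i = 0

/-- All windows of permutations of `{1, …, n}`. -/
def windows (n : ℕ) : Finset (ℕ → ℕ) := (vecs (fun _ => n) (n + 1)).filter (IsWindow n)

lemma mem_windows {n : ℕ} {g : ℕ → ℕ} : g ∈ windows n ↔ IsWindow n g := by
  rw [windows, Finset.mem_filter, mem_vecs, and_iff_right_iff_imp]
  rintro ⟨h1, -, h3⟩
  refine ⟨fun i _ => ?_, fun i hi => h3 i fun h => ?_⟩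
  · by_cases h : i ∈ Finset.Icc 1 n
    · exact (Finset.mem_Icc.1 (h1 i h)).2
    · rw [h3 i h]; exact Nat.zero_le _
  · have := Finset.mem_Icc.1 h; omega

/-- The window contains no decreasing subsequence of length three. -/
def NoDec (n : ℕ) (g : ℕ → ℕ) : Prop :=
  ¬ ∃ i j k : ℕ, 1 ≤ i ∧ i < j ∧ j < k ∧ k ≤ n ∧ g k < g j ∧ g j < g i

/-- The positions whose entry is smaller than the position. -/
def deficients (n : ℕ) (g : ℕ → ℕ) : Finset ℕ := (Finset.Icc 1 n).filter fun i => g i < i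

/-- The number of blocks of a window. -/
def blocks (n : ℕ) (g : ℕ → ℕ) : ℕ :=
  ((Finset.Icc 1 n).filter fun i => ∀ j ∈ Finset.Icc 1 i, g j ≤ i).card

lemma card_filter_le_image {A : Finset ℕ} {f : ℕ → ℕ} (hf : StrictMonoOn f A) {x : ℕ}
    (hx : x ∈ A) : ((A.image f).filter (· ≤ f x)).card = (A.filter (· ≤ x)).card := by
  have : (A.image f).filter (· ≤ f x) = (A.filter (· ≤ x)).image f := by
    ext y
    simp only [Finset.mem_filter, Finset.mem_image]
    constructor
    · rintro ⟨⟨z, hz, rfl⟩, h⟩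
      exact ⟨z, ⟨hz, (hf.le_iff_le hz hx).1 h⟩, rfl⟩
    · rintro ⟨z, ⟨hz, h⟩, rfl⟩
      exact ⟨⟨z, hz, rfl⟩, (hf.le_iff_le hz hx).2 h⟩
  rw [this, Finset.card_image_of_injOn]
  exact hf.injOn.mono fun y hy => (Finset.mem_filter.1 (Finset.mem_coe.1 hy)).1

lemma card_filter_lt_of_mem {B : Finset ℕ} {x y : ℕ} (hxy : x < y) (hy : y ∈ B) :
    (B.filter (· ≤ x)).card < (B.filter (· ≤ y)).card := by
  refine Finset.card_lt_card ⟨fun z hz => ?_, fun h => ?_⟩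
  · rw [Finset.mem_filter] at hz ⊢; exact ⟨hz.1, by omega⟩
  · have := h (Finset.mem_filter.2 ⟨hy, le_rfl⟩)
    rw [Finset.mem_filter] at this
    omega

lemma eqOn_of_strictMonoOn {A : Finset ℕ} {f g : ℕ → ℕ} (hf : StrictMonoOn f A)
    (hg : StrictMonoOn g A) (h : A.image f = A.image g) {x : ℕ} (hx : x ∈ A) : f x = g x := by
  have h1 := card_filter_le_image hf hx
  have h2 := card_filter_le_image hg hx
  have hfx := Finset.mem_image_of_mem f hx
  have hgx := Finset.mem_image_of_mem g hx
  rw [h] at h1 hfx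
  rcases lt_trichotomy (f x) (g x) with hlt | heq | hlt
  · have := card_filter_lt_of_mem hlt hgx; omega
  · exact heq
  · have := card_filter_lt_of_mem hlt hfx; omega

lemma exists_strictMonoOn {A B : Finset ℕ} (h : A.card = B.card) :
    ∃ f : ℕ → ℕ, StrictMonoOn f A ∧ A.image f = B := by
  let e := (A.orderIsoOfFin h).symm.trans (B.orderIsoOfFin rfl)
  refine ⟨fun x => if hx : x ∈ A then (e ⟨x, hx⟩ : ℕ) else 0, ?_, ?_⟩
  · intro x hx y hy hxy
    have hx' : x ∈ A := hx
    have hy' : y ∈ A := hy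
    simp only [hx', hy', dif_pos]
    exact e.strictMono (show (⟨x, hx'⟩ : A) < ⟨y, hy'⟩ from hxy)
  · ext y
    rw [Finset.mem_image]
    constructor
    · rintro ⟨x, hx, rfl⟩
      simp only [hx, dif_pos]
      exact (e ⟨x, hx⟩).2
    · intro hy
      refine ⟨e.symm ⟨y, hy⟩, (e.symm ⟨y, hy⟩).2, ?_⟩
      simp

lemma pathHeight_eq {n : ℕ} {S V : Finset ℕ} (hV : V ⊆ Finset.Icc 1 n) {i : ℕ} (hi : i ≤ n) :
    pathHeight S V i =
      (((Finset.Icc 1 n \ S).filter (· ≤ i)).card : ℤ) - ((V.filter (· ≤ i)).card : ℤ) := by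
  induction i with
  | zero =>
    rw [Finset.filter_eq_empty_iff.2, Finset.filter_eq_empty_iff.2]
    · rfl
    · intro x hx; have := Finset.mem_Icc.1 (hV hx); omega
    · intro x hx; have := Finset.mem_Icc.1 (Finset.mem_sdiff.1 hx).1; omega
  | succ i ih =>
    have step : ∀ A : Finset ℕ, ((A.filter (· ≤ i + 1)).card : ℤ) =
        (A.filter (· ≤ i)).card + if i + 1 ∈ A then 1 else 0 := by
      intro A
      split_ifs with h
      · have : A.filter (· ≤ i + 1) = insert (i + 1) (A.filter (· ≤ i)) := by
          ext x
          simp only [Finset.mem_filter, Finset.mem_insert]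
          constructor
          · rintro ⟨h1, h2⟩
            rcases Nat.le_succ_iff.1 h2 with h3 | h3
            · exact Or.inr ⟨h1, h3⟩
            · exact Or.inl h3
          · rintro (rfl | ⟨h1, h2⟩)
            · exact ⟨h, le_rfl⟩
            · exact ⟨h1, by omega⟩
        rw [this, Finset.card_insert_of_notMem (by simp)]
        push_cast; rfl
      · rw [add_zero]
        congr 2
        refine Finset.filter_congr fun x hx => ?_
        have : x ≠ i + 1 := fun h' => h (h' ▸ hx)
        omega
    rw [pathHeight, ih (by omega), step, step]
    have : i + 1 ∈ Finset.Icc 1 n \ S ↔ ¬ i + 1 ∈ S := by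
      rw [Finset.mem_sdiff, Finset.mem_Icc]; constructor
      · exact fun h => h.2
      · exact fun h => ⟨by omega, h⟩
    simp only [this]
    split_ifs <;> omega

lemma IsWindow.image_eq {n : ℕ} {g : ℕ → ℕ} (hg : IsWindow n g) :
    (Finset.Icc 1 n).image g = Finset.Icc 1 n := by
  refine Finset.eq_of_subset_of_card_le (Finset.image_subset_iff.2 hg.1) ?_
  rw [Finset.card_image_of_injOn hg.2.1]

lemma IsWindow.exists_le_of_lt {n i : ℕ} {g : ℕ → ℕ} (hg : IsWindow n g) (hi : i < n)
    (h : g (i + 1) < i + 1) : ∃ j ∈ Finset.Icc 1 i, i < g j := by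
  by_contra! hc
  have hsub : ∀ j ∈ Finset.Icc 1 i, j ∈ Finset.Icc 1 n := fun j hj => by
    rw [Finset.mem_Icc] at hj ⊢; omega
  have h1 : (Finset.Icc 1 i).image g = Finset.Icc 1 i := by
    refine Finset.eq_of_subset_of_card_le (Finset.image_subset_iff.2 fun j hj => ?_) ?_
    · rw [Finset.mem_Icc]
      exact ⟨(Finset.mem_Icc.1 (hg.1 j (hsub j hj))).1, hc j hj⟩
    · rw [Finset.card_image_of_injOn (hg.2.1.mono fun j hj => hsub j hj)]
  have hi1 : i + 1 ∈ Finset.Icc 1 n := Finset.mem_Icc.2 ⟨by omega, hi⟩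
  have h2 : g (i + 1) ∈ Finset.Icc 1 i := by
    have := Finset.mem_Icc.1 (hg.1 _ hi1)
    rw [Finset.mem_Icc]; omega
  rw [← h1, Finset.mem_image] at h2
  obtain ⟨j, hj, hj'⟩ := h2
  have := hg.2.1 (hsub j hj) hi1 hj'
  have := Finset.mem_Icc.1 hj
  omega

lemma pathHeight_deficients {n : ℕ} {g : ℕ → ℕ} (hg : IsWindow n g) {i : ℕ} (hi : i ≤ n) :
    pathHeight (deficients n g) ((Finset.Icc 1 n \ deficients n g).image g) i =
      ((Finset.Icc 1 i).filter fun j => i < g j).card := by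
  have hmem : ∀ j, j ∈ Finset.Icc 1 n \ deficients n g ↔ j ∈ Finset.Icc 1 n ∧ j ≤ g j := by
    intro j
    rw [Finset.mem_sdiff, deficients, Finset.mem_filter]
    constructor
    · rintro ⟨h1, h2⟩; exact ⟨h1, not_lt.1 fun h => h2 ⟨h1, h⟩⟩
    · rintro ⟨h1, h2⟩; exact ⟨h1, fun h => by omega⟩
  rw [pathHeight_eq (Finset.image_subset_iff.2 fun j hj => hg.1 j ((hmem j).1 hj).1) hi]
  have h1 : (((Finset.Icc 1 n \ deficients n g).image g).filter (· ≤ i)).card =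
      (((Finset.Icc 1 n \ deficients n g).filter (· ≤ i)).filter fun j => ¬ i < g j).card := by
    rw [Finset.filter_image, Finset.card_image_of_injOn]
    · congr 1
      ext j
      simp only [Finset.mem_filter, hmem, not_lt]
      constructor
      · rintro ⟨⟨h1, h2⟩, h3⟩; exact ⟨⟨⟨h1, h2⟩, h2.trans h3⟩, h3⟩
      · rintro ⟨⟨h1, -⟩, h3⟩; exact ⟨h1, h3⟩
    · refine hg.2.1.mono fun j hj => ?_
      simp only [Finset.coe_filter, Set.mem_ofPred_eq, hmem] at hj
      exact hj.1.1
  have h2 : ((Finset.Icc 1 i).filter fun j => i < g j) =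
      ((Finset.Icc 1 n \ deficients n g).filter (· ≤ i)).filter fun j => i < g j := by
    ext j
    simp only [Finset.mem_filter, hmem, Finset.mem_Icc]
    omega
  rw [h1, h2, ← Finset.card_filter_add_card_filter_not
    (s := (Finset.Icc 1 n \ deficients n g).filter (· ≤ i))
    (fun j => i < g j)]
  push_cast
  ring

lemma NoDec.strictMonoOn {n : ℕ} {g : ℕ → ℕ} (hg : IsWindow n g) (hn : NoDec n g) :
    StrictMonoOn g (deficients n g : Finset ℕ) ∧
      StrictMonoOn g (Finset.Icc 1 n \ deficients n g : Finset ℕ) := by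
  have hne : ∀ i j, i ∈ Finset.Icc 1 n → j ∈ Finset.Icc 1 n → i < j → g i ≠ g j :=
    fun i j hi hj hij h => by have := hg.2.1 hi hj h; omega
  constructor
  · intro i hi j hj hij
    obtain ⟨hi, hi'⟩ := Finset.mem_filter.1 (Finset.mem_coe.1 hi)
    obtain ⟨hj, hj'⟩ := Finset.mem_filter.1 (Finset.mem_coe.1 hj)
    by_contra hlt
    have hlt : g j < g i := lt_of_le_of_ne (not_lt.1 hlt) (hne i j hi hj hij).symm
    have hi := Finset.mem_Icc.1 hi
    have hj := Finset.mem_Icc.1 hj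
    obtain ⟨k, hk, hk'⟩ := hg.exists_le_of_lt (i := i - 1) (by omega)
      (by rw [Nat.sub_add_cancel hi.1]; exact hi')
    have hk := Finset.mem_Icc.1 hk
    have := hne k i (Finset.mem_Icc.2 (by omega)) (Finset.mem_Icc.2 hi) (by omega)
    exact hn ⟨k, i, j, hk.1, by omega, hij, hj.2, hlt, by omega⟩
  · intro i hi j hj hij
    rw [Finset.mem_coe, Finset.mem_sdiff, deficients, Finset.mem_filter] at hi hj
    by_contra hlt
    have hlt : g j < g i := lt_of_le_of_ne (not_lt.1 hlt) (hne i j hi.1 hj.1 hij).symm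
    have hij' : j ≤ g j := not_lt.1 fun h => hj.2 ⟨hj.1, h⟩
    have hi1 := Finset.mem_Icc.1 hi.1
    have hj1 := Finset.mem_Icc.1 hj.1
    have hsub : Finset.Ico 1 (g j) ⊆ (((Finset.Icc 1 j).erase i).erase j).image g := by
      intro v hv
      have hv := Finset.mem_Ico.1 hv
      have hvn : v ∈ (Finset.Icc 1 n).image g := by
        rw [hg.image_eq, Finset.mem_Icc]
        have := Finset.mem_Icc.1 (hg.1 j hj.1)
        omega
      obtain ⟨k, hk, rfl⟩ := Finset.mem_image.1 hvn
      refine Finset.mem_image_of_mem g ?_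
      have hk1 := Finset.mem_Icc.1 hk
      rw [Finset.mem_erase, Finset.mem_erase, Finset.mem_Icc]
      refine ⟨by rintro rfl; omega, by rintro rfl; omega, hk1.1, ?_⟩
      by_contra hkj
      exact hn ⟨i, j, k, hi1.1, hij, by omega, hk1.2, by omega, hlt⟩
    have h1 := (Finset.card_le_card hsub).trans Finset.card_image_le
    rw [Finset.card_erase_of_mem (by rw [Finset.mem_erase, Finset.mem_Icc]; omega),
      Finset.card_erase_of_mem (by rw [Finset.mem_Icc]; omega), Nat.card_Ico, Nat.card_Icc] at h1
    omega

lemma card_filter_sdiff_add {n m : ℕ} {A : Finset ℕ} (hA : A ⊆ Finset.Icc 1 n) (hm : m ≤ n) :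
    ((Finset.Icc 1 n \ A).filter (· ≤ m)).card + (A.filter (· ≤ m)).card = m := by
  rw [← Finset.card_union_of_disjoint, ← Finset.filter_union, Finset.sdiff_union_of_subset hA]
  · have : (Finset.Icc 1 n).filter (· ≤ m) = Finset.Icc 1 m := by
      ext x; simp only [Finset.mem_filter, Finset.mem_Icc]; omega
    rw [this, Nat.card_Icc, Nat.add_sub_cancel]
  · exact Finset.disjoint_filter_filter Finset.sdiff_disjoint

lemma card_filter_le_le_succ (A : Finset ℕ) {i : ℕ} (hi : 1 ≤ i) :
    (A.filter (· ≤ i)).card ≤ (A.filter (· ≤ i - 1)).card + 1 := by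
  refine (Finset.card_le_card (t := insert i (A.filter (· ≤ i - 1))) fun x hx => ?_).trans
    (Finset.card_insert_le _ _)
  rw [Finset.mem_filter] at hx
  rw [Finset.mem_insert, Finset.mem_filter]
  by_cases h : x = i
  · exact Or.inl h
  · exact Or.inr ⟨hx.1, by omega⟩

lemma noDec_of_strictMonoOn {n : ℕ} {S : Finset ℕ} {g : ℕ → ℕ} (h1 : StrictMonoOn g S)
    (h2 : StrictMonoOn g (Finset.Icc 1 n \ S : Finset ℕ)) : NoDec n g := by
  rintro ⟨i, j, k, hi, hij, hjk, hk, hkj, hji⟩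
  have key : ∀ a b, 1 ≤ a → a < b → b ≤ n → g b < g a → ¬ (a ∈ S ↔ b ∈ S) := by
    intro a b ha hab hb hlt h
    by_cases hS : a ∈ S
    · have := h1 hS (h.1 hS) hab; omega
    · have := h2 (Finset.mem_coe.2 (Finset.mem_sdiff.2 ⟨Finset.mem_Icc.2 (by omega), hS⟩))
        (Finset.mem_coe.2 (Finset.mem_sdiff.2 ⟨Finset.mem_Icc.2 (by omega), h.not.1 hS⟩)) hab
      omega
  have a1 := key i j hi hij (by omega) hji
  have a2 := key j k (by omega) hjk hk hkj
  have a3 := key i k hi (by omega) hk (by omega)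
  tauto

lemma exists_window_of_isCode {n : ℕ} {S V : Finset ℕ} (hS : S ⊆ Finset.Icc 1 n)
    (hV : V ⊆ Finset.Icc 1 n) (hc : IsCode S V n) (h0 : pathHeight S V n = 0) :
    ∃ g, IsWindow n g ∧ NoDec n g ∧ deficients n g = S ∧ (Finset.Icc 1 n \ S).image g = V := by
  set T := Finset.Icc 1 n \ S with hT
  have hle : ∀ A ⊆ Finset.Icc 1 n, A.filter (· ≤ n) = A := fun A hA =>
    Finset.filter_true_of_mem fun x hx => (Finset.mem_Icc.1 (hA hx)).2
  have hcard : T.card = V.card := by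
    rw [pathHeight_eq hV le_rfl, ← hT, hle T Finset.sdiff_subset, hle V hV] at h0
    omega
  have hcard' : S.card = (Finset.Icc 1 n \ V).card := by
    have e1 := Finset.card_sdiff_add_card_eq_card hS
    have e2 := Finset.card_sdiff_add_card_eq_card hV
    rw [← hT] at e1
    omega
  obtain ⟨f1, hf1, hf1V⟩ := exists_strictMonoOn hcard
  obtain ⟨f2, hf2, hf2V⟩ := exists_strictMonoOn hcard'
  set g : ℕ → ℕ := fun i => if i ∈ S then f2 i else if i ∈ T then f1 i else 0 with hg
  have gS : ∀ i ∈ S, g i = f2 i := fun i hi => if_pos hi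
  have gT : ∀ i ∈ T, g i = f1 i := fun i hi => by
    rw [hg]; exact (if_neg (Finset.mem_sdiff.1 hi).2).trans (if_pos hi)
  have hST : ∀ i ∈ Finset.Icc 1 n, i ∈ S ∨ i ∈ T := fun i hi =>
    or_iff_not_imp_left.2 fun h => Finset.mem_sdiff.2 ⟨hi, h⟩
  have imS : ∀ i ∈ S, g i ∈ Finset.Icc 1 n \ V := fun i hi => by
    rw [gS i hi, ← hf2V]; exact Finset.mem_image_of_mem _ hi
  have imT : ∀ i ∈ T, g i ∈ V := fun i hi => by
    rw [gT i hi, ← hf1V]; exact Finset.mem_image_of_mem _ hi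
  have hgS : StrictMonoOn g S := fun i hi j hj hij => by
    rw [gS i hi, gS j hj]; exact hf2 hi hj hij
  have hgT : StrictMonoOn g T := fun i hi j hj hij => by
    rw [gT i hi, gT j hj]; exact hf1 hi hj hij
  have geT : ∀ i ∈ T, i ≤ g i := by
    intro i hi
    have hi1 := Finset.mem_Icc.1 (Finset.mem_sdiff.1 hi).1
    by_contra hlt
    have a1 : (0 : ℤ) ≤ pathHeight S V (i - 1) := IsCode.nonneg fun j hj => hc j (by omega)
    rw [pathHeight_eq hV (by omega), ← hT] at a1
    have a2 := card_filter_le_image hf1 hi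
    rw [hf1V, ← gT i hi] at a2
    have a3 := card_filter_lt_of_mem (x := i - 1) (by omega) hi
    have a4 : (V.filter (· ≤ g i)).card ≤ (V.filter (· ≤ i - 1)).card :=
      Finset.card_le_card fun x hx => by
        rw [Finset.mem_filter] at hx ⊢; exact ⟨hx.1, by omega⟩
    omega
  have ltS : ∀ i ∈ S, g i < i := by
    intro i hi
    have hi1 := Finset.mem_Icc.1 (hS hi)
    by_contra hlt
    have a1 := hc (i - 1) (by omega) (by rwa [Nat.sub_add_cancel hi1.1])
    rw [pathHeight_eq hV (by omega), ← hT] at a1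
    have a2 := card_filter_le_image hf2 hi
    rw [hf2V, ← gS i hi] at a2
    have a3 := card_filter_lt_of_mem (x := i - 1) (by omega) (imS i hi)
    have a4 := card_filter_le_le_succ S hi1.1
    have a5 := card_filter_sdiff_add hS (m := i - 1) (by omega)
    have a6 := card_filter_sdiff_add hV (m := i - 1) (by omega)
    rw [← hT] at a5
    omega
  refine ⟨g, ⟨?_, ?_, ?_⟩, noDec_of_strictMonoOn hgS hgT, ?_, ?_⟩
  · intro i hi
    rcases hST i hi with h | h
    · exact (Finset.mem_sdiff.1 (imS i h)).1
    · exact hV (imT i h)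
  · intro i hi j hj hij
    rcases hST i hi with h | h <;> rcases hST j hj with h' | h'
    · exact hgS.injOn h h' hij
    · exact absurd (hij ▸ imT j h') (Finset.mem_sdiff.1 (imS i h)).2
    · exact absurd (hij ▸ imT i h) (Finset.mem_sdiff.1 (imS j h')).2
    · exact hgT.injOn h h' hij
  · intro i hi
    rw [hg]
    exact (if_neg fun h => hi (hS h)).trans (if_neg fun h => hi (Finset.mem_sdiff.1 h).1)
  · ext i
    rw [deficients, Finset.mem_filter]
    constructor
    · rintro ⟨h1, h2⟩
      refine (hST i h1).resolve_right fun h => ?_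
      have := geT i h
      omega
    · exact fun h => ⟨hS h, ltS i h⟩
  · rw [← hf1V]
    exact Finset.image_congr fun i hi => gT i hi

section
open Polynomial

theorem sum_windows_deficients {n : ℕ} {S : Finset ℕ} (hS : S ⊆ Finset.Icc 1 n) :
    ∑ g ∈ (windows n).filter fun g => NoDec n g ∧ deficients n g = S, (X : ℤ[X]) ^ blocks n g =
      fpoly S n := by
  rw [← codeSum_zero_right, codeSum]
  simp only [codeWeight]
  rw [← Finset.sum_filter]
  refine Finset.sum_bij (fun g _ => (Finset.Icc 1 n \ S).image g) ?_ ?_ ?_ ?_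
  · intro g hg
    obtain ⟨hgw, hn, rfl⟩ := Finset.mem_filter.1 hg
    replace hg := mem_windows.1 hgw
    rw [Finset.mem_filter, Finset.mem_powerset]
    refine ⟨Finset.image_subset_iff.2 fun j hj => hg.1 j (Finset.mem_sdiff.1 hj).1, ?_, ?_⟩
    · intro i hi hd
      rw [pathHeight_deficients hg hi.le]
      obtain ⟨j, hj, hj'⟩ := hg.exists_le_of_lt hi (Finset.mem_filter.1 hd).2
      exact_mod_cast Finset.card_pos.2 ⟨j, Finset.mem_filter.2 ⟨hj, hj'⟩⟩
    · rw [pathHeight_deficients hg le_rfl, Finset.filter_eq_empty_iff.2]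
      · rfl
      · intro j hj
        have := Finset.mem_Icc.1 (hg.1 j hj)
        omega
  · intro f hf g hg h
    obtain ⟨hf, hfn, hfS⟩ := Finset.mem_filter.1 hf
    obtain ⟨hg, hgn, hgS⟩ := Finset.mem_filter.1 hg
    rw [mem_windows] at hf hg
    obtain ⟨hf1, hf2⟩ := hfn.strictMonoOn hf
    obtain ⟨hg1, hg2⟩ := hgn.strictMonoOn hg
    rw [hfS] at hf1 hf2
    rw [hgS] at hg1 hg2
    have hcomp : ∀ k : ℕ → ℕ, IsWindow n k → S.image k =
        Finset.Icc 1 n \ (Finset.Icc 1 n \ S).image k := by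
      intro k hk
      nth_rewrite 1 [← hk.image_eq]
      rw [← Finset.image_sdiff_of_injOn hk.2.1 Finset.sdiff_subset, Finset.sdiff_sdiff_eq_self hS]
    funext i
    by_cases hi : i ∈ Finset.Icc 1 n
    · by_cases hiS : i ∈ S
      · refine eqOn_of_strictMonoOn hf1 hg1 ?_ hiS
        rw [hcomp f hf, hcomp g hg]
        exact congrArg _ h
      · exact eqOn_of_strictMonoOn hf2 hg2 h (Finset.mem_sdiff.2 ⟨hi, hiS⟩)
    · rw [hf.2.2 i hi, hg.2.2 i hi]
  · intro V hV
    obtain ⟨hV, hc, h0⟩ := Finset.mem_filter.1 hV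
    obtain ⟨g, hg, hn, hd, himg⟩ :=
      exists_window_of_isCode hS (Finset.mem_powerset.1 hV) hc (by simpa using h0)
    exact ⟨g, Finset.mem_filter.2 ⟨mem_windows.2 hg, hn, hd⟩, himg⟩
  · intro g hg
    obtain ⟨hgw, hn, rfl⟩ := Finset.mem_filter.1 hg
    replace hg := mem_windows.1 hgw
    rw [blocks, touches]
    congr 2
    ext i
    simp only [Finset.mem_filter]
    refine and_congr_right fun hi => ?_
    rw [pathHeight_deficients hg (Finset.mem_Icc.1 hi).2, Int.natCast_eq_zero,
      Finset.card_eq_zero, Finset.filter_eq_empty_iff]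
    simp only [not_lt]
end

section
open Polynomial

lemma sum_fpoly_eq {ι : Type*} {E : Finset ι} {T : ι → Finset ℕ} {S : Finset ℕ} {s n : ℕ}
    (hsn : s ≤ n) (h : ∀ e ∈ E, ∀ i, s < i → (i ∈ T e ↔ i ∈ S))
    (h0 : ∑ e ∈ E, fpoly (T e) s = fpoly S s) : ∑ e ∈ E, fpoly (T e) n = fpoly S n := by
  induction n, hsn using Nat.le_induction with
  | base => exact h0
  | succ n hn ih =>
    have h1 : ∀ e ∈ E, fpoly (T e) (n + 1) =
        if n + 1 ∈ S then sumOp (fpoly (T e) n) else X * fpoly (T e) n := fun e he => by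
      rw [fpoly]; simp only [h e he (n + 1) (by omega)]
    rw [Finset.sum_congr rfl h1, fpoly, ← ih]
    split_ifs
    · rw [map_sum]
    · rw [Finset.mul_sum]

/-- The deficient positions `2, …, e + 1`, followed by the elements of `S` above `s`. -/
def shiftSet (S : Finset ℕ) (s e : ℕ) : Finset ℕ := Finset.Icc 2 (e + 1) ∪ S.filter (s < ·)

lemma mem_shiftSet_of_le {S : Finset ℕ} {s e i : ℕ} (hi : i ≤ s) :
    i ∈ shiftSet S s e ↔ 2 ≤ i ∧ i ≤ e + 1 := by
  rw [shiftSet, Finset.mem_union, Finset.mem_Icc, Finset.mem_filter]; omega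

lemma mem_shiftSet_of_lt {S : Finset ℕ} {s e i : ℕ} (he : e < s) (hi : s < i) :
    i ∈ shiftSet S s e ↔ i ∈ S := by
  rw [shiftSet, Finset.mem_union, Finset.mem_Icc, Finset.mem_filter]
  constructor
  · rintro (h | h)
    · omega
    · exact h.1
  · exact fun h => Or.inr ⟨h, hi⟩

lemma fpoly_shiftSet {S : Finset ℕ} {s e : ℕ} (he : e < s) :
    fpoly (shiftSet S s e) s = X ^ (s - e) := by
  have h1 : fpoly (shiftSet S s e) 1 = X := by
    rw [fpoly, if_neg, fpoly, mul_one]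
    rw [mem_shiftSet_of_le (by omega)]; omega
  have h2 : fpoly (shiftSet S s e) (1 + e) = X := by
    rw [fpoly_add_of_mem, h1]
    · exact Function.iterate_fixed sumOp_X e
    · intro i hi hi'
      rw [mem_shiftSet_of_le (by omega)]; omega
  obtain ⟨a, rfl⟩ : ∃ a, s = 1 + e + a := ⟨s - (1 + e), by omega⟩
  rw [fpoly_add_of_notMem, h2, ← pow_succ]
  · congr 1; omega
  · intro i hi hi'
    rw [mem_shiftSet_of_le hi']; omega

lemma sum_fpoly_shiftSet {S : Finset ℕ} {s n : ℕ} (hs : s ∈ S) (h1 : 1 ≤ s) (hsn : s ≤ n)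
    (hmin : ∀ i ∈ S, s ≤ i) : ∑ e ∈ Finset.range s, fpoly (shiftSet S s e) n =
      fpoly (S.filter (s < ·)) n + fpoly S n := by
  obtain ⟨r, rfl⟩ : ∃ r, s = r + 1 := ⟨s - 1, by omega⟩
  rw [Finset.sum_range_succ', add_comm]
  congr 1
  · rw [shiftSet, Finset.Icc_eq_empty (by omega), Finset.empty_union]
  · refine sum_fpoly_eq hsn (fun e he i hi => mem_shiftSet_of_lt ?_ hi) ?_
    · have := Finset.mem_range.1 he; omega
    · have h2 : fpoly S r = X ^ r := by
        have := fpoly_add_of_notMem (S := S) 0 r fun i _ hi h => by have := hmin i h; omega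
        rw [zero_add] at this
        rw [this, fpoly, mul_one]
      rw [fpoly, if_pos hs, h2, sumOp_X_pow, ← Finset.sum_range_reflect (fun i => (X : ℤ[X]) ^ (i + 1))]
      refine Finset.sum_congr rfl fun e he => ?_
      have := Finset.mem_range.1 he
      rw [fpoly_shiftSet (by omega)]
      congr 1; omega

end

lemma not_mem_deficients {n i : ℕ} {g : ℕ → ℕ} (hi : i ∈ Finset.Icc 1 n) :
    i ∉ deficients n g ↔ i ≤ g i := by
  rw [deficients, Finset.mem_filter]
  exact ⟨fun h => not_lt.1 fun h' => h ⟨hi, h'⟩, fun h h' => by omega⟩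

lemma one_notMem_deficients {n : ℕ} {g : ℕ → ℕ} (hg : IsWindow n g) : 1 ∉ deficients n g := by
  intro h
  obtain ⟨h1, h2⟩ := Finset.mem_filter.1 h
  have := Finset.mem_Icc.1 (hg.1 1 h1)
  omega

lemma strictMonoOn_Icc_one_iff {n s : ℕ} {g : ℕ → ℕ} (hg : IsWindow n g) (hn : NoDec n g)
    (hs : s ≤ n) : StrictMonoOn g (Finset.Icc 1 s : Finset ℕ) ↔ ∀ i ∈ deficients n g, s < i := by
  constructor
  · intro h i hi
    by_contra his
    obtain ⟨h1, h2⟩ := Finset.mem_filter.1 hi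
    have h1 := Finset.mem_Icc.1 h1
    obtain ⟨j, hj, hj'⟩ := hg.exists_le_of_lt (i := i - 1) (by omega)
      (by rwa [Nat.sub_add_cancel h1.1])
    have hj := Finset.mem_Icc.1 hj
    have := h (a := j) (b := i) (by simp; omega) (by simp; omega) (by omega)
    omega
  · intro h
    refine (hn.strictMonoOn hg).2.mono fun i hi => ?_
    have hi := Finset.mem_Icc.1 (Finset.mem_coe.1 hi)
    refine Finset.mem_coe.2 (Finset.mem_sdiff.2 ⟨Finset.mem_Icc.2 (by omega), fun hd => ?_⟩)
    have := h i hd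
    omega

lemma strictMonoOn_Icc_two_iff {n s e : ℕ} {g : ℕ → ℕ} (hg : IsWindow n g) (hn : NoDec n g)
    (hs : s ≤ n) :
    (StrictMonoOn g (Finset.Icc 2 s : Finset ℕ) ∧ ((deficients n g).filter (· ≤ s)).card = e) ↔
      (deficients n g).filter (· ≤ s) = Finset.Icc 2 (e + 1) := by
  constructor
  · rintro ⟨h, hc⟩
    have hstep : ∀ i j, 2 ≤ i → i ≤ j → j ≤ s → i ≤ g i → j ≤ g j := by
      intro i j hi hij
      induction j, hij using Nat.le_induction with
      | base => exact fun _ h => h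
      | succ j hj ih =>
        intro hjs hgi
        have h1 := ih (by omega) hgi
        have := h (a := j) (b := j + 1) (by simp; omega) (by simp; omega) (by omega)
        omega
    have hsub : ∀ i ∈ (deficients n g).filter (· ≤ s), Finset.Icc 2 i ⊆
        (deficients n g).filter (· ≤ s) := by
      intro i hi j hj
      obtain ⟨hi, his⟩ := Finset.mem_filter.1 hi
      obtain ⟨hi, hi'⟩ := Finset.mem_filter.1 hi
      have hj := Finset.mem_Icc.1 hj
      refine Finset.mem_filter.2 ⟨?_, by omega⟩
      by_contra hjd
      rw [not_mem_deficients (Finset.mem_Icc.2 (by omega))] at hjd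
      have := hstep j i hj.1 hj.2 his hjd
      omega
    refine Finset.eq_of_subset_of_card_le (fun i hi => ?_) ?_
    · have h1 := Finset.card_le_card (hsub i hi)
      have h2 : i ≠ 1 := by
        rintro rfl; exact one_notMem_deficients hg (Finset.mem_filter.1 hi).1
      have h3 := Finset.mem_Icc.1 (Finset.mem_filter.1 (Finset.mem_filter.1 hi).1).1
      rw [hc, Nat.card_Icc] at h1
      rw [Finset.mem_Icc]; omega
    · rw [hc, Nat.card_Icc]; omega
  · intro h
    have hd : ∀ i, 1 ≤ i → i ≤ s → (i ∈ deficients n g ↔ 2 ≤ i ∧ i ≤ e + 1) := by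
      intro i hi his
      rw [← Finset.mem_Icc, ← h, Finset.mem_filter, and_iff_left his]
    refine ⟨fun i hi j hj hij => ?_, by rw [h, Nat.card_Icc]; omega⟩
    have hi := Finset.mem_Icc.1 (Finset.mem_coe.1 hi)
    have hj := Finset.mem_Icc.1 (Finset.mem_coe.1 hj)
    have hi' : i ∈ Finset.Icc 1 n := Finset.mem_Icc.2 (by omega)
    have hj' : j ∈ Finset.Icc 1 n := Finset.mem_Icc.2 (by omega)
    by_cases h1 : i ∈ deficients n g <;> by_cases h2 : j ∈ deficients n g
    · exact (hn.strictMonoOn hg).1 h1 h2 hij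
    · have h1 := (Finset.mem_filter.1 h1).2
      rw [not_mem_deficients hj'] at h2
      omega
    · rw [hd i (by omega) (by omega)] at h1
      rw [hd j (by omega) (by omega)] at h2
      omega
    · exact (hn.strictMonoOn hg).2 (Finset.mem_coe.2 (Finset.mem_sdiff.2 ⟨hi', h1⟩))
        (Finset.mem_coe.2 (Finset.mem_sdiff.2 ⟨hj', h2⟩)) hij

section
open Polynomial

lemma sum_windows_Icc_one {n s : ℕ} {S : Finset ℕ} (hS : S ⊆ Finset.Icc 1 n) (hs : s ≤ n) :
    ∑ g ∈ (windows n).filter fun g => NoDec n g ∧ StrictMonoOn g (Finset.Icc 1 s : Finset ℕ) ∧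
      (deficients n g).filter (s < ·) = S.filter (s < ·), (X : ℤ[X]) ^ blocks n g =
      fpoly (S.filter (s < ·)) n := by
  rw [← sum_windows_deficients ((Finset.filter_subset _ _).trans hS)]
  refine Finset.sum_congr (Finset.filter_congr fun g hg => ?_) fun _ _ => rfl
  refine and_congr_right fun hn => ?_
  rw [strictMonoOn_Icc_one_iff (mem_windows.1 hg) hn hs]
  constructor
  · rintro ⟨h1, h2⟩
    rw [← h2, Finset.filter_true_of_mem h1]
  · intro h
    rw [h]
    exact ⟨fun i hi => (Finset.mem_filter.1 hi).2, by rw [Finset.filter_filter]; simp⟩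

lemma sum_windows_Icc_two {n s : ℕ} {S : Finset ℕ} (hS : S ⊆ Finset.Icc 1 n) (hs : s ∈ S)
    (hmin : ∀ i ∈ S, s ≤ i) :
    ∑ g ∈ (windows n).filter fun g => NoDec n g ∧ StrictMonoOn g (Finset.Icc 2 s : Finset ℕ) ∧
      (deficients n g).filter (s < ·) = S.filter (s < ·), (X : ℤ[X]) ^ blocks n g =
      fpoly (S.filter (s < ·)) n + fpoly S n := by
  obtain ⟨h1, hsn⟩ := Finset.mem_Icc.1 (hS hs)
  rw [← sum_fpoly_shiftSet hs h1 hsn hmin, ← Finset.sum_fiberwise_of_maps_to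
    (t := Finset.range s) (g := fun g => ((deficients n g).filter (· ≤ s)).card)]
  · refine Finset.sum_congr rfl fun e he => ?_
    have he := Finset.mem_range.1 he
    rw [← sum_windows_deficients, Finset.filter_filter]
    · refine Finset.sum_congr (Finset.filter_congr fun g hg => ?_) fun _ _ => rfl
      rw [and_assoc]
      refine and_congr_right fun hn => ?_
      rw [and_right_comm, strictMonoOn_Icc_two_iff (mem_windows.1 hg) hn hsn]
      constructor
      · rintro ⟨h2, h3⟩
        rw [shiftSet, ← h2, ← h3, ← Finset.filter_or]
        exact (Finset.filter_true_of_mem fun i _ => by omega).symm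
      · intro h
        rw [h]
        constructor
        · ext i
          rw [Finset.mem_filter, Finset.mem_Icc]
          constructor
          · rintro ⟨h2, h3⟩; exact (mem_shiftSet_of_le h3).1 h2
          · intro h2; exact ⟨(mem_shiftSet_of_le (by omega)).2 h2, by omega⟩
        · ext i
          rw [Finset.mem_filter, Finset.mem_filter]
          exact and_congr_left fun h2 => mem_shiftSet_of_lt he h2
    · intro i hi
      rcases Finset.mem_union.1 hi with h | h
      · have := Finset.mem_Icc.1 h; rw [Finset.mem_Icc]; omega
      · exact hS (Finset.mem_filter.1 h).1
  · intro g hg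
    obtain ⟨hg, -⟩ := Finset.mem_filter.1 hg
    have : (deficients n g).filter (· ≤ s) ⊆ Finset.Icc 2 s := fun i hi => by
      obtain ⟨h2, h3⟩ := Finset.mem_filter.1 hi
      have h4 := Finset.mem_Icc.1 (Finset.mem_filter.1 h2).1
      have h5 : i ≠ 1 := by
        rintro rfl; exact one_notMem_deficients (mem_windows.1 hg) h2
      rw [Finset.mem_Icc]; omega
    have := Finset.card_le_card this
    rw [Nat.card_Icc] at this
    rw [Finset.mem_range]; omega

end

/-- The rank of position `i` when the positions in `R` come first, in decreasing order,
followed by the remaining positions in increasing order. -/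
def posRank (R : Finset ℕ) (i : ℕ) : ℕ :=
  (if i ∈ R then 1 else i) + (R.filter (i < ·)).card

lemma posRank_of_mem {R : Finset ℕ} {i : ℕ} (h : i ∈ R) :
    posRank R i = 1 + (R.filter (i < ·)).card := by rw [posRank, if_pos h]

lemma posRank_of_notMem {R : Finset ℕ} {i : ℕ} (h : i ∉ R) :
    posRank R i = i + (R.filter (i < ·)).card := by rw [posRank, if_neg h]

lemma posRank_lt_of_mem {R : Finset ℕ} {i j : ℕ} (hi : i ∈ R) (hj : j ∈ R) (hij : i < j) :
    posRank R j < posRank R i := by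
  rw [posRank_of_mem hi, posRank_of_mem hj]
  refine Nat.add_lt_add_left (Finset.card_lt_card ⟨fun k hk => ?_, fun h => ?_⟩) 1
  · rw [Finset.mem_filter] at hk ⊢; exact ⟨hk.1, by omega⟩
  · have := (Finset.mem_filter.1 (h (Finset.mem_filter.2 ⟨hj, hij⟩))).2
    omega

lemma posRank_lt_of_notMem {R : Finset ℕ} {i j : ℕ} (hi : i ∉ R) (hj : j ∉ R) (hij : i < j) :
    posRank R i < posRank R j := by
  rw [posRank_of_notMem hi, posRank_of_notMem hj]
  have h1 : R.filter (i < ·) ⊆ Finset.Ioo i j ∪ R.filter (j < ·) := fun k hk => by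
    obtain ⟨h1, h2⟩ := Finset.mem_filter.1 hk
    have : k ≠ j := by rintro rfl; exact hj h1
    rw [Finset.mem_union, Finset.mem_Ioo, Finset.mem_filter]
    by_cases h : k < j
    · exact Or.inl ⟨h2, h⟩
    · exact Or.inr ⟨h1, by omega⟩
  have h2 := (Finset.card_le_card h1).trans (Finset.card_union_le _ _)
  rw [Nat.card_Ioo] at h2
  omega

lemma posRank_le_card {R : Finset ℕ} {i : ℕ} (hi : i ∈ R) : posRank R i ≤ R.card := by
  rw [posRank_of_mem hi, add_comm]
  exact Finset.card_lt_card ⟨Finset.filter_subset _ _, fun h => by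
    have := (Finset.mem_filter.1 (h hi)).2; omega⟩

lemma card_lt_posRank {n : ℕ} {R : Finset ℕ} {i : ℕ} (hR : R ⊆ Finset.Icc 1 n) (h1 : 1 ≤ i)
    (hi : i ∉ R) : R.card < posRank R i := by
  rw [posRank_of_notMem hi]
  have h1 : R ⊆ Finset.Ico 1 i ∪ R.filter (i < ·) := fun k hk => by
    have : k ≠ i := by rintro rfl; exact hi hk
    have := Finset.mem_Icc.1 (hR hk)
    rw [Finset.mem_union, Finset.mem_Ico, Finset.mem_filter]
    by_cases h : k < i
    · exact Or.inl ⟨by omega, h⟩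
    · exact Or.inr ⟨hk, by omega⟩
  have h2 := (Finset.card_le_card h1).trans (Finset.card_union_le _ _)
  rw [Nat.card_Ico] at h2
  omega

lemma posRank_lt_of_mem_of_notMem {n : ℕ} {R : Finset ℕ} {i j : ℕ} (hR : R ⊆ Finset.Icc 1 n)
    (hi : i ∈ R) (h1 : 1 ≤ j) (hj : j ∉ R) : posRank R i < posRank R j :=
  (posRank_le_card hi).trans_lt (card_lt_posRank hR h1 hj)

lemma posRank_of_forall_le {R : Finset ℕ} {i : ℕ} (h : ∀ j ∈ R, j < i) : posRank R i = i := by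
  rw [posRank_of_notMem fun hi => lt_irrefl _ (h i hi), Finset.filter_eq_empty_iff.2]
  · rfl
  · intro j hj; have := h j hj; omega

lemma posRank_max {R : Finset ℕ} {s : ℕ} (hs : s ∈ R) (h : ∀ j ∈ R, j ≤ s) :
    posRank R s = 1 := by
  rw [posRank_of_mem hs, Finset.filter_eq_empty_iff.2]
  · rfl
  · intro j hj; have := h j hj; omega

lemma posRank_le_of_le {R : Finset ℕ} {i m : ℕ} (h1 : 1 ≤ i) (him : i ≤ m)
    (h : ∀ j ∈ R, j ≤ m) : posRank R i ≤ m := by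
  have h1 : R.filter (i < ·) ⊆ Finset.Ioc i m := fun k hk => by
    obtain ⟨h1, h2⟩ := Finset.mem_filter.1 hk
    have := h k h1
    rw [Finset.mem_Ioc]; omega
  have h2 := Finset.card_le_card h1
  rw [Nat.card_Ioc] at h2
  rw [posRank]
  split_ifs <;> omega

lemma one_le_posRank {R : Finset ℕ} {i : ℕ} (h1 : 1 ≤ i) : 1 ≤ posRank R i := by
  rw [posRank]; split_ifs <;> omega

lemma posRank_injOn {n : ℕ} {R : Finset ℕ} (hR : R ⊆ Finset.Icc 1 n) :
    Set.InjOn (posRank R) (Finset.Icc 1 n) := by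
  intro i hi j hj h
  have hi := (Finset.mem_Icc.1 (Finset.mem_coe.1 hi)).1
  have hj := (Finset.mem_Icc.1 (Finset.mem_coe.1 hj)).1
  by_contra hne
  by_cases h1 : i ∈ R <;> by_cases h2 : j ∈ R
  · rcases Nat.lt_or_gt_of_ne hne with h3 | h3
    · have := posRank_lt_of_mem h1 h2 h3; omega
    · have := posRank_lt_of_mem h2 h1 h3; omega
  · have := posRank_lt_of_mem_of_notMem hR h1 hj h2; omega
  · have := posRank_lt_of_mem_of_notMem hR h2 hi h1; omega
  · rcases Nat.lt_or_gt_of_ne hne with h3 | h3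
    · have := posRank_lt_of_notMem h1 h2 h3; omega
    · have := posRank_lt_of_notMem h2 h1 h3; omega

lemma posRank_mem {n : ℕ} {R : Finset ℕ} (hR : R ⊆ Finset.Icc 1 n) {i : ℕ}
    (hi : i ∈ Finset.Icc 1 n) : posRank R i ∈ Finset.Icc 1 n := by
  have hi := Finset.mem_Icc.1 hi
  exact Finset.mem_Icc.2 ⟨one_le_posRank hi.1,
    posRank_le_of_le hi.1 hi.2 fun j hj => (Finset.mem_Icc.1 (hR hj)).2⟩

lemma exists_posRank_eq {n : ℕ} {R : Finset ℕ} (hR : R ⊆ Finset.Icc 1 n) {q : ℕ}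
    (hq : q ∈ Finset.Icc 1 n) : ∃ i ∈ Finset.Icc 1 n, posRank R i = q := by
  rw [← Finset.mem_image, Finset.eq_of_subset_of_card_le
    (Finset.image_subset_iff.2 fun i hi => posRank_mem hR hi)
    (by rw [Finset.card_image_of_injOn (posRank_injOn hR)])]
  exact hq

lemma InB.map_zero {n : ℕ} {w : Equiv.Perm ℤ} (hw : InB n w) : w 0 = 0 := by
  have := hw.1 0
  rw [neg_zero] at this
  omega

lemma InB.abs_mem {n : ℕ} {w : Equiv.Perm ℤ} (hw : InB n w) {i : ℕ} (hi : i ∈ Finset.Icc 1 n) :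
    (w i).natAbs ∈ Finset.Icc 1 n := by
  have hi := Finset.mem_Icc.1 hi
  rw [Finset.mem_Icc]
  constructor
  · by_contra h
    have h0 : w i = w 0 := by rw [hw.map_zero]; omega
    have := w.injective h0
    omega
  · by_contra h
    have h0 := hw.2 (w i) (by rw [Int.abs_eq_natAbs]; omega)
    have h1 := w.injective h0
    rw [h1] at h
    omega

lemma InB.eq_of_natAbs_eq {n : ℕ} {w : Equiv.Perm ℤ} (hw : InB n w) {i j : ℕ} (hi : 1 ≤ i)
    (h : (w i).natAbs = (w j).natAbs) : i = j := by
  rcases Int.natAbs_eq_natAbs_iff.1 h with h | h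
  · exact_mod_cast w.injective h
  · rw [← hw.1] at h
    have := w.injective h
    omega

lemma InB.ext {n : ℕ} {w w' : Equiv.Perm ℤ} (hw : InB n w) (hw' : InB n w')
    (h : ∀ i ∈ Finset.Icc 1 n, w ((i : ℕ) : ℤ) = w' ((i : ℕ) : ℤ)) : w = w' := by
  have key : ∀ k : ℕ, w k = w' k := fun k => by
    by_cases hk : k ∈ Finset.Icc 1 n
    · exact h k hk
    · rw [Finset.mem_Icc] at hk
      by_cases h0 : k = 0
      · rw [h0, Nat.cast_zero, hw.map_zero, hw'.map_zero]
      · rw [hw.2 k (by rw [Nat.abs_cast]; omega), hw'.2 k (by rw [Nat.abs_cast]; omega)]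
  refine Equiv.ext fun x => ?_
  rcases Int.natAbs_eq x with hx | hx
  · rw [hx, key]
  · rw [hx, hw.1, hw'.1, key]

lemma exists_inB {n : ℕ} {u : ℕ → ℤ} (h1 : ∀ i ∈ Finset.Icc 1 n, (u i).natAbs ∈ Finset.Icc 1 n)
    (h2 : Set.InjOn (fun i => (u i).natAbs) (Finset.Icc 1 n)) :
    ∃ w, InB n w ∧ ∀ i ∈ Finset.Icc 1 n, w ((i : ℕ) : ℤ) = u i := by
  set v : ℤ → ℤ := fun x => if x.natAbs ≤ n then x.sign * u x.natAbs else x with hv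
  have v1 : ∀ x, x.natAbs ≤ n → v x = x.sign * u x.natAbs := fun x hx => if_pos hx
  have v2 : ∀ x, ¬ x.natAbs ≤ n → v x = x := fun x hx => if_neg hx
  have hmem : ∀ x : ℤ, x ≠ 0 → x.natAbs ≤ n → x.natAbs ∈ Finset.Icc 1 n := fun x h0 h =>
    Finset.mem_Icc.2 (by omega)
  have habs : ∀ x : ℤ, x ≠ 0 → x.natAbs ≤ n → (v x).natAbs = (u x.natAbs).natAbs := by
    intro x h0 h
    rw [v1 x h, Int.natAbs_mul, Int.natAbs_sign_of_ne_zero h0, one_mul]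
  have v0 : v 0 = 0 := by simp [hv]
  have hle : ∀ x : ℤ, x.natAbs ≤ n → (v x).natAbs ≤ n := by
    intro x h
    by_cases h0 : x = 0
    · rw [h0, v0]; simp
    · rw [habs x h0 h]
      exact (Finset.mem_Icc.1 (h1 _ (hmem x h0 h))).2
  have hne : ∀ x : ℤ, x ≠ 0 → x.natAbs ≤ n → v x ≠ 0 := by
    intro x h0 h hz
    have := Finset.mem_Icc.1 (h1 _ (hmem x h0 h))
    rw [← habs x h0 h, hz] at this
    simp at this
  have hinj : Function.Injective v := by
    intro x y hxy
    by_cases hx : x.natAbs ≤ n <;> by_cases hy : y.natAbs ≤ n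
    · by_cases hx0 : x = 0
      · by_contra hy0
        rw [hx0, v0] at hxy
        exact hne y (fun h => hy0 (by rw [hx0, h])) hy hxy.symm
      · by_cases hy0 : y = 0
        · rw [hy0, v0] at hxy
          exact absurd hxy (hne x hx0 hx)
        · have h3 : x.natAbs = y.natAbs := h2 (Finset.mem_coe.2 (hmem x hx0 hx))
            (Finset.mem_coe.2 (hmem y hy0 hy)) (by
              change (u x.natAbs).natAbs = (u y.natAbs).natAbs
              rw [← habs x hx0 hx, ← habs y hy0 hy, hxy])
          have h4 := hne x hx0 hx
          rw [v1 x hx, v1 y hy, h3] at hxy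
          rw [v1 x hx, h3] at h4
          have h5 := mul_right_cancel₀ (right_ne_zero_of_mul h4) hxy
          rw [← Int.sign_mul_natAbs x, ← Int.sign_mul_natAbs y, h5, h3]
    · have := hle x hx; rw [hxy, v2 y hy] at this; exact absurd this hy
    · have := hle y hy; rw [← hxy, v2 x hx] at this; exact absurd this hx
    · rwa [v2 x hx, v2 y hy] at hxy
  have hsurj : Function.Surjective v := by
    intro y
    by_cases hy : y.natAbs ≤ n
    · have himg : (Finset.Icc (-n : ℤ) n).image v = Finset.Icc (-n : ℤ) n := by
        refine Finset.eq_of_subset_of_card_le (Finset.image_subset_iff.2 fun x hx => ?_)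
          (by rw [Finset.card_image_of_injective _ hinj])
        rw [Finset.mem_Icc] at hx ⊢
        have := hle x (by omega)
        omega
      have : y ∈ (Finset.Icc (-n : ℤ) n).image v := by rw [himg, Finset.mem_Icc]; omega
      obtain ⟨x, -, hx⟩ := Finset.mem_image.1 this
      exact ⟨x, hx⟩
    · exact ⟨y, v2 y hy⟩
  refine ⟨Equiv.ofBijective v ⟨hinj, hsurj⟩, ⟨fun x => ?_,
    fun x hx => v2 x (by rw [Int.abs_eq_natAbs] at hx; omega)⟩,
    fun i hi => ?_⟩
  · change v (-x) = - v x
    by_cases hx : x.natAbs ≤ n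
    · rw [v1 x hx, v1 (-x) (by rwa [Int.natAbs_neg]), Int.sign_neg, Int.natAbs_neg, neg_mul]
    · rw [v2 x hx, v2 (-x) (by rwa [Int.natAbs_neg])]
  · have hi' := Finset.mem_Icc.1 hi
    change v i = u i
    rw [v1 _ (by simpa using hi'.2), Int.natAbs_natCast,
      Int.sign_eq_one_of_pos (by exact_mod_cast hi'.1), one_mul]

/-- The signed permutation `w` has negative positions `R`, and `g` lists the absolute values of
its entries in the order given by `posRank R`. -/
structure Represents (n : ℕ) (R : Finset ℕ) (g : ℕ → ℕ) (w : Equiv.Perm ℤ) : Prop where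
  subset : R ⊆ Finset.Icc 1 n
  window : IsWindow n g
  inB : InB n w
  neg : ∀ i ∈ R, w ((i : ℕ) : ℤ) = - (g (posRank R i) : ℤ)
  pos : ∀ i ∈ Finset.Icc 1 n, i ∉ R → w ((i : ℕ) : ℤ) = g (posRank R i)

lemma exists_represents {n : ℕ} {R : Finset ℕ} {g : ℕ → ℕ} (hR : R ⊆ Finset.Icc 1 n)
    (hg : IsWindow n g) : ∃ w, Represents n R g w := by
  have habs : ∀ i, (if i ∈ R then - (g (posRank R i) : ℤ) else g (posRank R i)).natAbs =
      g (posRank R i) := fun i => by split_ifs <;> simp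
  obtain ⟨w, hw, h⟩ := exists_inB (n := n)
    (u := fun i => if i ∈ R then - (g (posRank R i) : ℤ) else g (posRank R i))
    (fun i hi => by rw [habs]; exact hg.1 _ (posRank_mem hR hi))
    (fun i hi j hj hij => by
      simp only [habs] at hij
      exact posRank_injOn hR hi hj (hg.2.1 (posRank_mem hR hi) (posRank_mem hR hj) hij))
  exact ⟨w, hR, hg, hw, fun i hi => by rw [h i (hR hi), if_pos hi],
    fun i hi hi' => by rw [h i hi, if_neg hi']⟩

lemma Represents.eq {n : ℕ} {R : Finset ℕ} {g : ℕ → ℕ} {w w' : Equiv.Perm ℤ}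
    (h : Represents n R g w) (h' : Represents n R g w') : w = w' := by
  refine h.inB.ext h'.inB fun i hi => ?_
  by_cases hiR : i ∈ R
  · rw [h.neg i hiR, h'.neg i hiR]
  · rw [h.pos i hi hiR, h'.pos i hi hiR]

lemma Represents.natAbs_eq {n : ℕ} {R : Finset ℕ} {g : ℕ → ℕ} {w : Equiv.Perm ℤ}
    (h : Represents n R g w) {i : ℕ} (hi : i ∈ Finset.Icc 1 n) :
    (w i).natAbs = g (posRank R i) := by
  by_cases hiR : i ∈ R
  · rw [h.neg i hiR]; simp
  · rw [h.pos i hi hiR]; simp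

lemma Represents.negSet_eq {n : ℕ} {R : Finset ℕ} {g : ℕ → ℕ} {w : Equiv.Perm ℤ}
    (h : Represents n R g w) : NegSet n w = R := by
  ext i
  rw [NegSet, Finset.mem_filter]
  constructor
  · rintro ⟨hi, hlt⟩
    by_contra hiR
    rw [h.pos i hi hiR] at hlt
    omega
  · intro hi
    have := Finset.mem_Icc.1 (h.window.1 _ (posRank_mem h.subset (h.subset hi)))
    refine ⟨h.subset hi, ?_⟩
    rw [h.neg i hi]
    omega

lemma Represents.inj {n : ℕ} {R R' : Finset ℕ} {g g' : ℕ → ℕ} {w : Equiv.Perm ℤ}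
    (h : Represents n R g w) (h' : Represents n R' g' w) : R = R' ∧ g = g' := by
  obtain rfl : R = R' := by rw [← h.negSet_eq, h'.negSet_eq]
  refine ⟨rfl, funext fun q => ?_⟩
  by_cases hq : q ∈ Finset.Icc 1 n
  · obtain ⟨i, hi, rfl⟩ := exists_posRank_eq h.subset hq
    rw [← h.natAbs_eq hi, h'.natAbs_eq hi]
  · rw [h.window.2.2 q hq, h'.window.2.2 q hq]

lemma InB.exists_represents {n : ℕ} {w : Equiv.Perm ℤ} (hw : InB n w) :
    ∃ R g, Represents n R g w := by
  have hR : NegSet n w ⊆ Finset.Icc 1 n := Finset.filter_subset _ _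
  choose! p hp hp' using fun q (hq : q ∈ Finset.Icc 1 n) => exists_posRank_eq hR hq
  have hpos : ∀ i ∈ Finset.Icc 1 n, p (posRank (NegSet n w) i) = i := fun i hi =>
    posRank_injOn hR (hp _ (posRank_mem hR hi)) hi (hp' _ (posRank_mem hR hi))
  refine ⟨NegSet n w, fun q => if q ∈ Finset.Icc 1 n then (w (p q)).natAbs else 0, hR,
    ⟨fun q hq => ?_, fun q hq q' hq' h => ?_, fun q hq => if_neg hq⟩, hw, fun i hi => ?_,
    fun i hi hi' => ?_⟩
  · simp only [if_pos hq]; exact hw.abs_mem (hp q hq)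
  · have hq := Finset.mem_coe.1 hq
    have hq' := Finset.mem_coe.1 hq'
    simp only [if_pos hq, if_pos hq'] at h
    rw [← hp' q hq, ← hp' q' hq', hw.eq_of_natAbs_eq (Finset.mem_Icc.1 (hp q hq)).1 h]
  · simp only [if_pos (posRank_mem hR (hR hi)), hpos i (hR hi)]
    have := (Finset.mem_filter.1 hi).2
    omega
  · simp only [if_pos (posRank_mem hR hi), hpos i hi]
    have : ¬ w (i : ℤ) < 0 := fun h => hi' (Finset.mem_filter.2 ⟨hi, h⟩)
    omega

lemma Represents.inv_lt_inv {n : ℕ} {R : Finset ℕ} {g : ℕ → ℕ} {w : Equiv.Perm ℤ}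
    (h : Represents n R g w) {q q' : ℕ} (hq : q ∈ Finset.Icc 1 n) (hq' : q' ∈ Finset.Icc 1 n)
    (hlt : q < q') : w⁻¹ (g q : ℤ) < w⁻¹ (g q' : ℤ) := by
  have key : ∀ i ∈ Finset.Icc 1 n, w⁻¹ (g (posRank R i) : ℤ) = if i ∈ R then -(i : ℤ) else i := by
    intro i hi
    rw [Equiv.Perm.inv_eq_iff_eq]
    split_ifs with hiR
    · rw [h.inB.1, h.neg i hiR, neg_neg]
    · rw [h.pos i hi hiR]
  obtain ⟨i, hi, rfl⟩ := exists_posRank_eq h.subset hq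
  obtain ⟨j, hj, rfl⟩ := exists_posRank_eq h.subset hq'
  rw [key i hi, key j hj]
  have hi := Finset.mem_Icc.1 hi
  have hj := Finset.mem_Icc.1 hj
  by_cases h1 : i ∈ R <;> by_cases h2 : j ∈ R
  · rw [if_pos h1, if_pos h2]
    rcases lt_trichotomy i j with h3 | rfl | h3
    · have := posRank_lt_of_mem h1 h2 h3; omega
    · omega
    · omega
  · rw [if_pos h1, if_neg h2]; omega
  · have := posRank_lt_of_mem_of_notMem h.subset h2 hi.1 h1; omega
  · rw [if_neg h1, if_neg h2]
    rcases lt_trichotomy i j with h3 | rfl | h3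
    · omega
    · omega
    · have := posRank_lt_of_notMem h2 h1 h3; omega

lemma Represents.forall_inv_lt_iff {n : ℕ} {R : Finset ℕ} {g : ℕ → ℕ} {w : Equiv.Perm ℤ}
    (h : Represents n R g w) {i : ℕ} (hi : i < n) :
    (∀ j ∈ Finset.Icc 1 i, ∀ k ∈ Finset.Icc (i + 1) n,
      w⁻¹ ((j : ℕ) : ℤ) < w⁻¹ ((k : ℕ) : ℤ)) ↔ ∀ j ∈ Finset.Icc 1 i, g j ≤ i := by
  have hsub : Finset.Icc 1 i ⊆ Finset.Icc 1 n := Finset.Icc_subset_Icc_right hi.le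
  constructor
  · intro hb q hq
    by_contra hgq
    have hqn := hsub hq
    have hq1 := Finset.mem_Icc.1 hq
    have hgqn := Finset.mem_Icc.1 (h.window.1 q hqn)
    obtain ⟨q', hq', hgq'⟩ : ∃ q' ∈ Finset.Icc (i + 1) n, g q' ≤ i := by
      by_contra! hc
      have hsub' : insert q (Finset.Icc (i + 1) n) ⊆ Finset.Icc 1 n := fun x hx => by
        rcases Finset.mem_insert.1 hx with rfl | hx
        · exact hqn
        · have := Finset.mem_Icc.1 hx
          exact Finset.mem_Icc.2 (by omega)
      have h1 := Finset.card_le_card_of_injOn (s := insert q (Finset.Icc (i + 1) n))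
        (t := Finset.Icc (i + 1) n) g (fun x hx => by
          rcases Finset.mem_insert.1 (Finset.mem_coe.1 hx) with rfl | hx
          · exact Finset.mem_coe.2 (Finset.mem_Icc.2 (by omega))
          · have := hc x hx
            have hx' := Finset.mem_Icc.1 hx
            have := Finset.mem_Icc.1 (h.window.1 x (Finset.mem_Icc.2 (by omega)))
            exact Finset.mem_coe.2 (Finset.mem_Icc.2 (by omega)))
        (h.window.2.1.mono (by exact_mod_cast hsub'))
      rw [Finset.card_insert_of_notMem (by rw [Finset.mem_Icc]; omega)] at h1
      omega
    have hq'1 := Finset.mem_Icc.1 hq'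
    have hq'n : q' ∈ Finset.Icc 1 n := Finset.mem_Icc.2 (by omega)
    have h1 := Finset.mem_Icc.1 (h.window.1 q' hq'n)
    have h2 := hb (g q') (Finset.mem_Icc.2 (by omega)) (g q) (Finset.mem_Icc.2 (by omega))
    have h3 := h.inv_lt_inv hqn hq'n (by omega)
    exact lt_asymm h2 h3
  · intro hb j hj k hk
    have himg : (Finset.Icc 1 i).image g = Finset.Icc 1 i := by
      refine Finset.eq_of_subset_of_card_le (Finset.image_subset_iff.2 fun x hx => ?_) ?_
      · exact Finset.mem_Icc.2 ⟨(Finset.mem_Icc.1 (h.window.1 x (hsub hx))).1, hb x hx⟩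
      · rw [Finset.card_image_of_injOn (h.window.2.1.mono (by exact_mod_cast hsub))]
    rw [← himg] at hj
    obtain ⟨q, hq, rfl⟩ := Finset.mem_image.1 hj
    have hk := Finset.mem_Icc.1 hk
    have hkn : k ∈ (Finset.Icc 1 n).image g := by
      rw [h.window.image_eq, Finset.mem_Icc]; omega
    obtain ⟨q', hq', rfl⟩ := Finset.mem_image.1 hkn
    refine h.inv_lt_inv (hsub hq) hq' ?_
    by_contra hle
    have := hb q' (Finset.mem_Icc.2 ⟨(Finset.mem_Icc.1 hq').1,
      (not_lt.1 hle).trans (Finset.mem_Icc.1 hq).2⟩)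
    omega

theorem Represents.bl_inv {n : ℕ} {R : Finset ℕ} {g : ℕ → ℕ} {w : Equiv.Perm ℤ}
    (h : Represents n R g w) (hn : 0 < n) : bl n w⁻¹ = blocks n g := by
  have hins : Finset.Icc 1 n = insert n (Finset.Ioo 0 n) := by
    ext i; simp only [Finset.mem_Icc, Finset.mem_insert, Finset.mem_Ioo]; omega
  have htop : ∀ j ∈ Finset.Icc 1 n, g j ≤ n := fun j hj => (Finset.mem_Icc.1 (h.window.1 j hj)).2
  rw [bl, blocks]
  rw [hins, Finset.filter_insert, if_pos htop, Finset.card_insert_of_notMem (by simp), add_comm]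
  congr 2
  ext i
  simp only [Finset.mem_filter]
  refine and_congr_right fun hi => ?_
  exact h.forall_inv_lt_iff (Finset.mem_Ioo.1 hi).2

lemma Represents.isFC_iff_of_mem {n : ℕ} {R : Finset ℕ} {g : ℕ → ℕ} {w : Equiv.Perm ℤ}
    (h : Represents n R g w) {s : ℕ} (hs : s ∈ R) (hmax : ∀ j ∈ R, j ≤ s) :
    IsFC n w ↔ NoDec n g ∧ StrictMonoOn g (Finset.Icc 2 s : Finset ℕ) ∧
      (R ≠ {s} → StrictMonoOn g (Finset.Icc 1 s : Finset ℕ)) := by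
  have hsn := Finset.mem_Icc.1 (h.subset hs)
  have hmem : ∀ i, 1 ≤ i → i ≤ n → i ∈ Finset.Icc 1 n := fun i h1 h2 => Finset.mem_Icc.2 ⟨h1, h2⟩
  have habs : ∀ i, 1 ≤ i → i ≤ n → |w (i : ℤ)| = g (posRank R i) := fun i h1 h2 => by
    rw [Int.abs_eq_natAbs, h.natAbs_eq (hmem i h1 h2)]
  have hgpos : ∀ i, 1 ≤ i → i ≤ n → 1 ≤ g (posRank R i) := fun i h1 h2 =>
    (Finset.mem_Icc.1 (h.window.1 _ (posRank_mem h.subset (hmem i h1 h2)))).1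
  have hneg : ∀ i, 1 ≤ i → i ≤ n → w (i : ℤ) < 0 → i ∈ R := fun i h1 h2 h3 => by
    by_contra hi
    rw [h.pos i (hmem i h1 h2) hi] at h3
    omega
  have hbig : ∀ i, s < i → i ∉ R ∧ posRank R i = i := fun i hi =>
    ⟨fun h' => by have := hmax i h'; omega,
      posRank_of_forall_le fun j hj => (hmax j hj).trans_lt hi⟩
  have hr1 := posRank_max hs hmax
  constructor
  · rintro ⟨-, c1, c2, c3⟩
    have a1 : ∀ i ∈ R, ∀ j ∈ R, i < j → g (posRank R j) < g (posRank R i) := by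
      intro i hi j hj hij
      have hi1 := Finset.mem_Icc.1 (h.subset hi)
      have hj1 := Finset.mem_Icc.1 (h.subset hj)
      by_contra hlt
      have hne : g (posRank R i) ≠ g (posRank R j) := fun h' => by
        have := h.window.2.1 (posRank_mem h.subset (h.subset hi))
          (posRank_mem h.subset (h.subset hj)) h'
        have := posRank_lt_of_mem hi hj hij
        omega
      refine c1 ⟨i, j, hi1.1, hij, hj1.2, ?_, ?_⟩
      · rw [h.neg i hi, h.neg j hj]; omega
      · rw [h.neg i hi]
        have := hgpos i hi1.1 hi1.2
        omega
    have a2 : ∀ i j, 1 ≤ i → i < j → j < s → j ∉ R → g (posRank R i) ≤ g (posRank R j) := by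
      intro i j hi hij hjs hj
      by_contra hlt
      have hjw := h.pos j (hmem j (by omega) (by omega)) hj
      refine c2 ⟨i, j, s, hi, hij, hjs, hsn.2, ?_, ?_⟩
      · rw [hjw, habs i hi (by omega)]; omega
      · rw [hjw, h.neg s hs]
        have := hgpos s hsn.1 hsn.2
        omega
    have a3 : ∀ i j, 1 ≤ i → i < j → j ∈ R → j < s → g (posRank R j) ≤ g (posRank R i) := by
      intro i j hi hij hj hjs
      by_contra hlt
      refine c3 ⟨i, j, s, hi, hij, hjs, hsn.2, ?_, ?_⟩
      · rw [habs i hi (by omega), h.neg j hj]; omega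
      · rw [habs i hi (by omega), h.neg s hs]
        have := hgpos i hi (by omega)
        omega
    have mono : ∀ q q', 1 ≤ q → q < q' → q' ≤ s → (R = {s} → 2 ≤ q) → g q < g q' := by
      intro q q' hq hqq hqs hR
      refine lt_of_le_of_ne ?_ fun h' => by
        have := h.window.2.1 (Finset.mem_coe.2 (hmem q hq (by omega)))
          (Finset.mem_coe.2 (hmem q' (by omega) (by omega))) h'
        omega
      obtain ⟨i, hi, rfl⟩ := exists_posRank_eq h.subset (hmem q hq (by omega))
      obtain ⟨j, hj, rfl⟩ := exists_posRank_eq h.subset (hmem q' (by omega) (by omega))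
      have hi1 := Finset.mem_Icc.1 hi
      have hj1 := Finset.mem_Icc.1 hj
      have his : i ≤ s := by
        by_contra h'
        have := (hbig i (by omega)).2
        omega
      have hjs : j ≤ s := by
        by_contra h'
        have := (hbig j (by omega)).2
        omega
      by_cases hiR : i ∈ R <;> by_cases hjR : j ∈ R
      · rcases lt_trichotomy i j with h1 | rfl | h1
        · have := posRank_lt_of_mem hiR hjR h1; omega
        · omega
        · exact (a1 j hjR i hiR h1).le
      · have hjs' : j < s := lt_of_le_of_ne hjs fun h' => hjR (h' ▸ hs)
        obtain ⟨i', hi'R, hi's, hi'⟩ : ∃ i' ∈ R, i' < s ∧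
            g (posRank R i) ≤ g (posRank R i') := by
          by_cases hieq : i = s
          · subst hieq
            have hne : R ≠ {i} := fun h' => by have := hR h'; omega
            obtain ⟨i', hi', hne'⟩ : ∃ i' ∈ R, i' ≠ i := by
              by_contra! h'
              exact hne (Finset.eq_singleton_iff_unique_mem.2 ⟨hs, h'⟩)
            have hlt : i' < i := lt_of_le_of_ne (hmax i' hi') hne'
            exact ⟨i', hi', hlt, (a1 i' hi' i hs hlt).le⟩
          · exact ⟨i, hiR, lt_of_le_of_ne his hieq, le_rfl⟩
        refine hi'.trans ?_
        rcases lt_trichotomy i' j with h1 | rfl | h1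
        · exact a2 i' j (Finset.mem_Icc.1 (h.subset hi'R)).1 h1 hjs' hjR
        · exact absurd hi'R hjR
        · exact a3 j i' hj1.1 h1 hi'R hi's
      · have := posRank_lt_of_mem_of_notMem h.subset hjR hi1.1 hiR
        omega
      · rcases lt_trichotomy i j with h1 | rfl | h1
        · exact a2 i j hi1.1 h1 (lt_of_le_of_ne hjs fun h' => hjR (h' ▸ hs)) hjR
        · omega
        · have := posRank_lt_of_notMem hjR hiR h1; omega
    refine ⟨?_, fun q hq q' hq' hqq => ?_, fun hR q hq q' hq' hqq => ?_⟩
    · rintro ⟨p, q, l, hp, hpq, hql, hl, hlq, hqp⟩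
      obtain ⟨i, hi, rfl⟩ := exists_posRank_eq h.subset (hmem p hp (by omega))
      have hi1 := Finset.mem_Icc.1 hi
      by_cases hqs : q ≤ s
      · by_cases hR : R = {s} → 2 ≤ posRank R i
        · have := mono _ q hp hpq hqs hR; omega
        · push Not at hR
          obtain ⟨hR, hp2⟩ := hR
          have hp1 : posRank R i = posRank R s := by omega
          have hls : s < l := by
            by_contra h'
            have := mono q l (by omega) hql (by omega) fun _ => by omega
            omega
          obtain ⟨j, hj, rfl⟩ := exists_posRank_eq h.subset (hmem q (by omega) (by omega))
          have hj1 := Finset.mem_Icc.1 hj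
          have hjs : j < s := by
            rcases lt_trichotomy j s with h1 | rfl | h1
            · exact h1
            · omega
            · have := (hbig j h1).2; omega
          obtain ⟨b1, b2⟩ := hbig l hls
          refine c3 ⟨j, s, l, hj1.1, hjs, hls, hl, ?_, ?_⟩
          · rw [habs j hj1.1 hj1.2, h.neg s hs, ← hp1]; omega
          · rw [habs j hj1.1 hj1.2, h.pos l (hmem l (by omega) hl) b1, b2]; omega
      · obtain ⟨b1, b2⟩ := hbig q (by omega)
        obtain ⟨b3, b4⟩ := hbig l (by omega)
        have hiq : i < q := by
          by_cases his : i ≤ s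
          · omega
          · have := (hbig i (by omega)).2; omega
        have hqw := h.pos q (hmem q (by omega) (by omega)) b1
        refine c2 ⟨i, q, l, hi1.1, hiq, hql, hl, ?_, ?_⟩
        · rw [hqw, habs i hi1.1 hi1.2, b2]; omega
        · rw [hqw, h.pos l (hmem l (by omega) hl) b3, b2, b4]; omega
    · have hq := Finset.mem_Icc.1 (Finset.mem_coe.1 hq)
      have hq' := Finset.mem_Icc.1 (Finset.mem_coe.1 hq')
      exact mono q q' (by omega) hqq hq'.2 fun _ => hq.1
    · have hq := Finset.mem_Icc.1 (Finset.mem_coe.1 hq)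
      have hq' := Finset.mem_Icc.1 (Finset.mem_coe.1 hq')
      exact mono q q' hq.1 hqq hq'.2 fun h' => absurd h' hR
  · rintro ⟨hn, m2, m1⟩
    have mono2 : ∀ q q', 2 ≤ q → q < q' → q' ≤ s → g q < g q' := fun q q' h1 h2 h3 =>
      m2 (Finset.mem_coe.2 (Finset.mem_Icc.2 (by omega)))
        (Finset.mem_coe.2 (Finset.mem_Icc.2 (by omega))) h2
    have mono1 : R ≠ {s} → ∀ q q', 1 ≤ q → q < q' → q' ≤ s → g q < g q' :=
      fun hR q q' h1 h2 h3 =>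
      m1 hR (Finset.mem_coe.2 (Finset.mem_Icc.2 (by omega)))
        (Finset.mem_coe.2 (Finset.mem_Icc.2 (by omega))) h2
    have hrs : ∀ i, 1 ≤ i → i ≤ s → posRank R i ≤ s := fun i h1 h2 => posRank_le_of_le h1 h2 hmax
    have a1 : ∀ i ∈ R, ∀ j ∈ R, i < j → ¬ w (j : ℤ) < w (i : ℤ) := by
      intro i hi j hj hij hlt
      have hne : R ≠ {s} := fun hR => by
        rw [hR, Finset.mem_singleton] at hi hj; omega
      have hj1 := Finset.mem_Icc.1 (h.subset hj)
      have hi1 := Finset.mem_Icc.1 (h.subset hi)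
      have := mono1 hne _ _ (one_le_posRank hj1.1) (posRank_lt_of_mem hi hj hij)
        (hrs i hi1.1 (hmax i hi))
      rw [h.neg i hi, h.neg j hj] at hlt
      omega
    refine ⟨h.inB, ?_, ?_, ?_⟩
    · rintro ⟨i, j, hi, hij, hj, hlt, hi0⟩
      exact a1 i (hneg i hi (by omega) hi0) j (hneg j (by omega) hj (by omega)) hij hlt
    · rintro ⟨i, j, k, hi, hij, hjk, hk, hlt, hlt'⟩
      by_cases hjR : j ∈ R
      · refine a1 j hjR k (hneg k (by omega) hk ?_) hjk hlt'
        rw [h.neg j hjR] at hlt'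
        omega
      · have hj' := hmem j (by omega) (by omega)
        rw [habs i hi (by omega), h.pos j hj' hjR] at hlt
        have hij' : posRank R i < posRank R j := by
          by_cases hiR : i ∈ R
          · exact posRank_lt_of_mem_of_notMem h.subset hiR (by omega) hjR
          · exact posRank_lt_of_notMem hiR hjR hij
        by_cases hkR : k ∈ R
        · have hks := hmax k hkR
          have hjs := hrs j (by omega) (by omega)
          by_cases hR : R = {s}
          · have hiR : i ∉ R := fun h' => by
              rw [hR, Finset.mem_singleton] at h' hkR; omega
            have h2 := card_lt_posRank h.subset hi hiR
            rw [hR, Finset.card_singleton, ← hR] at h2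
            have := mono2 _ _ h2 hij' hjs
            omega
          · have := mono1 hR _ _ (one_le_posRank hi) hij' hjs
            omega
        · rw [h.pos j hj' hjR, h.pos k (hmem k (by omega) hk) hkR] at hlt'
          exact hn ⟨_, _, _, one_le_posRank hi, hij', posRank_lt_of_notMem hjR hkR hjk,
            (Finset.mem_Icc.1 (posRank_mem h.subset (hmem k (by omega) hk))).2, by omega, by omega⟩
    · rintro ⟨i, j, k, hi, hij, hjk, hk, hlt, hlt'⟩
      have hjR : j ∈ R := hneg j (by omega) (by omega) (by have := abs_nonneg (w (i : ℤ)); omega)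
      have hjs := hmax j hjR
      rw [habs i hi (by omega), h.neg j hjR, neg_neg] at hlt
      have hji : posRank R j < posRank R i := by
        by_cases hiR : i ∈ R
        · exact posRank_lt_of_mem hiR hjR hij
        · exact posRank_lt_of_mem_of_notMem h.subset hjR hi hiR
      have his := hrs i hi (by omega)
      by_cases hR : R = {s}
      · have hjs' : j = s := by rw [hR, Finset.mem_singleton] at hjR; exact hjR
        obtain ⟨b1, b2⟩ := hbig k (by omega)
        rw [habs i hi (by omega), h.pos k (hmem k (by omega) hk) b1, b2] at hlt'
        exact hn ⟨_, _, k, one_le_posRank (by omega), hji, by omega, hk, by omega, by omega⟩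
      · have := mono1 hR _ _ (one_le_posRank (by omega)) hji his
        omega

lemma Represents.isFC_iff_empty {n : ℕ} {g : ℕ → ℕ} {w : Equiv.Perm ℤ}
    (h : Represents n ∅ g w) : IsFC n w ↔ NoDec n g := by
  have hw : ∀ i, 1 ≤ i → i ≤ n → w (i : ℤ) = g i := fun i h1 h2 => by
    rw [h.pos i (Finset.mem_Icc.2 ⟨h1, h2⟩) (Finset.notMem_empty i),
      posRank_of_forall_le fun j hj => absurd hj (Finset.notMem_empty j)]
  constructor
  · rintro ⟨-, -, c2, -⟩ ⟨i, j, k, hi, hij, hjk, hk, h1, h2⟩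
    refine c2 ⟨i, j, k, hi, hij, hjk, hk, ?_, ?_⟩
    · rw [hw i hi (by omega), hw j (by omega) (by omega), Nat.abs_cast]; omega
    · rw [hw j (by omega) (by omega), hw k (by omega) hk]; omega
  · intro hn
    refine ⟨h.inB, ?_, ?_, ?_⟩
    · rintro ⟨i, j, hi, hij, hj, -, h0⟩
      rw [hw i hi (by omega)] at h0
      omega
    · rintro ⟨i, j, k, hi, hij, hjk, hk, h1, h2⟩
      rw [hw i hi (by omega), hw j (by omega) (by omega), Nat.abs_cast] at h1
      rw [hw j (by omega) (by omega), hw k (by omega) hk] at h2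
      exact hn ⟨i, j, k, hi, hij, hjk, hk, by omega, by omega⟩
    · rintro ⟨i, j, k, hi, hij, hjk, hk, h1, -⟩
      rw [hw i hi (by omega), hw j (by omega) (by omega), Nat.abs_cast] at h1
      omega

/-- The set of negative positions, together with the later positions with small entries. -/
def shape (n : ℕ) (w : Equiv.Perm ℤ) : Finset ℕ :=
  NegSet n w ∪ (Finset.Icc 1 n).filter fun i => (NegSet n w).sup id < i ∧ w (i : ℤ) < i

lemma sup_id_mem {R : Finset ℕ} (h : R ≠ ∅) : R.sup id ∈ R := by
  obtain ⟨s, hs, hs'⟩ := Finset.exists_mem_eq_sup R (Finset.nonempty_iff_ne_empty.2 h) id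
  rw [hs']; exact hs

lemma le_sup_id {R : Finset ℕ} {j : ℕ} (hj : j ∈ R) : j ≤ R.sup id := Finset.le_sup (f := id) hj

lemma Represents.apply_of_lt {n : ℕ} {R : Finset ℕ} {g : ℕ → ℕ} {w : Equiv.Perm ℤ}
    (h : Represents n R g w) {i : ℕ} (hi : i ∈ Finset.Icc 1 n) (his : R.sup id < i) :
    w (i : ℤ) = g i := by
  have h1 : ∀ j ∈ R, j < i := fun j hj => (le_sup_id hj).trans_lt his
  rw [h.pos i hi fun h' => lt_irrefl _ (h1 i h'), posRank_of_forall_le h1]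

lemma Represents.shape_eq {n : ℕ} {R : Finset ℕ} {g : ℕ → ℕ} {w : Equiv.Perm ℤ}
    (h : Represents n R g w) :
    shape n w = R ∪ (deficients n g).filter (R.sup id < ·) := by
  rw [shape, h.negSet_eq, deficients, Finset.filter_filter]
  congr 1
  refine Finset.filter_congr fun i hi => ?_
  rw [and_comm]
  refine and_congr_left fun his => ?_
  rw [h.apply_of_lt hi his, Nat.cast_lt]

lemma shape_subset (n : ℕ) (w : Equiv.Perm ℤ) : shape n w ⊆ Finset.Icc 1 n :=
  Finset.union_subset (Finset.filter_subset _ _) (Finset.filter_subset _ _)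

lemma NoDec.lt_iff {n i : ℕ} {g : ℕ → ℕ} (hg : IsWindow n g) (hn : NoDec n g) (h1 : 1 ≤ i)
    (hi : i < n) : g (i + 1) < g i ↔ i ∉ deficients n g ∧ i + 1 ∈ deficients n g := by
  have hi' : i ∈ Finset.Icc 1 n := Finset.mem_Icc.2 (by omega)
  have hi1 : i + 1 ∈ Finset.Icc 1 n := Finset.mem_Icc.2 (by omega)
  constructor
  · intro hlt
    by_cases a : i ∈ deficients n g <;> by_cases b : i + 1 ∈ deficients n g
    · have := (hn.strictMonoOn hg).1 a b (Nat.lt_succ_self i); omega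
    · have a' := (Finset.mem_filter.1 a).2
      rw [not_mem_deficients hi1] at b
      omega
    · exact ⟨a, b⟩
    · have := (hn.strictMonoOn hg).2 (Finset.mem_coe.2 (Finset.mem_sdiff.2 ⟨hi', a⟩))
        (Finset.mem_coe.2 (Finset.mem_sdiff.2 ⟨hi1, b⟩)) (Nat.lt_succ_self i)
      omega
  · rintro ⟨a, b⟩
    rw [not_mem_deficients hi'] at a
    have b := (Finset.mem_filter.1 b).2
    refine lt_of_le_of_ne (by omega) fun h => ?_
    have := hg.2.1 hi1 hi' h
    omega

lemma IsFC.noDec {n : ℕ} {R : Finset ℕ} {g : ℕ → ℕ} {w : Equiv.Perm ℤ} (hw : IsFC n w)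
    (h : Represents n R g w) : NoDec n g := by
  by_cases hR : R = ∅
  · subst hR
    exact h.isFC_iff_empty.1 hw
  · exact ((h.isFC_iff_of_mem (sup_id_mem hR) fun j => le_sup_id).1 hw).1

theorem IsFC.desB_eq {n : ℕ} {w : Equiv.Perm ℤ} (hw : IsFC n w) :
    DesB n w = DesBSet n (shape n w) := by
  obtain ⟨R, g, h⟩ := hw.1.exists_represents
  have hn := hw.noDec h
  have hmem : ∀ i, 1 ≤ i → i ≤ n → i ∈ Finset.Icc 1 n := fun i h1 h2 => Finset.mem_Icc.2 ⟨h1, h2⟩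
  have hneg : ∀ i, 1 ≤ i → i ≤ n → (w (i : ℤ) < 0 ↔ i ∈ R) := fun i h1 h2 => by
    rw [← h.negSet_eq, NegSet, Finset.mem_filter, and_iff_right (hmem i h1 h2)]
  have hle : ∀ i, i ≤ R.sup id → (i ∈ shape n w ↔ i ∈ R) := fun i hi => by
    rw [h.shape_eq, Finset.mem_union, Finset.mem_filter]
    exact or_iff_left fun h' => absurd h'.2 (by omega)
  have hlt : ∀ i, R.sup id < i → (i ∈ shape n w ↔ i ∈ deficients n g) := fun i hi => by
    rw [h.shape_eq, Finset.mem_union, Finset.mem_filter, and_iff_left hi, or_iff_right]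
    intro h'; have := le_sup_id h'; omega
  ext p
  rw [mem_DesBSet (shape_subset n w), DesB, Finset.mem_filter, Finset.mem_range]
  by_cases hp : p < n
  swap
  · refine iff_of_false (fun h' => hp h'.1) fun h' => ?_
    have := Finset.mem_Icc.1 (shape_subset n w h'.2)
    omega
  rw [and_iff_right hp, went, if_neg (Nat.succ_ne_zero p), went]
  rcases Nat.eq_zero_or_pos p with rfl | hp0
  · have h0 : 0 ∉ shape n w := fun h' => by
      have := Finset.mem_Icc.1 (shape_subset n w h'); omega
    rw [if_pos rfl, hneg _ (by omega) (by omega), and_iff_right h0]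
    by_cases h1 : 0 + 1 ≤ R.sup id
    · rw [hle _ h1]
    · rw [hlt _ (not_le.1 h1)]
      refine iff_of_false (fun h' => h1 (le_sup_id h')) (one_notMem_deficients h.window)
  · rw [if_neg (by omega)]
    rcases lt_trichotomy p (R.sup id) with h1 | h1 | h1
    · rw [hle p h1.le, hle (p + 1) h1]
      have hR : R ≠ ∅ := fun hR => by rw [hR] at h1; simp at h1
      have hs := sup_id_mem hR
      have hsn := Finset.mem_Icc.1 (h.subset hs)
      have e1 := hneg p hp0 hp.le
      have e2 := hneg (p + 1) (by omega) hp
      have e3 := (hneg _ hsn.1 hsn.2).2 hs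
      by_cases a : p ∈ R <;> by_cases b : p + 1 ∈ R
      · refine iff_of_false (fun hd => ?_) fun h' => h'.1 a
        exact hw.2.1 ⟨p, p + 1, hp0, by omega, hp, hd, e1.2 a⟩
      · refine iff_of_false (fun hd => b (e2.1 (hd.trans (e1.2 a)))) fun h' => h'.1 a
      · refine iff_of_true ?_ ⟨a, b⟩
        exact (e2.2 b).trans_le (not_lt.1 fun h' => a (e1.1 h'))
      · refine iff_of_false (fun hd => ?_) fun h' => b h'.2
        have hps : p + 1 < R.sup id := lt_of_le_of_ne h1 fun h' => b (h' ▸ hs)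
        refine hw.2.2.1 ⟨p, p + 1, R.sup id, hp0, by omega, hps, hsn.2, hd.trans_le (le_abs_self _), ?_⟩
        exact e3.trans_le (not_lt.1 fun h' => b (e2.1 h'))
    · have hR : R ≠ ∅ := fun hR => by rw [hR] at h1; simp at h1; omega
      have hs := sup_id_mem hR
      rw [← h1] at hs
      refine iff_of_false (fun hd => ?_) fun h' => h'.1 ((hle p h1.le).2 hs)
      have := (hneg (p + 1) (by omega) hp).1 (hd.trans ((hneg p hp0 hp.le).2 hs))
      have := le_sup_id this
      omega
    · rw [h.apply_of_lt (hmem p hp0 hp.le) h1, h.apply_of_lt (hmem (p + 1) (by omega) hp) (by omega),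
        hlt p h1, hlt (p + 1) (by omega), Nat.cast_lt, hn.lt_iff h.window hp0 hp]

/-- The signed permutation represented by `R` and `g`. -/
def signedPerm (n : ℕ) (R : Finset ℕ) (g : ℕ → ℕ) : Equiv.Perm ℤ :=
  if h : ∃ w, Represents n R g w then h.choose else 1

lemma represents_signedPerm {n : ℕ} {R : Finset ℕ} {g : ℕ → ℕ} (hR : R ⊆ Finset.Icc 1 n)
    (hg : IsWindow n g) : Represents n R g (signedPerm n R g) := by
  have h := exists_represents hR hg
  rw [signedPerm, dif_pos h]
  exact h.choose_spec

/-- The fully commutative elements of `B_n`. -/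
def fcPerms (n : ℕ) : Finset (Equiv.Perm ℤ) :=
  (((Finset.Icc 1 n).powerset ×ˢ windows n).image fun p => signedPerm n p.1 p.2).filter (IsFC n)

lemma mem_fcPerms {n : ℕ} {w : Equiv.Perm ℤ} : w ∈ fcPerms n ↔ IsFC n w := by
  rw [fcPerms, Finset.mem_filter, and_iff_right_iff_imp]
  intro hw
  obtain ⟨R, g, h⟩ := hw.1.exists_represents
  exact Finset.mem_image.2 ⟨(R, g), Finset.mem_product.2 ⟨Finset.mem_powerset.2 h.subset,
    mem_windows.2 h.window⟩, (represents_signedPerm h.subset h.window).eq h⟩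

section
open Polynomial

/-- The part of the block enumeration coming from elements with negative positions `R`. -/
def negSum (n : ℕ) (S R : Finset ℕ) : ℤ[X] :=
  ∑ g ∈ (windows n).filter fun g => IsFC n (signedPerm n R g) ∧ shape n (signedPerm n R g) = S,
    X ^ blocks n g

lemma sum_fcPerms_eq_sum_negSum {n : ℕ} (hn : 0 < n) (S : Finset ℕ) :
    ∑ w ∈ (fcPerms n).filter fun w => shape n w = S, (X : ℤ[X]) ^ bl n w⁻¹ =
      ∑ R ∈ (Finset.Icc 1 n).powerset, negSum n S R := by
  have hrep : ∀ p ∈ (Finset.Icc 1 n).powerset ×ˢ windows n,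
      Represents n p.1 p.2 (signedPerm n p.1 p.2) := fun p hp =>
    represents_signedPerm (Finset.mem_powerset.1 (Finset.mem_product.1 hp).1)
      (mem_windows.1 (Finset.mem_product.1 hp).2)
  rw [fcPerms, Finset.filter_filter, Finset.sum_filter, Finset.sum_image, Finset.sum_product]
  · refine Finset.sum_congr rfl fun R hR => ?_
    rw [negSum, Finset.sum_filter]
    refine Finset.sum_congr rfl fun g hg => ?_
    rw [(hrep (R, g) (Finset.mem_product.2 ⟨hR, hg⟩)).bl_inv hn]
  · intro p hp q hq hpq
    have h1 := hrep p hp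
    have h2 := hrep q hq
    simp only at hpq
    rw [hpq] at h1
    obtain ⟨h3, h4⟩ := h1.inj h2
    exact Prod.ext h3 h4

lemma negSum_empty {n : ℕ} {S : Finset ℕ} (hS : S ⊆ Finset.Icc 1 n) :
    negSum n S ∅ = fpoly S n := by
  rw [← sum_windows_deficients hS, negSum]
  refine Finset.sum_congr (Finset.filter_congr fun g hg => ?_) fun _ _ => rfl
  have h := represents_signedPerm (Finset.empty_subset _) (mem_windows.1 hg)
  rw [h.isFC_iff_empty, h.shape_eq, Finset.empty_union, Finset.filter_true_of_mem]
  intro i hi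
  have := Finset.mem_Icc.1 (Finset.mem_filter.1 hi).1
  simp only [Finset.sup_empty, Nat.bot_eq_zero]
  omega

lemma union_filter_eq_iff {R D S : Finset ℕ} {s : ℕ} (hmax : ∀ j ∈ R, j ≤ s) :
    R ∪ D.filter (s < ·) = S ↔ R = S.filter (· ≤ s) ∧ D.filter (s < ·) = S.filter (s < ·) := by
  constructor
  · rintro rfl
    constructor <;> ext i <;> simp only [Finset.mem_filter, Finset.mem_union]
    · constructor
      · exact fun hi => ⟨Or.inl hi, hmax i hi⟩
      · rintro ⟨h | h, h'⟩
        · exact h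
        · omega
    · constructor
      · exact fun hi => ⟨Or.inr hi, hi.2⟩
      · rintro ⟨h | h, h'⟩
        · have := hmax i h; omega
        · exact h
  · rintro ⟨h1, h2⟩
    rw [h1, h2, ← Finset.filter_or]
    exact Finset.filter_true_of_mem fun i _ => by omega

lemma negSum_filter_le {n s : ℕ} {S : Finset ℕ} (hS : S ⊆ Finset.Icc 1 n) (hs : s ∈ S) :
    negSum n S (S.filter (· ≤ s)) =
      fpoly (S.filter (s < ·)) n + if S.filter (· ≤ s) = {s} then fpoly S n else 0 := by
  have hsR : s ∈ S.filter (· ≤ s) := Finset.mem_filter.2 ⟨hs, le_rfl⟩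
  have hmax : ∀ j ∈ S.filter (· ≤ s), j ≤ s := fun j hj => (Finset.mem_filter.1 hj).2
  have hsup : (S.filter (· ≤ s)).sup id = s :=
    le_antisymm (Finset.sup_le hmax) (le_sup_id hsR)
  have hsn := Finset.mem_Icc.1 (hS hs)
  have hiff : ∀ g ∈ windows n, (IsFC n (signedPerm n (S.filter (· ≤ s)) g) ∧
      shape n (signedPerm n (S.filter (· ≤ s)) g) = S ↔
      (NoDec n g ∧ StrictMonoOn g (Finset.Icc 2 s : Finset ℕ) ∧
      (S.filter (· ≤ s) ≠ {s} → StrictMonoOn g (Finset.Icc 1 s : Finset ℕ))) ∧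
      (deficients n g).filter (s < ·) = S.filter (s < ·)) := by
    intro g hg
    have h := represents_signedPerm ((Finset.filter_subset (· ≤ s) S).trans hS) (mem_windows.1 hg)
    rw [h.isFC_iff_of_mem hsR hmax, h.shape_eq, hsup, union_filter_eq_iff hmax,
      and_iff_right rfl]
  rw [negSum]
  split_ifs with h1
  · rw [← sum_windows_Icc_two hS hs]
    · refine Finset.sum_congr (Finset.filter_congr fun g hg => ?_) fun _ _ => rfl
      rw [hiff g hg]
      tauto
    · intro i hi
      by_contra his
      have : i ∈ S.filter (· ≤ s) := Finset.mem_filter.2 ⟨hi, by omega⟩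
      rw [h1, Finset.mem_singleton] at this
      omega
  · rw [add_zero, ← sum_windows_Icc_one hS hsn.2]
    refine Finset.sum_congr (Finset.filter_congr fun g hg => ?_) fun _ _ => rfl
    rw [hiff g hg]
    have : StrictMonoOn g (Finset.Icc 1 s : Finset ℕ) → StrictMonoOn g (Finset.Icc 2 s : Finset ℕ) :=
      fun h => h.mono (by exact_mod_cast Finset.Icc_subset_Icc_left (by omega))
    tauto

lemma negSum_eq_zero {n : ℕ} {S R : Finset ℕ} (hR : R ⊆ Finset.Icc 1 n) (h0 : R ≠ ∅)
    (h : ∀ s ∈ S, S.filter (· ≤ s) ≠ R) : negSum n S R = 0 := by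
  rw [negSum, Finset.filter_false_of_mem, Finset.sum_empty]
  rintro g hg ⟨-, h2⟩
  rw [(represents_signedPerm hR (mem_windows.1 hg)).shape_eq,
    union_filter_eq_iff fun j => le_sup_id] at h2
  have h3 := sup_id_mem h0
  rw [h2.1] at h3
  have h4 := (Finset.mem_filter.1 h3).1
  rw [← h2.1] at h4
  exact h _ h4 h2.1.symm

theorem sum_fcPerms {n : ℕ} (hn : 0 < n) {S : Finset ℕ} (hS : S ⊆ Finset.Icc 1 n) :
    ∑ w ∈ (fcPerms n).filter fun w => shape n w = S, (X : ℤ[X]) ^ bl n w⁻¹ =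
      hpoly S n + if S = ∅ then 0 else fpoly S n := by
  have hsub : insert ∅ (S.image fun s => S.filter (· ≤ s)) ⊆ (Finset.Icc 1 n).powerset := by
    intro R hR
    rw [Finset.mem_powerset]
    rcases Finset.mem_insert.1 hR with rfl | hR
    · exact Finset.empty_subset _
    · obtain ⟨s, -, rfl⟩ := Finset.mem_image.1 hR
      exact (Finset.filter_subset _ _).trans hS
  rw [sum_fcPerms_eq_sum_negSum hn, ← Finset.sum_subset hsub, Finset.sum_insert, Finset.sum_image,
    Finset.sum_congr rfl fun s hs => negSum_filter_le hS hs, Finset.sum_add_distrib,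
    negSum_empty hS, hpoly_eq, Finset.filter_mem_eq_inter, Finset.inter_eq_right.2 hS, ← add_assoc]
  · congr 1
    by_cases h0 : S = ∅
    · rw [if_pos h0, h0, Finset.sum_empty]
    · have hne := Finset.nonempty_iff_ne_empty.2 h0
      rw [if_neg h0, Finset.sum_eq_single (S.min' hne), if_pos]
      · ext i
        rw [Finset.mem_filter, Finset.mem_singleton]
        constructor
        · rintro ⟨h1, h2⟩; exact le_antisymm h2 (S.min'_le i h1)
        · rintro rfl; exact ⟨S.min'_mem hne, le_rfl⟩
      · intro s hs hsne
        refine if_neg fun h1 => hsne ?_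
        have : S.min' hne ∈ S.filter (· ≤ s) :=
          Finset.mem_filter.2 ⟨S.min'_mem hne, S.min'_le s hs⟩
        rw [h1, Finset.mem_singleton] at this
        exact this.symm
      · exact fun h1 => absurd (S.min'_mem hne) h1
  · intro s hs t ht hst
    simp only at hst
    have h1 : s ∈ S.filter (· ≤ t) := hst ▸ Finset.mem_filter.2 ⟨hs, le_rfl⟩
    have h2 : t ∈ S.filter (· ≤ s) := hst ▸ Finset.mem_filter.2 ⟨ht, le_rfl⟩
    exact le_antisymm (Finset.mem_filter.1 h1).2 (Finset.mem_filter.1 h2).2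
  · intro h
    obtain ⟨s, hs, hs'⟩ := Finset.mem_image.1 h
    have : s ∈ S.filter (· ≤ s) := Finset.mem_filter.2 ⟨hs, le_rfl⟩
    rw [hs'] at this
    exact absurd this (Finset.notMem_empty s)
  · intro R hR hR'
    rw [Finset.mem_insert, not_or] at hR'
    exact negSum_eq_zero (Finset.mem_powerset.1 hR) hR'.1 fun s hs h =>
      hR'.2 (Finset.mem_image.2 ⟨s, hs, h⟩)

end

section
open Polynomial

theorem sum_FB_eq {n : ℕ} (hn : 0 < n) :
    ∑ w ∈ fcPerms n, (X ^ bl n w⁻¹ : ℤ[X]) • FB ℤ[X] n (DesB n w) =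
      ∑ k ∈ Finset.Icc 1 n,
        (∑ j ∈ Finset.range (n + 1), (bCoeff n k j : ℤ[X]) * X ^ j) •
          (hSeries ℤ[X] 1 k * hSeries ℤ[X] 0 (n - k))
      + ∑ k ∈ Finset.range (n / 2 + 1),
        (∑ j ∈ Finset.range (n + 1), (aCoeff n k j : ℤ[X]) * X ^ j) •
          schurS ℤ[X] 0 (twoRow (n - k) k) := by
  ext1 m
  obtain ⟨N, hN⟩ := finsupp_bound m
  have hterm : ∀ w ∈ fcPerms n,
      MvPowerSeries.coeff m ((X ^ bl n w⁻¹ : ℤ[X]) • FB ℤ[X] n (DesB n w)) =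
        if ∑ i ∈ Finset.range (N + 1), m i = n then
          if shape n w ∈ allowedSets m n then X ^ bl n w⁻¹ else 0 else 0 := fun w hw => by
    have hFB : MvPowerSeries.coeff m (FB ℤ[X] n (DesB n w)) = _ :=
      coeff_FB ℤ[X] (J := DesB n w) (fun j hj => Finset.mem_range.1 (Finset.mem_filter.1 hj).1) hN
    have hmem : shape n w ∈ allowedSets m n ↔ ∀ j ∈ DesBSet n (shape n w), IsCut m j := by
      rw [allowedSets, Finset.mem_filter, Finset.mem_powerset, and_iff_right (shape_subset n w)]
    rw [MvPowerSeries.coeff_smul, hFB, (mem_fcPerms.1 hw).desB_eq]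
    simp only [hmem, ite_and, mul_ite, mul_one, mul_zero]
  rw [coeff_rhs hN, map_sum, Finset.sum_congr rfl hterm]
  split_ifs with hm
  · rw [← Finset.sum_filter, ← Finset.sum_fiberwise_of_maps_to
      (s := (fcPerms n).filter fun w => shape n w ∈ allowedSets m n) (g := shape n)
      (fun w hw => (Finset.mem_filter.1 hw).2)]
    refine Finset.sum_congr rfl fun S hS => ?_
    rw [← sum_fcPerms hn (mem_allowedSets.1 hS).1, Finset.filter_filter]
    refine Finset.sum_congr (Finset.filter_congr fun w _ => ?_) fun _ _ => rfl
    exact and_iff_right_of_imp fun h => h ▸ hS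
  · exact Finset.sum_const_zero

lemma map_FB (n : ℕ) (J : Finset ℕ) : MvPowerSeries.map (C : ℤ →+* ℤ[X]) (FB ℤ n J) = FB ℤ[X] n J := by
  ext1 m
  rw [MvPowerSeries.coeff_map]
  exact map_natCast C _

lemma map_hSeries (s k : ℕ) : MvPowerSeries.map (C : ℤ →+* ℤ[X]) (hSeries ℤ s k) = hSeries ℤ[X] s k := by
  ext1 m
  rw [MvPowerSeries.coeff_map]
  change C (ite _ _ _) = ite _ _ _
  split_ifs <;> simp

lemma map_schurS (s : ℕ) (lam : ℕ → ℕ) :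
    MvPowerSeries.map (C : ℤ →+* ℤ[X]) (schurS ℤ s lam) = schurS ℤ[X] s lam := by
  ext1 m
  rw [MvPowerSeries.coeff_map]
  exact map_natCast C _

lemma coeff_coeff_smul_map (m : ℕ →₀ ℕ) (j : ℕ) (p : ℤ[X]) (F : MvPowerSeries ℕ ℤ) :
    (MvPowerSeries.coeff m (p • MvPowerSeries.map C F)).coeff j =
      MvPowerSeries.coeff m (p.coeff j • F) := by
  rw [MvPowerSeries.coeff_smul, MvPowerSeries.coeff_map, coeff_mul_C, map_zsmul, smul_eq_mul]

lemma coeff_sum_natCast_mul_X_pow {n j : ℕ} (hj : j ≤ n) (a : ℕ → ℕ) :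
    (∑ i ∈ Finset.range (n + 1), (a i : ℤ[X]) * X ^ i).coeff j = (a j : ℤ) := by
  simp [finsetSum_coeff, coeff_natCast_mul, coeff_X_pow, hj]

/-- The coefficient of `q ^ j` in the generating function of `FC(B_n)`. -/
theorem sum_FB_bl_eq {n j : ℕ} (hn : 0 < n) (hj : j ≤ n) :
    ∑ w ∈ (fcPerms n).filter fun w => bl n w⁻¹ = j, FB ℤ n (DesB n w) =
      ∑ k ∈ Finset.Icc 1 n, bCoeff n k j • (hSeries ℤ 1 k * hSeries ℤ 0 (n - k))
      + ∑ k ∈ Finset.range (n / 2 + 1), aCoeff n k j • schurS ℤ 0 (twoRow (n - k) k) := by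
  ext1 m
  have h := congrArg (fun F => (MvPowerSeries.coeff m F).coeff j) (sum_FB_eq hn)
  simp only [← map_FB, ← map_hSeries, ← map_schurS, ← map_mul, map_add, map_sum, coeff_add,
    finsetSum_coeff, coeff_coeff_smul_map, coeff_sum_natCast_mul_X_pow hj, coeff_X_pow] at h
  simp only [map_add, map_sum, map_nsmul]
  simp only [map_zsmul, Nat.cast_smul_eq_nsmul, map_nsmul] at h
  rw [Finset.sum_filter]
  simpa [eq_comm] using h

end

section ChowPos

variable {n : ℕ} {F G : MvPowerSeries ℕ ℤ}

lemma ChowPos.zero (n : ℕ) : ChowPos n 0 := ⟨0, by simp⟩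

lemma ChowPos.add (hF : ChowPos n F) (hG : ChowPos n G) : ChowPos n (F + G) := by
  obtain ⟨c, rfl⟩ := hF
  obtain ⟨d, rfl⟩ := hG
  refine ⟨c + d, ?_⟩
  simp only [Pi.add_apply, Nat.cast_add, add_smul, Finset.sum_add_distrib]

lemma ChowPos.nsmul (a : ℕ) (hF : ChowPos n F) : ChowPos n (a • F) := by
  induction a with
  | zero => rw [zero_smul]; exact .zero n
  | succ a ih => rw [succ_nsmul]; exact ih.add hF

lemma ChowPos.sum {s : Finset ℕ} {f : ℕ → MvPowerSeries ℕ ℤ} (h : ∀ k ∈ s, ChowPos n (f k)) :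
    ChowPos n (∑ k ∈ s, f k) :=
  Finset.sum_induction f (ChowPos n) (fun _ _ => .add) (.zero n) h

lemma chowPos_schurS_mul {k : ℕ} (hk : k ≤ n) (p : Nat.Partition k) (q : Nat.Partition (n - k)) :
    ChowPos n (schurS ℤ 1 (partFun p) * schurS ℤ 0 (partFun q)) := by
  refine ⟨Pi.single ⟨⟨k, Nat.lt_succ_of_le hk⟩, p, q⟩ 1, ?_⟩
  rw [Finset.sum_eq_single (⟨⟨k, Nat.lt_succ_of_le hk⟩, p, q⟩ :
    Σ k : Fin (n + 1), Nat.Partition (k : ℕ) × Nat.Partition (n - (k : ℕ)))]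
  · rw [Pi.single_eq_same, Nat.cast_one, one_smul]
  · intro b _ hb
    rw [Pi.single_eq_of_ne hb, Nat.cast_zero, zero_smul]
  · exact fun h => absurd (Finset.mem_univ _) h

lemma exists_partFun_eq_twoRow {m a b : ℕ} (hab : b ≤ a) (hm : a + b = m) :
    ∃ p : Nat.Partition m, partFun p = twoRow a b := by
  rcases Nat.eq_zero_or_pos b with rfl | hb
  · rcases Nat.eq_zero_or_pos a with rfl | ha
    · refine ⟨⟨0, by simp, by simpa using hm⟩, funext fun i => ?_⟩
      simp [partFun, twoRow]
    · refine ⟨⟨{a}, by simpa using ha, by simpa using hm⟩, funext fun i => ?_⟩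
      rcases i with _ | i <;> simp [partFun, twoRow]
  · refine ⟨⟨b ::ₘ {a}, by simp; omega, by simp; omega⟩, funext fun i => ?_⟩
    have : (b ::ₘ ({a} : Multiset ℕ)).sort (· ≤ ·) = [b, a] := by
      rw [Multiset.sort_cons _ _ _ (by simpa using hab), Multiset.sort_singleton]
    rcases i with _ | _ | i <;> simp [partFun, twoRow, this]

lemma chowPos_hSeries_mul {k : ℕ} (hk : k ≤ n) :
    ChowPos n (hSeries ℤ 1 k * hSeries ℤ 0 (n - k)) := by
  obtain ⟨p, hp⟩ := exists_partFun_eq_twoRow (Nat.zero_le k) (add_zero k)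
  obtain ⟨q, hq⟩ := exists_partFun_eq_twoRow (Nat.zero_le (n - k)) (add_zero (n - k))
  rw [← schurS_twoRow_zero, ← schurS_twoRow_zero, ← hp, ← hq]
  exact chowPos_schurS_mul hk p q

lemma hSeries_one_zero : hSeries ℤ 1 0 = 1 := by
  ext1 m
  rw [MvPowerSeries.coeff_one]
  change ite _ _ _ = _
  refine if_congr ⟨fun h => ?_, ?_⟩ rfl rfl
  · ext v
    by_contra hv
    exact hv (Finset.sum_eq_zero_iff.1 h.1 v (Finsupp.mem_support_iff.2 hv))
  · rintro rfl
    simp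

lemma chowPos_schurS_twoRow {k : ℕ} (hk : 2 * k ≤ n) :
    ChowPos n (schurS ℤ 0 (twoRow (n - k) k)) := by
  obtain ⟨p, hp⟩ := exists_partFun_eq_twoRow le_rfl (add_zero 0)
  obtain ⟨q, hq⟩ := exists_partFun_eq_twoRow (m := n - 0) (a := n - k) (b := k)
    (by omega) (by omega)
  have := chowPos_schurS_mul (Nat.zero_le n) p q
  rwa [hp, hq, schurS_twoRow_zero, hSeries_one_zero, one_mul] at this

end ChowPos

theorem chow_schur_positivity_FC_Bn (n : ℕ) (hn : 0 < n) :
    ((∑ᶠ w ∈ {w : Equiv.Perm ℤ | IsFC n w},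
        (Polynomial.X ^ bl n w⁻¹ : Polynomial ℤ) • FB (Polynomial ℤ) n (DesB n w)) =
      ∑ k ∈ Finset.Icc 1 n,
        (∑ j ∈ Finset.range (n + 1), (bCoeff n k j : Polynomial ℤ) * Polynomial.X ^ j) •
          (hSeries (Polynomial ℤ) 1 k * hSeries (Polynomial ℤ) 0 (n - k))
      + ∑ k ∈ Finset.range (n / 2 + 1),
        (∑ j ∈ Finset.range (n + 1), (aCoeff n k j : Polynomial ℤ) * Polynomial.X ^ j) •
          schurS (Polynomial ℤ) 0 (twoRow (n - k) k)) ∧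
    ∀ j : ℕ, 1 ≤ j → j ≤ n →
      ChowPos n (∑ᶠ w ∈ {w : Equiv.Perm ℤ | IsFC n w ∧ bl n w⁻¹ = j},
        FB ℤ n (DesB n w)) := by
  refine ⟨?_, fun j _ hj => ?_⟩
  · have h : {w : Equiv.Perm ℤ | IsFC n w} = ↑(fcPerms n) :=
      Set.ext fun w => mem_fcPerms.symm
    rw [h, finsum_mem_coe_finset, sum_FB_eq hn]
  · have h : {w : Equiv.Perm ℤ | IsFC n w ∧ bl n w⁻¹ = j} =
        ↑((fcPerms n).filter fun w => bl n w⁻¹ = j) :=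
      Set.ext fun w => by simp [mem_fcPerms]
    rw [h, finsum_mem_coe_finset, sum_FB_bl_eq hn hj]
    refine .add (.sum fun k hk => .nsmul _ (chowPos_hSeries_mul (Finset.mem_Icc.1 hk).2))
      (.sum fun k hk => .nsmul _ (chowPos_schurS_twoRow ?_))
    have := Finset.mem_range.1 hk
    omega

end Paper
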